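/- Let Q and Q′ be normal coordinates for germs at 0 of real-analytic hypersurfaces M, M′ ⊂ ℂ², neither Levi-flat near 0. For every integer k ≥ 0 there exists a ℂ²-valued function Φ^k(z, Λ₁, Λ̃₁, Λ₂, Λ̃₂), polynomial in (Λ₂, Λ̃₂) ∈ ℂ^{N_{k+1}} × ℂ^{N_{k+1}} with coefficients holomorphic in (z, Λ₁, Λ̃₁) on a neighborhood of {0} × T(ℂ²) × conj(T(ℂ²)) in ℂ × ℂ^{2×2} × ℂ^{2×2}, depending only on Q and Q′, such that every local biholomorphism H : (ℂ²,0) → (ℂ²,0) satisfying the mapping identity for (Q,Q′) obeys ∂_w^k H(z,0) = Φ^k(z, H′(0), conj(H′(0)), j^{k+1}₀H, conj(j^{k+1}₀H)) for all z ∈ ℂ near 0. -/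

import Mathlib

open Filter Topology Matrix

noncomputable section

/-- Complex conjugation as a plain function. -/
def cj : ℂ → ℂ := (starRingEnd ℂ)

/-- Iterated partial derivative `∂_z^i ∂_w^j F (z, w)` of `F : ℂ → ℂ → ℂ`. -/
def pd (F : ℂ → ℂ → ℂ) (i j : ℕ) (z w : ℂ) : ℂ :=
  deriv^[i] (fun z' => deriv^[j] (F z') w) z

/-- `Q` is a normal-coordinates defining function (near `0`) of a germ of a
real-analytic hypersurface in `ℂ²`. -/
def IsNormalCoord (Q : ℂ → ℂ → ℂ → ℂ) : Prop :=
  AnalyticAt ℂ (fun p : ℂ × ℂ × ℂ => Q p.1 p.2.1 p.2.2) 0 ∧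
  (∀ᶠ p : ℂ × ℂ in 𝓝 0, Q p.1 0 p.2 = p.2) ∧
  (∀ᶠ p : ℂ × ℂ in 𝓝 0, Q 0 p.1 p.2 = p.2) ∧
  (∀ᶠ p : ℂ × ℂ × ℂ in 𝓝 0, Q p.1 p.2.1 (cj (Q (cj p.2.1) (cj p.1) (cj p.2.2))) = p.2.2)

/-- The mapping identity expressing that the germ at `0` of the holomorphic map
`H = (F, G)` (with `H(0) = 0`) sends the hypersurface defined by `Q` into the one
defined by `Q'`. -/
def SendsInto (Q Q' : ℂ → ℂ → ℂ → ℂ) (F G : ℂ → ℂ → ℂ) : Prop :=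
  AnalyticAt ℂ (fun p : ℂ × ℂ => F p.1 p.2) 0 ∧
  AnalyticAt ℂ (fun p : ℂ × ℂ => G p.1 p.2) 0 ∧
  F 0 0 = 0 ∧ G 0 0 = 0 ∧
  ∀ᶠ p : ℂ × ℂ × ℂ in 𝓝 0,
    G p.1 (Q p.1 p.2.1 p.2.2) =
      Q' (F p.1 (Q p.1 p.2.1 p.2.2)) (cj (F (cj p.2.1) (cj p.2.2))) (cj (G (cj p.2.1) (cj p.2.2)))

/-- Determinant of the Jacobian matrix of `H = (F, G)` at `0`. -/
def JacDet (F G : ℂ → ℂ → ℂ) : ℂ :=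
  pd F 1 0 0 0 * pd G 0 1 0 0 - pd F 0 1 0 0 * pd G 1 0 0 0

/-- The hypersurface defined by `Q` is not Levi-flat near `0`, i.e. `Q(z,χ,τ) ≢ τ`. -/
def NotLeviFlat (Q : ℂ → ℂ → ℂ → ℂ) : Prop :=
  ¬ ∀ᶠ p : ℂ × ℂ × ℂ in 𝓝 0, Q p.1 p.2.1 p.2.2 = p.2.2

/-- The hypersurface defined by `Q` is of finite type at `0`, i.e. `Q(z,χ,0) ≢ 0`. -/
def FiniteTypeAt (Q : ℂ → ℂ → ℂ → ℂ) : Prop :=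
  ¬ ∀ᶠ p : ℂ × ℂ in 𝓝 0, Q p.1 p.2 0 = 0

/-- `q_{αμ}(χ) = ∂_z^α ∂_τ^μ Q(0, χ, 0)`. -/
def qd (Q : ℂ → ℂ → ℂ → ℂ) (α μ : ℕ) (χ : ℂ) : ℂ :=
  deriv^[α] (fun z => deriv^[μ] (fun τ => Q z χ τ) 0) 0

/-- The hypersurface (germ) defined by `Q` as a subset of `ℂ²`. -/
def MSet (Q : ℂ → ℂ → ℂ → ℂ) : Set (ℂ × ℂ) := {p | p.2 = Q p.1 (cj p.1) (cj p.2)}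

/-- The index set of a `k`-jet: pairs `(i, j)` with `1 ≤ i + j ≤ k`. -/
def JetSet (k : ℕ) : Finset (ℕ × ℕ) :=
  (Finset.range (k + 1) ×ˢ Finset.range (k + 1)).filter
    fun ij => 1 ≤ ij.1 + ij.2 ∧ ij.1 + ij.2 ≤ k

/-- Index type for the `k`-jet of a map `H = (F, G)`: an admissible pair `(i, j)` of
differentiation orders together with a Boolean selecting the component (`true` for `F`,
`false` for `G`). Its cardinality is `N_k = k² + 3k`. -/
abbrev JetIdx (k : ℕ) : Type := {ij : ℕ × ℕ // ij ∈ JetSet k} × Bool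

/-- The `k`-jet of `H = (F, G)` at `0`: all partials `∂_z^i ∂_w^j F(0)`, `∂_z^i ∂_w^j G(0)`
with `1 ≤ i + j ≤ k`. -/
def jetMap (k : ℕ) (F G : ℂ → ℂ → ℂ) (p : JetIdx k) : ℂ :=
  if p.2 then pd F p.1.1.1 p.1.1.2 0 0 else pd G p.1.1.1 p.1.1.2 0 0

/-- `T(ℂ²)`: invertible upper-triangular `2 × 2` complex matrices. -/
def Tmat : Set (Matrix (Fin 2) (Fin 2) ℂ) := {A | A 1 0 = 0 ∧ A 0 0 ≠ 0 ∧ A 1 1 ≠ 0}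

/-- The image of `T(ℂ²)` under componentwise complex conjugation. -/
def TmatConj : Set (Matrix (Fin 2) (Fin 2) ℂ) := (fun A => A.map cj) '' Tmat

/-- The Jacobian matrix `H'(0)` of `H = (F, G)` at `0`. -/
def Jmat (F G : ℂ → ℂ → ℂ) : Matrix (Fin 2) (Fin 2) ℂ :=
  !![pd F 1 0 0 0, pd F 0 1 0 0; pd G 1 0 0 0, pd G 0 1 0 0]

attribute [local instance] Matrix.normedAddCommGroup Matrix.normedSpace

section Division

variable {E W : Type*} [NormedAddCommGroup E] [NormedSpace ℂ E]
  [NormedAddCommGroup W] [NormedSpace ℂ W]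

/-- The projection of `ℂ × E` onto the hyperplane where the first coordinate vanishes. -/
def killFst : ℂ × E →L[ℂ] ℂ × E :=
  (ContinuousLinearMap.inr ℂ ℂ E).comp (ContinuousLinearMap.snd ℂ ℂ E)

lemma killFst_apply (v : ℂ × E) : killFst v = (0, v.2) := by simp [killFst]

lemma norm_killFst_le : ‖(killFst : ℂ × E →L[ℂ] ℂ × E)‖ ≤ 1 := by
  refine ContinuousLinearMap.opNorm_le_bound _ zero_le_one fun v => ?_
  rw [killFst_apply, one_mul, Prod.norm_def, Prod.norm_def]
  simp

/-- The power series of the first-coordinate difference quotient of a function with power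
series `p`. -/
def divSeries (p : FormalMultilinearSeries ℂ (ℂ × E) W) : FormalMultilinearSeries ℂ (ℂ × E) W :=
  fun n => ∑ i : Fin (n + 1),
    ((p (n + 1)).compContinuousLinearMap
      (fun j => if j < i then killFst else ContinuousLinearMap.id ℂ _)).curryMid i (1, 0)

lemma norm_divSeries_le (p : FormalMultilinearSeries ℂ (ℂ × E) W) (n : ℕ) :
    ‖divSeries p n‖ ≤ (n + 1) * ‖p (n + 1)‖ := by
  refine (norm_sum_le _ _).trans ?_
  refine (Finset.sum_le_card_nsmul _ _ ‖p (n + 1)‖ fun i _ => ?_).trans (by simp)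
  refine (ContinuousLinearMap.le_opNorm _ _).trans ?_
  rw [ContinuousMultilinearMap.norm_curryMid]
  have h1 : ‖((1 : ℂ), (0 : E))‖ = 1 := by simp [Prod.norm_def]
  rw [h1, mul_one]
  refine (ContinuousMultilinearMap.norm_compContinuousLinearMap_le _ _).trans ?_
  refine mul_le_of_le_one_right (norm_nonneg _) ?_
  refine Finset.prod_le_one (fun _ _ => norm_nonneg _) fun j _ => ?_
  split_ifs
  · exact norm_killFst_le
  · exact ContinuousLinearMap.norm_id_le

lemma smul_divSeries (p : FormalMultilinearSeries ℂ (ℂ × E) W) (n : ℕ) (v : ℂ × E) :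
    v.1 • divSeries p n (fun _ => v) =
      p (n + 1) (fun _ => v) - p (n + 1) (fun _ => (0, v.2)) := by
  let a : ℕ → W := fun i => p (n + 1) fun j : Fin (n + 1) => if (j : ℕ) < i then (0, v.2) else v
  have key : ∀ i : Fin (n + 1),
      v.1 • (((p (n + 1)).compContinuousLinearMap
      (fun j => if j < i then killFst else ContinuousLinearMap.id ℂ _)).curryMid i (1, 0))
        (fun _ => v) = a i - a (i + 1) := by
    intro i
    rw [ContinuousMultilinearMap.curryMid_apply,
      ContinuousMultilinearMap.compContinuousLinearMap_apply]
    have e0 : (fun j => (if j < i then killFst else ContinuousLinearMap.id ℂ (ℂ × E))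
        (Fin.insertNth (α := fun _ => ℂ × E) i (1, 0) (fun _ => v) j)) =
        Function.update (fun j : Fin (n + 1) => if (j : ℕ) < i then ((0 : ℂ), v.2) else v) i
          (1, 0) := by
      funext j
      rcases eq_or_ne j i with rfl | hj
      · simp
      · rw [Function.update_of_ne hj]
        obtain ⟨j', rfl⟩ := Fin.exists_succAbove_eq hj
        rw [Fin.insertNth_apply_succAbove]
        by_cases h : i.succAbove j' < i
        · rw [if_pos h, if_pos (by simpa using h), killFst_apply]
        · rw [if_neg h, if_neg (by simpa using h)]; rfl
    have e1 : (fun j : Fin (n + 1) => if (j : ℕ) < i then ((0 : ℂ), v.2) else v) =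
        Function.update (fun j : Fin (n + 1) => if (j : ℕ) < i then ((0 : ℂ), v.2) else v) i
          v := by
      funext j
      rcases eq_or_ne j i with rfl | hj
      · simp
      · rw [Function.update_of_ne hj]
    have e2 : (fun j : Fin (n + 1) => if (j : ℕ) < (i : ℕ) + 1 then ((0 : ℂ), v.2) else v) =
        Function.update (fun j : Fin (n + 1) => if (j : ℕ) < i then ((0 : ℂ), v.2) else v) i
          (0, v.2) := by
      funext j
      rcases eq_or_ne j i with rfl | hj
      · simp
      · rw [Function.update_of_ne hj]
        have : (j : ℕ) ≠ i := fun h => hj (Fin.ext h)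
        by_cases h : (j : ℕ) < i
        · rw [if_pos h, if_pos (by omega)]
        · rw [if_neg h, if_neg (by omega)]
    rw [e0]
    simp only [a]
    rw [e2, e1]
    simp only [Function.update_idem]
    rw [← ContinuousMultilinearMap.map_update_smul, ← ContinuousMultilinearMap.map_update_sub]
    congr 2
    ext <;> simp
  unfold divSeries
  rw [_root_.sum_apply, Finset.smul_sum, Finset.sum_congr rfl fun i _ => key i,
    Fin.sum_univ_eq_sum_range (fun i => a i - a (i + 1)), Finset.sum_range_sub']
  simp only [a]
  congr 1
  congr 1
  funext j
  rw [if_pos j.2]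

lemma exists_div_fst [CompleteSpace W] {f : ℂ × E → W} {y0 : E} (hf : AnalyticAt ℂ f (0, y0)) :
    ∃ g : ℂ × E → W, AnalyticAt ℂ g (0, y0) ∧
      ∀ᶠ p in 𝓝 ((0 : ℂ), y0), f p = f (0, p.2) + p.1 • g p := by
  obtain ⟨p, R, hp⟩ := hf
  obtain ⟨r, hr0, hrR⟩ := ENNReal.lt_iff_exists_nnreal_btwn.1 hp.r_pos
  have hr0' : 0 < r := by exact_mod_cast hr0
  have hrad : (r : ENNReal) < p.radius := hrR.trans_le hp.r_le
  obtain ⟨C, hC, hb⟩ := p.norm_mul_pow_le_of_lt_radius hrad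
  have hq : ((r / 2 : NNReal) : ENNReal) ≤ (divSeries p).radius := by
    refine (divSeries p).le_radius_of_bound (C / r) fun n => ?_
    have h1 := norm_divSeries_le p n
    have h2 := hb (n + 1)
    have h3 : ((n : ℝ) + 1) ≤ 2 ^ n := by
      have := one_add_mul_le_pow (a := (1 : ℝ)) (by norm_num) n
      norm_num at this
      linarith
    have hr : (0 : ℝ) < r := hr0'
    rw [le_div_iff₀ hr]
    calc ‖divSeries p n‖ * ((r / 2 : NNReal) : ℝ) ^ n * r
        ≤ ((n + 1) * ‖p (n + 1)‖) * ((r / 2 : NNReal) : ℝ) ^ n * r := by gcongr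
      _ = ((n + 1) / 2 ^ n) * (‖p (n + 1)‖ * (r : ℝ) ^ (n + 1)) := by
          push_cast; rw [div_pow]; ring
      _ ≤ 1 * C := by
          gcongr
          rw [div_le_one (by positivity)]; exact h3
      _ = C := one_mul C
  have hqpos : 0 < (divSeries p).radius := lt_of_lt_of_le
    (ENNReal.coe_pos.2 (half_pos hr0')) hq
  have hg := (divSeries p).hasFPowerSeriesOnBall hqpos
  refine ⟨fun v => (divSeries p).sum (v - (0, y0)), ?_, ?_⟩
  · have := hg.comp_sub (0, y0)
    rw [zero_add] at this
    exact this.analyticAt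
  · have hmem : Metric.eball ((0 : ℂ), y0) (min (divSeries p).radius R) ∈ 𝓝 ((0 : ℂ), y0) :=
      Metric.eball_mem_nhds _ (lt_min hqpos hp.r_pos)
    filter_upwards [hmem] with v hv
    set u : ℂ × E := v - (0, y0) with hu
    have hu' : u ∈ Metric.eball (0 : ℂ × E) (min (divSeries p).radius R) := by
      rw [Metric.mem_eball, edist_zero_right]
      rw [Metric.mem_eball, edist_eq_enorm_sub] at hv
      exact hv
    have hv1 : v.1 = u.1 := by simp [hu]
    have hv2 : v = (0, y0) + u := by simp [hu]
    have hv3 : ((0 : ℂ), v.2) = (0, y0) + killFst u := by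
      rw [killFst_apply, hu]; ext <;> simp
    have hK : killFst u ∈ Metric.eball (0 : ℂ × E) R := by
      rw [Metric.mem_eball, edist_zero_right] at hu' ⊢
      refine lt_of_le_of_lt ?_ (hu'.trans_le (min_le_right _ _))
      rw [enorm_le_iff_norm_le]
      rw [killFst_apply, Prod.norm_def, Prod.norm_def]
      simp
    have s1 := hp.hasSum (Metric.eball_subset_eball (min_le_right _ _) hu')
    have s2 := hp.hasSum hK
    have s3 := (hg.hasSum (Metric.eball_subset_eball (min_le_left _ _) hu')).const_smul u.1
    rw [zero_add] at s3
    have s4 := s1.sub s2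
    rw [← hv2, ← hv3] at s4
    have s5 : HasSum (fun n : ℕ => u.1 • divSeries p n fun _ => u) (f v - f (0, v.2)) := by
      rw [← hasSum_nat_add_iff' 1] at s4
      simp only [Finset.sum_range_one] at s4
      have z : (p 0 fun _ => u) - (p 0 fun _ => killFst u) = 0 := by
        rw [sub_eq_zero]; congr 1; funext i; exact i.elim0
      rw [z, sub_zero] at s4
      convert s4 using 2 with n
      rw [smul_divSeries, killFst_apply]
    have := s3.unique s5
    rw [hv1]
    simp only [this]
    abel

end Division

lemma cj_add (a b : ℂ) : cj (a + b) = cj a + cj b := map_add (starRingEnd ℂ) a b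
lemma cj_mul (a b : ℂ) : cj (a * b) = cj a * cj b := map_mul (starRingEnd ℂ) a b
lemma cj_zero : cj 0 = 0 := map_zero (starRingEnd ℂ)
lemma cj_cj (a : ℂ) : cj (cj a) = a := starRingEnd_self_apply a
lemma norm_cj (a : ℂ) : ‖cj a‖ = ‖a‖ := RCLike.norm_conj a
lemma cj_eq_zero {a : ℂ} : cj a = 0 ↔ a = 0 := map_eq_zero (starRingEnd ℂ)
lemma continuous_cj : Continuous cj := Complex.continuous_conj

section ConjSeries

variable {E : Type*} [NormedAddCommGroup E] [NormedSpace ℂ E]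

/-- A norm-nonincreasing conjugate-linear self-map. -/
structure IsConjMap (σ : E → E) : Prop where
  add : ∀ u v, σ (u + v) = σ u + σ v
  smul : ∀ (c : ℂ) v, σ (c • v) = cj c • σ v
  norm_le : ∀ v, ‖σ v‖ ≤ ‖v‖

/-- The conjugate of a continuous multilinear form by a conjugate-linear map. -/
def conjForm {σ : E → E} (hσ : IsConjMap σ) {n : ℕ}
    (p : ContinuousMultilinearMap ℂ (fun _ : Fin n => E) ℂ) :
    ContinuousMultilinearMap ℂ (fun _ : Fin n => E) ℂ :=
  MultilinearMap.mkContinuous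
    { toFun := fun v => cj (p fun i => σ (v i))
      map_update_add' := by
        intro _ m i x y
        have h : ∀ w : E, (fun j => σ (Function.update m i w j)) =
            Function.update (fun j => σ (m j)) i (σ w) := fun w => by
          funext j
          rcases eq_or_ne j i with rfl | hj
          · simp
          · simp [hj]
        change cj (p fun j => σ (Function.update m i (x + y) j)) =
          cj (p fun j => σ (Function.update m i x j)) + cj (p fun j => σ (Function.update m i y j))
        rw [h, h, h, hσ.add, p.map_update_add, cj_add]
      map_update_smul' := by
        intro _ m i c x
        have h : ∀ w : E, (fun j => σ (Function.update m i w j)) =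
            Function.update (fun j => σ (m j)) i (σ w) := fun w => by
          funext j
          rcases eq_or_ne j i with rfl | hj
          · simp
          · simp [hj]
        change cj (p fun j => σ (Function.update m i (c • x) j)) =
          c * cj (p fun j => σ (Function.update m i x j))
        rw [h, h, hσ.smul, p.map_update_smul, smul_eq_mul, cj_mul, cj_cj] } ‖p‖ fun m => by
      change ‖cj (p fun i => σ (m i))‖ ≤ _
      rw [norm_cj]
      refine (p.le_opNorm _).trans ?_
      gcongr with i
      exact hσ.norm_le _

lemma norm_conjForm_le {σ : E → E} (hσ : IsConjMap σ) {n : ℕ}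
    (p : ContinuousMultilinearMap ℂ (fun _ : Fin n => E) ℂ) : ‖conjForm hσ p‖ ≤ ‖p‖ :=
  MultilinearMap.mkContinuous_norm_le _ (norm_nonneg _) _

lemma AnalyticAt.conj_comp {σ : E → E} (hσ : IsConjMap σ) {f : E → ℂ} {x : E}
    (hf : AnalyticAt ℂ f (σ x)) : AnalyticAt ℂ (fun v => cj (f (σ v))) x := by
  obtain ⟨p, r, hp⟩ := hf
  refine ⟨fun n => conjForm hσ (p n), r, ?_, hp.r_pos, ?_⟩
  · refine hp.r_le.trans ?_
    refine FormalMultilinearSeries.radius_le_of_le fun n => ?_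
    exact norm_conjForm_le hσ (p n)
  · intro y hy
    have hy' : σ y ∈ Metric.eball (0 : E) r := by
      rw [Metric.mem_eball, edist_zero_right] at hy ⊢
      refine lt_of_le_of_lt ?_ hy
      rw [enorm_le_iff_norm_le]
      exact hσ.norm_le y
    have h := hp.hasSum hy'
    have h2 := h.map (starRingEnd ℂ) Complex.continuous_conj
    rw [← hσ.add] at h2
    exact h2

end ConjSeries

lemma isConjMap_cj : IsConjMap cj := ⟨cj_add, cj_mul, fun v => (norm_cj v).le⟩

lemma isConjMap_prod {E E' : Type*} [NormedAddCommGroup E] [NormedSpace ℂ E]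
    [NormedAddCommGroup E'] [NormedSpace ℂ E'] {σ : E → E} {σ' : E' → E'}
    (h : IsConjMap σ) (h' : IsConjMap σ') :
    IsConjMap (fun p : E × E' => (σ p.1, σ' p.2)) where
  add u v := by simp [h.add, h'.add]
  smul c v := by simp [h.smul, h'.smul]
  norm_le v := by
    rw [Prod.norm_def, Prod.norm_def]
    exact max_le_max (h.norm_le _) (h'.norm_le _)

section Dslope

variable {E W : Type*} [NormedAddCommGroup E] [NormedSpace ℂ E]
  [NormedAddCommGroup W] [NormedSpace ℂ W]

lemma dslope_expand (h : ℂ → W) (z : ℂ) : h z = h 0 + z • dslope h 0 z := by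
  have := sub_smul_dslope h 0 z
  rw [sub_zero] at this
  rw [this]; abel

lemma dslope_eq_of_expand {h g : ℂ → W} {a : W} (hg : ContinuousAt g 0)
    (he : ∀ᶠ z in 𝓝 0, h z = a + z • g z) : dslope h 0 =ᶠ[𝓝 0] g := by
  have h0 : h 0 = a := by simpa using he.self_of_nhds
  filter_upwards [he] with z hz
  rcases eq_or_ne z 0 with rfl | hz0
  · rw [dslope_same]
    have hd : HasDerivAt h (g 0) 0 := by
      rw [hasDerivAt_iff_tendsto_slope]
      refine Tendsto.congr' ?_ (hg.tendsto.mono_left nhdsWithin_le_nhds)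
      filter_upwards [nhdsWithin_le_nhds he, self_mem_nhdsWithin] with w hw hw0
      rw [slope_def_module, hw, h0, sub_zero, add_sub_cancel_left, smul_smul,
        inv_mul_cancel₀ hw0, one_smul]
    exact hd.deriv
  · rw [dslope_of_ne _ hz0, slope_def_module, hz, h0, sub_zero, add_sub_cancel_left, smul_smul,
      inv_mul_cancel₀ hz0, one_smul]

lemma dslope_congr {h g : ℂ → W} (he : h =ᶠ[𝓝 0] g) : dslope h 0 =ᶠ[𝓝 0] dslope g 0 := by
  filter_upwards [he] with z hz
  rcases eq_or_ne z 0 with rfl | hz0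
  · rw [dslope_same, dslope_same, he.deriv_eq]
  · rw [dslope_of_ne _ hz0, dslope_of_ne _ hz0, slope_def_module, slope_def_module, hz,
      he.self_of_nhds]

lemma AnalyticAt.dslope_fst [CompleteSpace W] {f : ℂ → E → W} {y0 : E}
    (hf : AnalyticAt ℂ (fun p : ℂ × E => f p.1 p.2) (0, y0)) :
    AnalyticAt ℂ (fun p : ℂ × E => dslope (fun z => f z p.2) 0 p.1) (0, y0) := by
  obtain ⟨g, hg, he⟩ := exists_div_fst hf
  refine hg.congr ?_
  have hgc : ∀ᶠ p in 𝓝 ((0 : ℂ), y0), AnalyticAt ℂ g p := hg.eventually_analyticAt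
  have hK : Tendsto (fun p : ℂ × E => ((0 : ℂ), p.2)) (𝓝 (0, y0)) (𝓝 (0, y0)) :=
    (by fun_prop : Continuous fun p : ℂ × E => ((0 : ℂ), p.2)).tendsto' _ _ rfl
  filter_upwards [he, hK.eventually he.eventually_nhds, hK.eventually hgc] with p hp hp2 hp3
  rcases eq_or_ne p.1 0 with h0 | h0
  · have hc : Tendsto (fun z : ℂ => (z, p.2)) (𝓝 0) (𝓝 (0, p.2)) :=
      (by fun_prop : Continuous fun z : ℂ => (z, p.2)).tendsto' _ _ rfl
    have := dslope_eq_of_expand (h := fun z => f z p.2) (a := f 0 p.2)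
      (g := fun z => g (z, p.2))
      (hp3.continuousAt.tendsto.comp hc) (hc.eventually hp2)
    have := this.self_of_nhds
    rw [h0, this]
    congr 1
    exact Prod.ext h0 rfl
  · rw [dslope_of_ne _ h0, slope_def_module, hp, sub_zero, add_sub_cancel_left, smul_smul,
      inv_mul_cancel₀ h0, one_smul]

lemma AnalyticAt.dslope_zero {f : ℂ → W} (hf : AnalyticAt ℂ f 0) :
    AnalyticAt ℂ (dslope f 0) 0 := by
  obtain ⟨p, hp⟩ := hf
  exact hp.has_fpower_series_dslope_fslope.analyticAt

end Dslope

section Cancel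

variable {E W : Type*} [NormedAddCommGroup E] [NormedSpace ℂ E]
  [NormedAddCommGroup W] [NormedSpace ℂ W]

lemma eq_zero_of_pow_smul_eq_zero {g : ℂ → W} {m : ℕ} {a : ℂ} (hg : ContinuousAt g 0)
    (h : ∀ᶠ t in 𝓝 (0 : ℂ), (a + t) ^ m • g t = 0) : g 0 = 0 := by
  rcases eq_or_ne a 0 with rfl | ha
  · have h1 : Tendsto g (𝓝[≠] 0) (𝓝 (g 0)) := hg.tendsto.mono_left nhdsWithin_le_nhds
    refine tendsto_nhds_unique h1 (tendsto_const_nhds.congr' ?_)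
    filter_upwards [nhdsWithin_le_nhds h, self_mem_nhdsWithin] with t ht ht0
    rw [zero_add] at ht
    exact ((smul_eq_zero.1 ht).resolve_left (pow_ne_zero _ ht0)).symm
  · have := h.self_of_nhds
    rw [add_zero] at this
    exact (smul_eq_zero.1 this).resolve_left (pow_ne_zero _ ha)

lemma eventually_eq_zero_of_pow_smul {f : E → W} {x : E} (hf : AnalyticAt ℂ f x)
    (ℓ : E →L[ℂ] ℂ) (v : E) (hv : ℓ v = 1) {m : ℕ} (h : ∀ᶠ p in 𝓝 x, ℓ p ^ m • f p = 0) :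
    ∀ᶠ p in 𝓝 x, f p = 0 := by
  filter_upwards [hf.eventually_continuousAt, h.eventually_nhds] with p hp hp2
  have hc : Tendsto (fun t : ℂ => p + t • v) (𝓝 0) (𝓝 p) :=
    (by fun_prop : Continuous fun t : ℂ => p + t • v).tendsto' _ _ (by simp)
  have := eq_zero_of_pow_smul_eq_zero (g := fun t : ℂ => f (p + t • v)) (m := m) (a := ℓ p) ?_ ?_
  · simpa using this
  · have : Tendsto (fun t : ℂ => f (p + t • v)) (𝓝 0) (𝓝 (f p)) := hp.tendsto.comp hc
    simpa [ContinuousAt] using this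
  · filter_upwards [hc.eventually hp2] with t ht
    simpa [hv] using ht

lemma coeff_eq_zero_of_eventually {n : ℕ} {a : ℕ → ℂ} {w : ℂ → ℂ} (hw : ContinuousAt w 0)
    (h : ∀ᶠ x in 𝓝 (0 : ℂ), ∑ i ∈ Finset.range n, a i * x ^ i + x ^ n * w x = 0) :
    ∀ i < n, a i = 0 := by
  induction n generalizing a with
  | zero => intro i hi; omega
  | succ n ih =>
    have h0 : a 0 = 0 := by
      have := h.self_of_nhds
      simpa [Finset.sum_range_succ'] using this
    have hc : ContinuousAt (fun x => ∑ i ∈ Finset.range n, a (i + 1) * x ^ i + x ^ n * w x) 0 := by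
      fun_prop
    have h2 : ∀ᶠ x in 𝓝 (0 : ℂ),
        x * (∑ i ∈ Finset.range n, a (i + 1) * x ^ i + x ^ n * w x) = 0 := by
      filter_upwards [h] with x hx
      rw [Finset.sum_range_succ', h0] at hx
      rw [mul_add, Finset.mul_sum, ← hx]
      have : ∀ i, x * (a (i + 1) * x ^ i) = a (i + 1) * x ^ (i + 1) := fun i => by ring
      simp only [this]
      ring
    have h3 := eq_zero_of_pow_smul_eq_zero (m := 1) (a := 0) hc (by simpa using h2)
    have h4 := ih (a := fun i => a (i + 1)) (by
      filter_upwards [h2] with x hx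
      rcases eq_or_ne x 0 with rfl | hx0
      · exact h3
      · exact (mul_eq_zero.1 hx).resolve_left hx0)
    intro i hi
    rcases i with _ | i
    · exact h0
    · exact h4 i (by omega)

lemma exists_eq_pow_smul [CompleteSpace W] {f : ℂ × E → W} (hf : AnalyticAt ℂ f 0)
    (hne : ¬ ∀ᶠ p in 𝓝 0, f p = 0) :
    ∃ (n : ℕ) (g : ℂ × E → W), AnalyticAt ℂ g 0 ∧ (∀ᶠ p in 𝓝 0, f p = p.1 ^ n • g p) ∧
      ¬ ∀ᶠ y in 𝓝 (0 : E), g (0, y) = 0 := by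
  by_contra hcon
  push Not at hcon
  apply hne
  have hall : ∀ n : ℕ, ∃ g : ℂ × E → W, AnalyticAt ℂ g 0 ∧
      ∀ᶠ p in 𝓝 0, f p = p.1 ^ n • g p := by
    intro n
    induction n with
    | zero => exact ⟨f, hf, by simp⟩
    | succ n ih =>
      obtain ⟨g, hg, he⟩ := ih
      have h0 := hcon n g hg he
      obtain ⟨g', hg', he'⟩ := exists_div_fst (y0 := (0 : E)) (f := g) hg
      refine ⟨g', hg', ?_⟩
      have h0' : ∀ᶠ p : ℂ × E in 𝓝 0, g (0, p.2) = 0 :=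
        (continuous_snd.tendsto' (0 : ℂ × E) 0 rfl).eventually h0
      filter_upwards [he, he', h0'] with p h1 h2 h3
      rw [h1, h2, h3, zero_add, smul_smul, pow_succ]
  obtain ⟨ps, R, hp⟩ := hf
  filter_upwards [Metric.eball_mem_nhds (0 : ℂ × E) hp.r_pos] with p hpR
  have hfan : AnalyticOnNhd ℂ f (Metric.eball 0 R) := hp.analyticOnNhd
  set ℓ : ℂ → ℂ × E := fun t => t • p with hℓ
  have hℓa : ∀ t, AnalyticAt ℂ ℓ t := fun t => analyticAt_id.smul analyticAt_const
  have hφ : AnalyticOnNhd ℂ (f ∘ ℓ) (ℓ ⁻¹' Metric.eball 0 R) := fun t ht =>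
    (hfan _ ht).comp (hℓa t)
  have hconv : Convex ℝ (ℓ ⁻¹' Metric.eball 0 R) := by
    have hc : Convex ℝ (Metric.eball (0 : ℂ × E) R) := convex_eball _ _
    exact hc.is_linear_preimage (IsLinearMap.mk (fun x y => by simp [hℓ, add_smul])
      (fun c x => by simp [hℓ, mul_smul]))
  have h0mem : (0 : ℂ) ∈ ℓ ⁻¹' Metric.eball 0 R := by
    rw [Set.mem_preimage, hℓ]
    simp only [zero_smul]; exact Metric.mem_eball_self hp.r_pos
  have hz : f ∘ ℓ =ᶠ[𝓝 0] 0 := by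
    have hA := hφ 0 h0mem
    have : analyticOrderAt (f ∘ ℓ) 0 = ⊤ := by
      rw [ENat.eq_top_iff_forall_ge]
      intro n
      rw [natCast_le_analyticOrderAt hA]
      obtain ⟨g, hg, he⟩ := hall n
      have hg' : AnalyticAt ℂ g (ℓ 0) := by simpa [hℓ] using hg
      refine ⟨fun t => p.1 ^ n • g (ℓ t), (analyticAt_const).smul (hg'.comp (hℓa 0)), ?_⟩
      have ht : Tendsto ℓ (𝓝 0) (𝓝 0) := (hℓa 0).continuousAt.tendsto.trans (by simp [hℓ])
      filter_upwards [ht.eventually he] with t ht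
      simp only [Function.comp, ht, sub_zero]
      simp [hℓ, mul_pow, smul_smul]
    exact analyticOrderAt_eq_top.1 this
  have := hφ.eqOn_zero_of_preconnected_of_eventuallyEq_zero hconv.isPreconnected h0mem hz
  have h1 : (1 : ℂ) ∈ ℓ ⁻¹' Metric.eball 0 R := by
    rw [Set.mem_preimage, hℓ]
    simpa only [one_smul] using hpR
  simpa [hℓ] using this h1

end Cancel

section Taylor

/-- The difference quotient at `0`. -/
def ds (f : ℂ → ℂ) : ℂ → ℂ := dslope f 0

/-- The `j`-th Taylor coefficient at `0`, by iterated difference quotients. -/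
def tc (j : ℕ) (f : ℂ → ℂ) : ℂ := ds^[j] f 0

lemma tc_zero (f : ℂ → ℂ) : tc 0 f = f 0 := rfl
lemma tc_succ (j : ℕ) (f : ℂ → ℂ) : tc (j + 1) f = tc j (ds f) := rfl

lemma ds_expand (f : ℂ → ℂ) (z : ℂ) : f z = f 0 + z * ds f z := dslope_expand f z

lemma AnalyticAt.ds {f : ℂ → ℂ} (hf : AnalyticAt ℂ f 0) : AnalyticAt ℂ (ds f) 0 :=
  hf.dslope_zero

lemma AnalyticAt.iterate_ds {f : ℂ → ℂ} (hf : AnalyticAt ℂ f 0) (n : ℕ) :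
    AnalyticAt ℂ (_root_.ds^[n] f) 0 := by
  induction n generalizing f with
  | zero => exact hf
  | succ n ih => exact ih hf.ds

lemma taylor_expand (f : ℂ → ℂ) (n : ℕ) (z : ℂ) :
    f z = ∑ j ∈ Finset.range n, tc j f * z ^ j + z ^ n * ds^[n] f z := by
  induction n generalizing f with
  | zero => simp
  | succ n ih =>
    rw [Finset.sum_range_succ', ds_expand f z, ih (ds f), Function.iterate_succ_apply]
    simp only [tc_succ, tc_zero, pow_zero, mul_one, mul_add, Finset.mul_sum]
    have : ∀ j, z * (tc j (ds f) * z ^ j) = tc j (ds f) * z ^ (j + 1) := fun j => by ring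
    simp only [this]
    ring

lemma ds_congr {f g : ℂ → ℂ} (h : f =ᶠ[𝓝 0] g) : ds f =ᶠ[𝓝 0] ds g := dslope_congr h

lemma iterate_ds_congr {f g : ℂ → ℂ} (h : f =ᶠ[𝓝 0] g) (n : ℕ) :
    ds^[n] f =ᶠ[𝓝 0] ds^[n] g := by
  induction n generalizing f g with
  | zero => exact h
  | succ n ih => exact ih (ds_congr h)

lemma tc_congr {f g : ℂ → ℂ} (h : f =ᶠ[𝓝 0] g) (n : ℕ) : tc n f = tc n g :=
  (iterate_ds_congr h n).self_of_nhds

lemma deriv_iterate_eq_tc {f : ℂ → ℂ} (hf : AnalyticAt ℂ f 0) (n : ℕ) :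
    deriv^[n] f 0 = (n.factorial : ℂ) * tc n f := by
  have h := hf.hasFPowerSeriesAt
  have h2 := h.has_fpower_series_iterate_dslope_fslope n
  have h3 := h2.coeff_zero ![]
  have h4 : tc n f = iteratedDeriv n f 0 / n.factorial := by
    have e : tc n f = ((Function.swap dslope 0)^[n] f) 0 := rfl
    rw [e, ← h3]
    have := FormalMultilinearSeries.coeff_iterate_fslope (p :=
      FormalMultilinearSeries.ofScalars ℂ (fun n => iteratedDeriv n f 0 / (n.factorial : ℂ))) n 0
    rw [zero_add, FormalMultilinearSeries.coeff_ofScalars] at this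
    rw [← this]
    unfold FormalMultilinearSeries.coeff
    congr 1
    exact Subsingleton.elim _ _
  rw [h4, iteratedDeriv_eq_iterate, mul_div_cancel₀]
  exact_mod_cast n.factorial_ne_zero

end Taylor

/-- The parameter space of the coefficients: `(z, Λ, Λ̃)`. -/
abbrev Par : Type := ℂ × Matrix (Fin 2) (Fin 2) ℂ × Matrix (Fin 2) (Fin 2) ℂ

/-- Analyticity at every point of `{0} × T(ℂ²) × conj T(ℂ²)`. -/
def CoefAnalytic (c : Par → ℂ) : Prop :=
  ∀ A ∈ Tmat, ∀ B ∈ TmatConj, AnalyticAt ℂ c (0, A, B)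

/-- The local biholomorphisms sending `M` into `M'`. -/
def Maps (Q Q' : ℂ → ℂ → ℂ → ℂ) : Type :=
  {H : (ℂ → ℂ → ℂ) × (ℂ → ℂ → ℂ) // SendsInto Q Q' H.1 H.2 ∧ JacDet H.1 H.2 ≠ 0}

section Parametrization

variable {Q Q' : ℂ → ℂ → ℂ → ℂ}

namespace Maps

/-- The first component. -/
def F (H : Maps Q Q') : ℂ → ℂ → ℂ := H.1.1

/-- The second component. -/
def G (H : Maps Q Q') : ℂ → ℂ → ℂ := H.1.2

/-- The Jacobian matrix at the origin. -/
def J (H : Maps Q Q') : Matrix (Fin 2) (Fin 2) ℂ := Jmat H.F H.G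

/-- A derivative at the origin. -/
def jet (H : Maps Q Q') (p : (ℕ × ℕ) × Bool) : ℂ :=
  if p.2 then pd H.F p.1.1 p.1.2 0 0 else pd H.G p.1.1 p.1.2 0 0

end Maps

/-- The family attached to a coefficient function. -/
def coefFam (c : Par → ℂ) (H : Maps Q Q') (z : ℂ) : ℂ := c (z, H.J, H.J.map cj)

/-- Families of germs depending analytically on the `1`-jet only. -/
def IsBase (φ : Maps Q Q' → ℂ → ℂ) : Prop :=
  ∃ c, CoefAnalytic c ∧ ∀ H, φ H =ᶠ[𝓝 0] coefFam c H

/-- Families depending analytically on the `1`-jet, with nonzero value at `0`. -/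
def IsBaseUnit (φ : Maps Q Q' → ℂ → ℂ) : Prop :=
  ∃ c, CoefAnalytic c ∧ (∀ A ∈ Tmat, ∀ B ∈ TmatConj, c (0, A, B) ≠ 0) ∧
    ∀ H, φ H =ᶠ[𝓝 0] coefFam c H

/-- All Jacobian matrices are invertible and upper triangular. -/
def HasTriangularJacobians (Q Q' : ℂ → ℂ → ℂ → ℂ) : Prop := ∀ H : Maps Q Q', H.J ∈ Tmat

lemma map_cj_map_cj (A : Matrix (Fin 2) (Fin 2) ℂ) : (A.map cj).map cj = A := by
  ext i j; simp [Matrix.map_apply, cj_cj]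

lemma map_cj_mem {A : Matrix (Fin 2) (Fin 2) ℂ} (hA : A ∈ Tmat) : A.map cj ∈ TmatConj :=
  ⟨A, hA, rfl⟩

lemma map_cj_mem' {B : Matrix (Fin 2) (Fin 2) ℂ} (hB : B ∈ TmatConj) : B.map cj ∈ Tmat := by
  obtain ⟨A, hA, rfl⟩ := hB
  rwa [map_cj_map_cj]

lemma isConjMap_matrix :
    IsConjMap (fun A : Matrix (Fin 2) (Fin 2) ℂ => A.map cj) where
  add u v := by ext i j; simp [Matrix.map_apply, cj_add]
  smul c v := by ext i j; simp [Matrix.map_apply, cj_mul]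
  norm_le v := by
    refine (Matrix.norm_le_iff (norm_nonneg _)).2 fun i j => ?_
    rw [Matrix.map_apply, norm_cj]
    exact Matrix.norm_entry_le_entrywise_sup_norm v

lemma isConjMap_par :
    IsConjMap (fun p : Par => (cj p.1, p.2.2.map cj, p.2.1.map cj)) where
  add u v := by simp [cj_add, isConjMap_matrix.add]
  smul c v := by simp [cj_mul, isConjMap_matrix.smul]
  norm_le v := by
    have h1 := isConjMap_matrix.norm_le v.2.1
    have h2 := isConjMap_matrix.norm_le v.2.2
    simp only [Prod.norm_def, norm_cj] at *
    refine max_le_max le_rfl ?_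
    rw [max_comm]
    exact max_le_max h1 h2

lemma analyticAt_entry_fst (i j : Fin 2) (x : Par) :
    AnalyticAt ℂ (fun x : Par => x.2.1 i j) x := by
  have h : AnalyticAt ℂ (fun x : Par => x.2.1) x :=
    analyticAt_fst.comp analyticAt_snd
  exact ((Matrix.entryLinearMap ℂ ℂ i j).toContinuousLinearMap.analyticAt _).comp h

lemma analyticAt_entry_snd (i j : Fin 2) (x : Par) :
    AnalyticAt ℂ (fun x : Par => x.2.2 i j) x := by
  have h : AnalyticAt ℂ (fun x : Par => x.2.2) x :=
    analyticAt_snd.comp analyticAt_snd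
  exact ((Matrix.entryLinearMap ℂ ℂ i j).toContinuousLinearMap.analyticAt _).comp h

lemma tendsto_par (A B : Matrix (Fin 2) (Fin 2) ℂ) :
    Tendsto (fun z : ℂ => ((z, A, B) : Par)) (𝓝 0) (𝓝 (0, A, B)) :=
  (by fun_prop : Continuous fun z : ℂ => ((z, A, B) : Par)).tendsto' _ _ rfl

lemma CoefAnalytic.coefFam {c : Par → ℂ} (hc : CoefAnalytic c)
    (hT : HasTriangularJacobians Q Q') (H : Maps Q Q') : AnalyticAt ℂ (coefFam c H) 0 := by
  have h := hc _ (hT H) _ (map_cj_mem (hT H))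
  exact AnalyticAt.comp (f := fun z : ℂ => ((z, H.J, H.J.map cj) : Par)) h (by fun_prop)

namespace IsBase

variable {φ ψ : Maps Q Q' → ℂ → ℂ}

lemma congr (h : IsBase φ) (he : ∀ H, φ H =ᶠ[𝓝 0] ψ H) : IsBase ψ := by
  obtain ⟨c, hc, h⟩ := h
  exact ⟨c, hc, fun H => (he H).symm.trans (h H)⟩

lemma analyticAt (h : IsBase φ) (hT : HasTriangularJacobians Q Q') (H : Maps Q Q') :
    AnalyticAt ℂ (φ H) 0 := by
  obtain ⟨c, hc, h⟩ := h
  exact (hc.coefFam hT H).congr (h H).symm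

lemma of_analytic {h : ℂ → ℂ} (hh : AnalyticAt ℂ h 0) :
    IsBase (fun _ : Maps Q Q' => h) :=
  ⟨fun p => h p.1, fun A _ B _ => by
    have h1 : AnalyticAt ℂ (fun p : Par => p.1) (0, A, B) := analyticAt_fst
    exact AnalyticAt.fun_comp (g := h) hh h1, fun _ => EventuallyEq.rfl⟩

lemma const (a : ℂ) : IsBase (fun (_ : Maps Q Q') (_ : ℂ) => a) := of_analytic analyticAt_const

lemma add (h : IsBase φ) (h' : IsBase ψ) : IsBase (fun H z => φ H z + ψ H z) := by
  obtain ⟨c, hc, h⟩ := h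
  obtain ⟨c', hc', h'⟩ := h'
  exact ⟨fun p => c p + c' p, fun A hA B hB => (hc A hA B hB).add (hc' A hA B hB),
    fun H => (h H).add (h' H)⟩

lemma mul (h : IsBase φ) (h' : IsBase ψ) : IsBase (fun H z => φ H z * ψ H z) := by
  obtain ⟨c, hc, h⟩ := h
  obtain ⟨c', hc', h'⟩ := h'
  exact ⟨fun p => c p * c' p, fun A hA B hB => (hc A hA B hB).mul (hc' A hA B hB),
    fun H => (h H).mul (h' H)⟩

lemma entry_fst (i j : Fin 2) : IsBase (fun (H : Maps Q Q') (_ : ℂ) => H.J i j) :=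
  ⟨fun p => p.2.1 i j, fun _ _ _ _ => analyticAt_entry_fst i j _, fun _ => EventuallyEq.rfl⟩

lemma entry_snd (i j : Fin 2) : IsBase (fun (H : Maps Q Q') (_ : ℂ) => cj (H.J i j)) :=
  ⟨fun p => p.2.2 i j, fun _ _ _ _ => analyticAt_entry_snd i j _, fun _ => EventuallyEq.rfl⟩

lemma eval (h : IsBase φ) : IsBase (fun H _ => φ H 0) := by
  obtain ⟨c, hc, h⟩ := h
  refine ⟨fun p => c (0, p.2), fun A hA B hB => ?_, fun H => ?_⟩
  · have h1 : AnalyticAt ℂ (fun p : Par => ((0, p.2) : Par)) (0, A, B) :=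
      AnalyticAt.prod analyticAt_const analyticAt_snd
    exact AnalyticAt.fun_comp (f := fun p : Par => ((0, p.2) : Par)) (g := c) (hc A hA B hB) h1
  · have := (h H).self_of_nhds
    exact Eventually.of_forall fun z => this

lemma ds (h : IsBase φ) : IsBase (fun H => ds (φ H)) := by
  obtain ⟨c, hc, h⟩ := h
  refine ⟨fun p => dslope (fun z => c (z, p.2)) 0 p.1, fun A hA B hB => ?_, fun H => ?_⟩
  · exact AnalyticAt.dslope_fst (f := fun z (y : _ × _) => c (z, y)) (hc A hA B hB)
  · exact ds_congr (h H)

lemma bar (h : IsBase φ) : IsBase (fun H z => cj (φ H (cj z))) := by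
  obtain ⟨c, hc, h⟩ := h
  refine ⟨fun p => cj (c (cj p.1, p.2.2.map cj, p.2.1.map cj)), fun A hA B hB => ?_, fun H => ?_⟩
  · refine AnalyticAt.conj_comp isConjMap_par (f := c) ?_
    have := hc _ (map_cj_mem' hB) _ (map_cj_mem hA)
    rwa [← cj_zero] at this
  · have hcj : Tendsto cj (𝓝 0) (𝓝 0) := continuous_cj.tendsto' _ _ cj_zero
    filter_upwards [hcj.eventually (h H)] with z hz
    rw [hz]
    simp only [coefFam, map_cj_map_cj]

lemma comp {f : ℂ → ℂ} (hf : AnalyticAt ℂ f 0) (h : IsBase φ) (h0 : ∀ H, φ H 0 = 0) :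
    IsBase (fun H z => f (φ H z)) := by
  obtain ⟨c, hc, h⟩ := h
  refine ⟨fun p => f (c p - c (0, p.2)), fun A hA B hB => ?_, fun H => ?_⟩
  · have h1 : AnalyticAt ℂ (fun p : Par => ((0, p.2) : Par)) (0, A, B) :=
      AnalyticAt.prod analyticAt_const analyticAt_snd
    have h2 : AnalyticAt ℂ (fun p => c p - c (0, p.2)) (0, A, B) := (hc A hA B hB).sub
      (AnalyticAt.fun_comp (f := fun p : Par => ((0, p.2) : Par)) (g := c) (hc A hA B hB) h1)
    refine AnalyticAt.fun_comp (g := f) ?_ h2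
    simpa using hf
  · have h1 := (h H).self_of_nhds
    rw [h0 H] at h1
    filter_upwards [h H] with z hz
    rw [hz]
    change f _ = f (c _ - c _)
    have : c (0, H.J, H.J.map cj) = 0 := h1.symm
    rw [this, sub_zero]; rfl

end IsBase

namespace IsBaseUnit

variable {φ ψ : Maps Q Q' → ℂ → ℂ}

lemma isBase (h : IsBaseUnit φ) : IsBase φ := by
  obtain ⟨c, hc, -, h⟩ := h
  exact ⟨c, hc, h⟩

lemma mul (h : IsBaseUnit φ) (h' : IsBaseUnit ψ) : IsBaseUnit (fun H z => φ H z * ψ H z) := by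
  obtain ⟨c, hc, hn, h⟩ := h
  obtain ⟨c', hc', hn', h'⟩ := h'
  exact ⟨fun p => c p * c' p, fun A hA B hB => (hc A hA B hB).mul (hc' A hA B hB),
    fun A hA B hB => mul_ne_zero (hn A hA B hB) (hn' A hA B hB), fun H => (h H).mul (h' H)⟩

lemma pow (h : IsBaseUnit φ) (n : ℕ) : IsBaseUnit (fun H z => φ H z ^ n) := by
  obtain ⟨c, hc, hn, h⟩ := h
  exact ⟨fun p => c p ^ n, fun A hA B hB => (hc A hA B hB).pow n,
    fun A hA B hB => pow_ne_zero _ (hn A hA B hB), fun H => (h H).pow_const n⟩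

lemma inv (h : IsBaseUnit φ) : IsBaseUnit (fun H z => (φ H z)⁻¹) := by
  obtain ⟨c, hc, hn, h⟩ := h
  exact ⟨fun p => (c p)⁻¹, fun A hA B hB => (hc A hA B hB).inv (hn A hA B hB),
    fun A hA B hB => inv_ne_zero (hn A hA B hB), fun H => (h H).inv⟩

lemma const {a : ℂ} (ha : a ≠ 0) : IsBaseUnit (fun (_ : Maps Q Q') (_ : ℂ) => a) :=
  ⟨fun _ => a, fun _ _ _ _ => analyticAt_const, fun _ _ _ _ => ha, fun _ => EventuallyEq.rfl⟩

lemma entry00 : IsBaseUnit (fun (H : Maps Q Q') (_ : ℂ) => H.J 0 0) :=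
  ⟨fun p => p.2.1 0 0, fun _ _ _ _ => analyticAt_entry_fst _ _ _, fun _ hA _ _ => hA.2.1,
    fun _ => EventuallyEq.rfl⟩

lemma entry00_conj : IsBaseUnit (fun (H : Maps Q Q') (_ : ℂ) => cj (H.J 0 0)) :=
  ⟨fun p => p.2.2 0 0, fun _ _ _ _ => analyticAt_entry_snd _ _ _,
    fun _ _ B hB => by
      obtain ⟨A, hA, rfl⟩ := hB
      exact fun h => hA.2.1 (cj_eq_zero.1 h), fun _ => EventuallyEq.rfl⟩

lemma of_eval (h : IsBase φ) (h' : IsBaseUnit ψ) (he : ∀ H, φ H 0 = ψ H 0) : IsBaseUnit φ := by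
  obtain ⟨c, hc, h⟩ := h
  obtain ⟨c', hc', hn', h'⟩ := h'
  have h1 : ∀ A B, AnalyticAt ℂ (fun p : Par => ((0, p.2) : Par)) (0, A, B) :=
    fun A B => AnalyticAt.prod analyticAt_const analyticAt_snd
  refine ⟨fun p => c p - c (0, p.2) + c' (0, p.2), fun A hA B hB => ?_, fun A hA B hB => ?_,
    fun H => ?_⟩
  · exact ((hc A hA B hB).sub (AnalyticAt.fun_comp (f := fun p : Par => ((0, p.2) : Par)) (g := c)
      (hc A hA B hB) (h1 A B))).add (AnalyticAt.fun_comp (f := fun p : Par => ((0, p.2) : Par))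
      (g := c') (hc' A hA B hB) (h1 A B))
  · simpa using hn' A hA B hB
  · have e1 : φ H 0 = c (0, H.J, H.J.map cj) := (h H).self_of_nhds
    have e2 : ψ H 0 = c' (0, H.J, H.J.map cj) := (h' H).self_of_nhds
    filter_upwards [h H] with z hz
    rw [hz]
    change _ = c (z, _) - c (0, H.J, H.J.map cj) + c' (0, H.J, H.J.map cj)
    rw [← e1, ← e2, he H, sub_add_cancel]; rfl

lemma ne_zero (h : IsBaseUnit φ) (hT : HasTriangularJacobians Q Q') (H : Maps Q Q') :
    φ H 0 ≠ 0 := by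
  obtain ⟨c, hc, hn, h⟩ := h
  have e1 : φ H 0 = c (0, H.J, H.J.map cj) := (h H).self_of_nhds
  rw [e1]
  exact hn _ (hT H) _ (map_cj_mem (hT H))

end IsBaseUnit

/-- Families of germs which are polynomial in the `K`-jet and its conjugate, with coefficients
depending analytically on the `1`-jet. -/
inductive JetPoly (K : ℕ) : (Maps Q Q' → ℂ → ℂ) → Prop
  | base {φ : Maps Q Q' → ℂ → ℂ} (h : IsBase φ) : JetPoly K φ
  | congr {φ ψ : Maps Q Q' → ℂ → ℂ} (h : JetPoly K φ) (he : ∀ H, φ H =ᶠ[𝓝 0] ψ H) : JetPoly K ψ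
  | add {φ ψ : Maps Q Q' → ℂ → ℂ} (h : JetPoly K φ) (h' : JetPoly K ψ) :
      JetPoly K (fun H z => φ H z + ψ H z)
  | jet_mul {φ : Maps Q Q' → ℂ → ℂ} (p : (ℕ × ℕ) × Bool) (hp : p.1 ∈ JetSet K)
      (h : JetPoly K φ) : JetPoly K (fun H z => H.jet p * φ H z)
  | conj_jet_mul {φ : Maps Q Q' → ℂ → ℂ} (p : (ℕ × ℕ) × Bool) (hp : p.1 ∈ JetSet K)
      (h : JetPoly K φ) : JetPoly K (fun H z => cj (H.jet p) * φ H z)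

lemma ds_add {f g : ℂ → ℂ} (hf : AnalyticAt ℂ f 0) (hg : AnalyticAt ℂ g 0) :
    ds (fun z => f z + g z) =ᶠ[𝓝 0] fun z => ds f z + ds g z := by
  have h1 := hf.ds.continuousAt
  have h2 := hg.ds.continuousAt
  refine dslope_eq_of_expand (h := fun z => f z + g z) (a := f 0 + g 0)
    (g := fun z => ds f z + ds g z) (h1.add h2) ?_
  refine Eventually.of_forall fun z => ?_
  rw [ds_expand f z, ds_expand g z, smul_eq_mul]
  ring

lemma ds_const_mul {f : ℂ → ℂ} (hf : AnalyticAt ℂ f 0) (a : ℂ) :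
    ds (fun z => a * f z) =ᶠ[𝓝 0] fun z => a * ds f z := by
  have h1 := hf.ds.continuousAt
  refine dslope_eq_of_expand (h := fun z => a * f z) (a := a * f 0) (g := fun z => a * ds f z)
    (by fun_prop) ?_
  refine Eventually.of_forall fun z => ?_
  rw [ds_expand f z, smul_eq_mul]
  ring

lemma mem_jetSet {K : ℕ} {p : ℕ × ℕ} : p ∈ JetSet K ↔ 1 ≤ p.1 + p.2 ∧ p.1 + p.2 ≤ K := by
  simp only [JetSet, Finset.mem_filter, Finset.mem_product, Finset.mem_range]
  omega

namespace JetPoly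

variable {K : ℕ} {φ ψ : Maps Q Q' → ℂ → ℂ}

lemma mono {L : ℕ} (hKL : K ≤ L) (h : JetPoly K φ) : JetPoly L φ := by
  have hs : ∀ p, p ∈ JetSet K → p ∈ JetSet L := fun p hp => by
    rw [mem_jetSet] at hp ⊢; omega
  induction h with
  | base h => exact .base h
  | congr _ he ih => exact ih.congr he
  | add _ _ ih ih' => exact ih.add ih'
  | jet_mul p hp _ ih => exact ih.jet_mul p (hs _ hp)
  | conj_jet_mul p hp _ ih => exact ih.conj_jet_mul p (hs _ hp)

lemma base_mul (hb : IsBase ψ) (h : JetPoly K φ) : JetPoly K (fun H z => ψ H z * φ H z) := by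
  induction h with
  | base h => exact .base (hb.mul h)
  | congr _ he ih => exact ih.congr fun H => EventuallyEq.rfl.mul (he H)
  | add _ _ ih ih' =>
    exact (ih.add ih').congr fun H => Eventually.of_forall fun z => by
      simp only; ring
  | jet_mul p hp _ ih =>
    exact (ih.jet_mul p hp).congr fun H => Eventually.of_forall fun z => by
      simp only; ring
  | conj_jet_mul p hp _ ih =>
    exact (ih.conj_jet_mul p hp).congr fun H => Eventually.of_forall fun z => by
      simp only; ring

lemma mul (h : JetPoly K φ) (h' : JetPoly K ψ) : JetPoly K (fun H z => φ H z * ψ H z) := by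
  induction h with
  | base h => exact base_mul h h'
  | congr _ he ih => exact ih.congr fun H => (he H).mul EventuallyEq.rfl
  | add _ _ ih ih' =>
    exact (ih.add ih').congr fun H => Eventually.of_forall fun z => by
      simp only; ring
  | jet_mul p hp _ ih =>
    exact (ih.jet_mul p hp).congr fun H => Eventually.of_forall fun z => by
      simp only; ring
  | conj_jet_mul p hp _ ih =>
    exact (ih.conj_jet_mul p hp).congr fun H => Eventually.of_forall fun z => by
      simp only; ring

lemma const (a : ℂ) : JetPoly K (fun (_ : Maps Q Q') (_ : ℂ) => a) := .base (IsBase.const a)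

lemma neg (h : JetPoly K φ) : JetPoly K (fun H z => -φ H z) :=
  ((const (-1)).mul h).congr fun H => Eventually.of_forall fun z => by simp

lemma sub (h : JetPoly K φ) (h' : JetPoly K ψ) : JetPoly K (fun H z => φ H z - ψ H z) :=
  (h.add h'.neg).congr fun _ => Eventually.of_forall fun _ => (sub_eq_add_neg _ _).symm

lemma jet {p : (ℕ × ℕ) × Bool} (hp : p.1 ∈ JetSet K) :
    JetPoly K (fun (H : Maps Q Q') (_ : ℂ) => H.jet p) :=
  ((const 1).jet_mul p hp).congr fun H => Eventually.of_forall fun z => by simp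

lemma analyticAt (hT : HasTriangularJacobians Q Q') (h : JetPoly K φ) (H : Maps Q Q') :
    AnalyticAt ℂ (φ H) 0 := by
  induction h with
  | base h => exact h.analyticAt hT H
  | congr _ he ih => exact ih.congr (he H)
  | add _ _ ih ih' => exact ih.add ih'
  | jet_mul p hp _ ih => exact analyticAt_const.mul ih
  | conj_jet_mul p hp _ ih => exact analyticAt_const.mul ih

lemma ds (hT : HasTriangularJacobians Q Q') (h : JetPoly K φ) :
    JetPoly K (fun H => ds (φ H)) := by
  induction h with
  | base h => exact .base h.ds
  | congr _ he ih => exact ih.congr fun H => ds_congr (he H)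
  | add h h' ih ih' =>
    exact (ih.add ih').congr fun H => (ds_add (h.analyticAt hT H) (h'.analyticAt hT H)).symm
  | jet_mul p hp h ih =>
    exact (ih.jet_mul p hp).congr fun H => (ds_const_mul (h.analyticAt hT H) _).symm
  | conj_jet_mul p hp h ih =>
    exact (ih.conj_jet_mul p hp).congr fun H => (ds_const_mul (h.analyticAt hT H) _).symm

lemma iterate_ds (hT : HasTriangularJacobians Q Q') (h : JetPoly K φ) (n : ℕ) :
    JetPoly K (fun H => _root_.ds^[n] (φ H)) := by
  induction n generalizing φ with
  | zero => exact h
  | succ n ih => exact ih (h.ds hT)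

lemma eval (h : JetPoly K φ) : JetPoly K (fun H _ => φ H 0) := by
  induction h with
  | base h => exact .base h.eval
  | congr _ he ih => exact ih.congr fun H => Eventually.of_forall fun _ => (he H).self_of_nhds
  | add _ _ ih ih' => exact ih.add ih'
  | jet_mul p hp _ ih => exact ih.jet_mul p hp
  | conj_jet_mul p hp _ ih => exact ih.conj_jet_mul p hp

lemma tc (hT : HasTriangularJacobians Q Q') (h : JetPoly K φ) (n : ℕ) :
    JetPoly K (fun H _ => tc n (φ H)) := (h.iterate_ds hT n).eval

lemma bar (h : JetPoly K φ) : JetPoly K (fun H z => cj (φ H (cj z))) := by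
  have hcj : Tendsto cj (𝓝 0) (𝓝 0) := continuous_cj.tendsto' _ _ cj_zero
  induction h with
  | base h => exact .base h.bar
  | congr _ he ih =>
    exact ih.congr fun H => by
      filter_upwards [hcj.eventually (he H)] with z hz
      rw [hz]
  | add _ _ ih ih' =>
    exact (ih.add ih').congr fun H => Eventually.of_forall fun z => by
      simp only [cj_add]
  | jet_mul p hp _ ih =>
    exact (ih.conj_jet_mul p hp).congr fun H => Eventually.of_forall fun z => by
      simp only [cj_mul]
  | conj_jet_mul p hp _ ih =>
    exact (ih.jet_mul p hp).congr fun H => Eventually.of_forall fun z => by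
      simp only [cj_mul, cj_cj]

end JetPoly

/-- The exponents of a monomial in the `K`-jet and its conjugate. -/
abbrev JetExp (K : ℕ) : Type := (JetIdx K → ℕ) × (JetIdx K → ℕ)

/-- The value of a monomial in the `K`-jet and its conjugate. -/
def jetMon {K : ℕ} (e : JetExp K) (H : Maps Q Q') : ℂ :=
  (∏ i, jetMap K H.F H.G i ^ e.1 i) * (∏ i, cj (jetMap K H.F H.G i) ^ e.2 i)

lemma prod_pow_add_single {ι : Type*} [Fintype ι] [DecidableEq ι] (x : ι → ℂ) (e : ι → ℕ) (p : ι) :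
    ∏ i, x i ^ (e + Pi.single p 1 : ι → ℕ) i = x p * ∏ i, x i ^ e i := by
  have : ∀ i, x i ^ (e + Pi.single p 1 : ι → ℕ) i = x i ^ (Pi.single p 1 : ι → ℕ) i * x i ^ e i := fun i => by
    rw [Pi.add_apply, add_comm, pow_add]
  simp only [this, Finset.prod_mul_distrib]
  congr 1
  rw [Finset.prod_eq_single p]
  · simp
  · intro i _ hi; simp [hi]
  · simp

open Classical in
lemma JetPoly.exists_sum {K : ℕ} {φ : Maps Q Q' → ℂ → ℂ} (h : JetPoly K φ) :
    ∃ (T : Type) (_ : Fintype T) (s : T → JetExp K) (c : T → Par → ℂ),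
      (∀ t, CoefAnalytic (c t)) ∧
      ∀ H, φ H =ᶠ[𝓝 0] fun z => ∑ t, jetMon (s t) H * coefFam (c t) H z := by
  induction h with
  | base h =>
    obtain ⟨c, hc, h⟩ := h
    refine ⟨Unit, inferInstance, fun _ => 0, fun _ => c, fun _ => hc, fun H => ?_⟩
    refine (h H).trans (Eventually.of_forall fun z => ?_)
    simp [jetMon]
  | congr _ he ih =>
    obtain ⟨T, hT, s, c, hc, h⟩ := ih
    exact ⟨T, hT, s, c, hc, fun H => (he H).symm.trans (h H)⟩
  | add _ _ ih ih' =>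
    obtain ⟨T, hT, s, c, hc, h⟩ := ih
    obtain ⟨T', hT', s', c', hc', h'⟩ := ih'
    refine ⟨T ⊕ T', inferInstance, Sum.elim s s', Sum.elim c c', ?_, fun H => ?_⟩
    · rintro (t | t)
      exacts [hc t, hc' t]
    · refine ((h H).add (h' H)).trans (Eventually.of_forall fun z => ?_)
      simp
  | jet_mul p hp _ ih =>
    obtain ⟨T, hT, s, c, hc, h⟩ := ih
    refine ⟨T, hT, fun t => ((s t).1 + Pi.single (⟨p.1, hp⟩, p.2) 1, (s t).2), c, hc, fun H => ?_⟩
    filter_upwards [h H] with z hz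
    rw [hz, Finset.mul_sum]
    refine Finset.sum_congr rfl fun t _ => ?_
    simp only [jetMon]
    rw [prod_pow_add_single]
    simp only [jetMap, Maps.jet]
    ring
  | conj_jet_mul p hp _ ih =>
    obtain ⟨T, hT, s, c, hc, h⟩ := ih
    refine ⟨T, hT, fun t => ((s t).1, (s t).2 + Pi.single (⟨p.1, hp⟩, p.2) 1), c, hc, fun H => ?_⟩
    filter_upwards [h H] with z hz
    rw [hz, Finset.mul_sum]
    refine Finset.sum_congr rfl fun t _ => ?_
    simp only [jetMon]
    rw [prod_pow_add_single (fun i => cj (jetMap K H.F H.G i))]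
    simp only [jetMap, Maps.jet]
    ring

open Classical in
/-- Two jet-polynomial families assemble into a parametrization. -/
lemma JetPoly.exists_parametrization {K : ℕ} {φ ψ : Maps Q Q' → ℂ → ℂ}
    (hT : HasTriangularJacobians Q Q') (hφ : JetPoly K φ) (hψ : JetPoly K ψ) :
    ∃ (V : Set Par) (S : Finset (JetExp K)) (c : JetExp K → Par → ℂ × ℂ),
      IsOpen V ∧
      (∀ A B : Matrix (Fin 2) (Fin 2) ℂ, A ∈ Tmat → B ∈ TmatConj → ((0 : ℂ), A, B) ∈ V) ∧
      (∀ ab ∈ S, AnalyticOnNhd ℂ (c ab) V) ∧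
      ∀ H : Maps Q Q', ∀ᶠ z : ℂ in 𝓝 0, (z, H.J, H.J.map cj) ∈ V ∧
        (φ H z, ψ H z) = ∑ ab ∈ S, jetMon ab H • c ab (z, H.J, H.J.map cj) := by
  obtain ⟨T, hT1, s, c, hc, h⟩ := hφ.exists_sum
  obtain ⟨T', hT2, s', c', hc', h'⟩ := hψ.exists_sum
  let r : T ⊕ T' → JetExp K := Sum.elim s s'
  let d : T ⊕ T' → Par → ℂ × ℂ := Sum.elim (fun t x => (c t x, 0)) (fun t x => (0, c' t x))
  have hd : ∀ t, ∀ A ∈ Tmat, ∀ B ∈ TmatConj, AnalyticAt ℂ (d t) (0, A, B) := by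
    rintro (t | t) A hA B hB
    · exact AnalyticAt.prod (hc t A hA B hB) analyticAt_const
    · exact AnalyticAt.prod analyticAt_const (hc' t A hA B hB)
  let V : Set Par := ⋂ t, {x | AnalyticAt ℂ (d t) x}
  have hV : IsOpen V := isOpen_iInter_of_finite fun t => isOpen_analyticAt ℂ (d t)
  have hmem : ∀ A ∈ Tmat, ∀ B ∈ TmatConj, ((0 : ℂ), A, B) ∈ V := fun A hA B hB =>
    Set.mem_iInter.2 fun t => hd t A hA B hB
  refine ⟨V, Finset.univ.image r, fun e x => ∑ t with r t = e, d t x, hV,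
    fun A B hA hB => hmem A hA B hB, fun e _ x hx => ?_, fun H => ?_⟩
  · exact Finset.analyticAt_fun_sum _ fun t _ => Set.mem_iInter.1 hx t
  · have hmV : ∀ᶠ z : ℂ in 𝓝 0, ((z, H.J, H.J.map cj) : Par) ∈ V :=
      (tendsto_par _ _).eventually (hV.mem_nhds (hmem _ (hT H) _ (map_cj_mem (hT H))))
    filter_upwards [h H, h' H, hmV] with z hz hz' hzV
    refine ⟨hzV, ?_⟩
    have e1 : ∀ e ∈ Finset.univ.image r, jetMon e H • ∑ t with r t = e, d t (z, H.J, H.J.map cj) =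
        ∑ t with r t = e, jetMon (r t) H • d t (z, H.J, H.J.map cj) := fun e _ => by
      rw [Finset.smul_sum]
      refine Finset.sum_congr rfl fun t ht => ?_
      rw [(Finset.mem_filter.1 ht).2]
    rw [Finset.sum_congr rfl e1, Finset.sum_fiberwise_of_maps_to
      (fun t _ => Finset.mem_image_of_mem r (Finset.mem_univ t)), Fintype.sum_sum_type, hz, hz']
    ext <;> simp [r, d, coefFam, Prod.fst_sum, Prod.snd_sum]

/-- The normal form `Q = τ + τ^m R`, `R = z^α S(z,χ) + τ T`. -/
structure NormalForm (Q : ℂ → ℂ → ℂ → ℂ) (m α : ℕ) (R T : ℂ × ℂ × ℂ → ℂ) (S : ℂ × ℂ → ℂ) :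
    Prop where
  analytic_R : AnalyticAt ℂ R 0
  analytic_T : AnalyticAt ℂ T 0
  analytic_S : AnalyticAt ℂ S 0
  eq_Q : ∀ᶠ p : ℂ × ℂ × ℂ in 𝓝 0, Q p.1 p.2.1 p.2.2 = p.2.2 + p.2.2 ^ m * R p
  eq_R : ∀ᶠ p : ℂ × ℂ × ℂ in 𝓝 0, R p = p.1 ^ α * S (p.1, p.2.1) + p.2.2 * T p
  fst_zero : ∀ᶠ q : ℂ × ℂ in 𝓝 0, R (0, q.1, q.2) = 0
  snd_zero : ∀ᶠ q : ℂ × ℂ in 𝓝 0, R (q.1, 0, q.2) = 0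

/-- Precomposition by a continuous linear map preserves analyticity at `0`. -/
lemma AnalyticAt.comp_clm {E E' W : Type*} [NormedAddCommGroup E] [NormedSpace ℂ E]
    [NormedAddCommGroup E'] [NormedSpace ℂ E'] [NormedAddCommGroup W] [NormedSpace ℂ W]
    {f : E' → W} (hf : AnalyticAt ℂ f 0) (L : E →L[ℂ] E') :
    AnalyticAt ℂ (fun x => f (L x)) 0 := by
  refine AnalyticAt.fun_comp (g := f) (f := L) ?_ (L.analyticAt 0)
  rwa [map_zero]

lemma eventually_comp_clm {E E' : Type*} [NormedAddCommGroup E] [NormedSpace ℂ E]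
    [NormedAddCommGroup E'] [NormedSpace ℂ E'] (L : E →L[ℂ] E') {P : E' → Prop}
    (h : ∀ᶠ y in 𝓝 0, P y) : ∀ᶠ x in 𝓝 0, P (L x) :=
  (L.continuous.tendsto' 0 0 (map_zero L)).eventually h

/-- `(z, χ, τ) ↦ (τ, z, χ)`. -/
def rotL : ℂ × ℂ × ℂ →L[ℂ] ℂ × ℂ × ℂ :=
  ((ContinuousLinearMap.snd ℂ ℂ ℂ).comp (ContinuousLinearMap.snd ℂ ℂ (ℂ × ℂ))).prod
    ((ContinuousLinearMap.fst ℂ ℂ (ℂ × ℂ)).prod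
      ((ContinuousLinearMap.fst ℂ ℂ ℂ).comp (ContinuousLinearMap.snd ℂ ℂ (ℂ × ℂ))))

lemma rotL_apply (p : ℂ × ℂ × ℂ) : rotL p = (p.2.2, p.1, p.2.1) := rfl

/-- `(τ, z, χ) ↦ (z, χ, τ)`. -/
def rotR : ℂ × ℂ × ℂ →L[ℂ] ℂ × ℂ × ℂ :=
  ((ContinuousLinearMap.fst ℂ ℂ ℂ).comp (ContinuousLinearMap.snd ℂ ℂ (ℂ × ℂ))).prod
    (((ContinuousLinearMap.snd ℂ ℂ ℂ).comp (ContinuousLinearMap.snd ℂ ℂ (ℂ × ℂ))).prod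
      (ContinuousLinearMap.fst ℂ ℂ (ℂ × ℂ)))

lemma tau_cancel {f : ℂ × ℂ × ℂ → ℂ} (hf : AnalyticAt ℂ f 0) {m : ℕ}
    (h : ∀ᶠ p in 𝓝 (0 : ℂ × ℂ × ℂ), p.2.2 ^ m * f p = 0) : ∀ᶠ p in 𝓝 0, f p = 0 :=
  eventually_eq_zero_of_pow_smul hf
    ((ContinuousLinearMap.snd ℂ ℂ ℂ).comp (ContinuousLinearMap.snd ℂ ℂ (ℂ × ℂ))) (0, 0, 1) rfl h

lemma tau_cancel₂ {f : ℂ × ℂ → ℂ} (hf : AnalyticAt ℂ f 0) {m : ℕ}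
    (h : ∀ᶠ p in 𝓝 (0 : ℂ × ℂ), p.2 ^ m * f p = 0) : ∀ᶠ p in 𝓝 0, f p = 0 :=
  eventually_eq_zero_of_pow_smul hf (ContinuousLinearMap.snd ℂ ℂ ℂ) (0, 1) rfl h

/-- `(χ, τ) ↦ (0, χ, τ)`. -/
def inclFst : ℂ × ℂ →L[ℂ] ℂ × ℂ × ℂ := ContinuousLinearMap.inr ℂ ℂ (ℂ × ℂ)

lemma inclFst_apply (q : ℂ × ℂ) : inclFst q = (0, q.1, q.2) := rfl

/-- `(z, τ) ↦ (z, 0, τ)`. -/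
def inclSnd : ℂ × ℂ →L[ℂ] ℂ × ℂ × ℂ :=
  (ContinuousLinearMap.fst ℂ ℂ ℂ).prod ((0 : ℂ × ℂ →L[ℂ] ℂ).prod (ContinuousLinearMap.snd ℂ ℂ ℂ))

lemma inclSnd_apply (q : ℂ × ℂ) : inclSnd q = (q.1, 0, q.2) := rfl

lemma normalForm_of_components {Q : ℂ → ℂ → ℂ → ℂ} (hQ : IsNormalCoord Q) {m α : ℕ}
    {g t : ℂ × ℂ × ℂ → ℂ} {s : ℂ × ℂ → ℂ} (hg : AnalyticAt ℂ g 0) (ht : AnalyticAt ℂ t 0)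
    (hs : AnalyticAt ℂ s 0)
    (h1 : ∀ᶠ p : ℂ × ℂ × ℂ in 𝓝 0, Q p.2.1 p.2.2 p.1 - p.1 = p.1 ^ m * g p)
    (h2 : ∀ᶠ p : ℂ × ℂ × ℂ in 𝓝 0, g p = p.2.1 ^ α * s p.2 + p.1 * t p) :
    NormalForm Q m α (fun p => g (rotL p)) (fun p => t (rotL p)) s := by
  have hR := hg.comp_clm rotL
  have e1 : ∀ᶠ p : ℂ × ℂ × ℂ in 𝓝 0, Q p.1 p.2.1 p.2.2 = p.2.2 + p.2.2 ^ m * g (rotL p) := by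
    filter_upwards [eventually_comp_clm rotL h1] with p hp
    rw [rotL_apply] at hp ⊢
    simp only at hp
    rw [← hp]; ring
  refine ⟨hR, ht.comp_clm rotL, hs, e1, eventually_comp_clm rotL h2, ?_, ?_⟩
  · refine tau_cancel₂ (m := m) (f := fun q => g (rotL (inclFst q))) (hR.comp_clm inclFst) ?_
    filter_upwards [eventually_comp_clm inclFst e1, hQ.2.2.1] with q hq1 hq2
    simp only [inclFst_apply] at hq1 ⊢
    rw [hq2] at hq1
    linear_combination -hq1
  · refine tau_cancel₂ (m := m) (f := fun q => g (rotL (inclSnd q))) (hR.comp_clm inclSnd) ?_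
    filter_upwards [eventually_comp_clm inclSnd e1, hQ.2.1] with q hq1 hq2
    simp only [inclSnd_apply] at hq1 ⊢
    rw [hq2] at hq1
    linear_combination -hq1

lemma exists_normalForms {Q Q' : ℂ → ℂ → ℂ → ℂ} (hQ : IsNormalCoord Q) (hQ' : IsNormalCoord Q')
    (hLF : NotLeviFlat Q) :
    ∃ (m α : ℕ) (R T R' T' : ℂ × ℂ × ℂ → ℂ) (S S' : ℂ × ℂ → ℂ),
      NormalForm Q m (α + 1) R T S ∧ NormalForm Q' m (α + 1) R' T' S' ∧
      ¬ ∀ᶠ χ in 𝓝 (0 : ℂ), S (0, χ) = 0 ∧ S' (0, χ) = 0 := by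
  let f : ℂ × ℂ × ℂ → ℂ × ℂ := fun p => (Q p.2.1 p.2.2 p.1 - p.1, Q' p.2.1 p.2.2 p.1 - p.1)
  have hf : AnalyticAt ℂ f 0 := by
    refine AnalyticAt.prod ?_ ?_
    · exact (hQ.1.comp_clm rotR).sub analyticAt_fst
    · exact (hQ'.1.comp_clm rotR).sub analyticAt_fst
  have hne : ¬ ∀ᶠ p in 𝓝 0, f p = 0 := fun h => hLF (by
    filter_upwards [eventually_comp_clm rotL h] with p hp
    have := congrArg Prod.fst hp
    simpa [f, rotL_apply, sub_eq_zero] using this)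
  obtain ⟨m, g, hg, hfg, hg0⟩ := exists_eq_pow_smul hf hne
  have hh : AnalyticAt ℂ (fun q : ℂ × ℂ => g (0, q)) 0 :=
    hg.comp_clm (ContinuousLinearMap.inr ℂ ℂ (ℂ × ℂ))
  obtain ⟨α, s, hs, hgs, hs0⟩ := exists_eq_pow_smul hh hg0
  obtain ⟨t, ht, hgt⟩ := exists_div_fst (y0 := (0 : ℂ × ℂ)) hg
  have hgs' : ∀ᶠ p : ℂ × ℂ × ℂ in 𝓝 0, g (0, p.2) = p.2.1 ^ α • s p.2 :=
    eventually_comp_clm (ContinuousLinearMap.snd ℂ ℂ (ℂ × ℂ)) hgs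
  have c1 : ∀ {E : Type} [NormedAddCommGroup E] [NormedSpace ℂ E] {h : E → ℂ × ℂ},
      AnalyticAt ℂ h 0 → AnalyticAt ℂ (fun x => (h x).1) 0 := fun h => analyticAt_fst.comp h
  have c2 : ∀ {E : Type} [NormedAddCommGroup E] [NormedSpace ℂ E] {h : E → ℂ × ℂ},
      AnalyticAt ℂ h 0 → AnalyticAt ℂ (fun x => (h x).2) 0 := fun h => analyticAt_snd.comp h
  have N1 := normalForm_of_components hQ (m := m) (α := α) (c1 hg) (c1 ht) (c1 hs)
    (by filter_upwards [hfg] with p hp using congrArg Prod.fst hp)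
    (by
      filter_upwards [hgt, hgs'] with p h1 h2
      rw [h1, h2]; simp)
  have N2 := normalForm_of_components hQ' (m := m) (α := α) (c2 hg) (c2 ht) (c2 hs)
    (by filter_upwards [hfg] with p hp using congrArg Prod.snd hp)
    (by
      filter_upwards [hgt, hgs'] with p h1 h2
      rw [h1, h2]; simp)
  have hS0 : ¬ ∀ᶠ χ in 𝓝 (0 : ℂ), (s (0, χ)).1 = 0 ∧ (s (0, χ)).2 = 0 := fun h => hs0 (by
    filter_upwards [h] with χ h
    exact Prod.ext h.1 h.2)
  rcases α with _ | α
  · exfalso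
    apply hS0
    have e : ∀ {E : Type} [NormedAddCommGroup E] [NormedSpace ℂ E] (L : ℂ →L[ℂ] E) {P : E → Prop},
      (∀ᶠ y in 𝓝 0, P y) → ∀ᶠ x in 𝓝 0, P (L x) := fun L _ h => eventually_comp_clm L h
    filter_upwards [e (ContinuousLinearMap.inl ℂ ℂ ℂ) N1.fst_zero,
      e (ContinuousLinearMap.inl ℂ ℂ ℂ) N2.fst_zero,
      e (ContinuousLinearMap.inr ℂ ℂ ℂ) hgs] with χ h1 h2 h3
    simp only [ContinuousLinearMap.inl_apply, ContinuousLinearMap.inr_apply, rotL_apply, pow_zero,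
      one_smul] at h1 h2 h3
    rw [← h3]
    exact ⟨h1, h2⟩
  · exact ⟨m, α, _, _, _, _, _, _, N1, N2, hS0⟩

/-- The ring of functions of `(z, χ, τ)` analytic at the origin. -/
def anRing : Subring (ℂ × ℂ × ℂ → ℂ) where
  carrier := {f | AnalyticAt ℂ f 0}
  mul_mem' hf hg := AnalyticAt.mul hf hg
  one_mem' := analyticAt_const
  add_mem' hf hg := AnalyticAt.add hf hg
  zero_mem' := analyticAt_const
  neg_mem' hf := AnalyticAt.neg hf

/-- The ideal of germs `z^{a+1} u + τ^{b+1} v`. -/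
def truncIdeal (a b : ℕ) : Ideal anRing where
  carrier := {f | ∃ u v : ℂ × ℂ × ℂ → ℂ, AnalyticAt ℂ u 0 ∧ AnalyticAt ℂ v 0 ∧
    ∀ᶠ p in 𝓝 0, f.1 p = p.1 ^ (a + 1) * u p + p.2.2 ^ (b + 1) * v p}
  add_mem' := by
    rintro f g ⟨u, v, hu, hv, h⟩ ⟨u', v', hu', hv', h'⟩
    refine ⟨_, _, hu.add hu', hv.add hv', ?_⟩
    filter_upwards [h, h'] with p h h'
    change f.1 p + g.1 p = _
    rw [h, h', Pi.add_apply, Pi.add_apply]; ring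
  zero_mem' := ⟨0, 0, analyticAt_const, analyticAt_const, Eventually.of_forall fun p => by simp⟩
  smul_mem' := by
    rintro c f ⟨u, v, hu, hv, h⟩
    refine ⟨_, _, AnalyticAt.mul c.2 hu, AnalyticAt.mul c.2 hv, ?_⟩
    filter_upwards [h] with p h
    change c.1 p * f.1 p = _
    rw [h, Pi.mul_apply, Pi.mul_apply]; ring

/-- Analytic germs in `(z, χ, τ)` modulo `z^{a+1}` and `τ^{b+1}`. -/
abbrev TruncRing (a b : ℕ) : Type := anRing ⧸ truncIdeal a b

section ToTrunc

variable {a b : ℕ} {f g : ℂ × ℂ × ℂ → ℂ}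

open Classical in
/-- The class of a function analytic at the origin. -/
def toTrunc (a b : ℕ) (f : ℂ × ℂ × ℂ → ℂ) : TruncRing a b :=
  if h : AnalyticAt ℂ f 0 then Ideal.Quotient.mk _ ⟨f, h⟩ else 0

lemma toTrunc_of (hf : AnalyticAt ℂ f 0) :
    toTrunc a b f = Ideal.Quotient.mk (truncIdeal a b) ⟨f, hf⟩ := dif_pos hf

lemma toTrunc_eq_zero (hf : AnalyticAt ℂ f 0) : toTrunc a b f = 0 ↔
    ∃ u v : ℂ × ℂ × ℂ → ℂ, AnalyticAt ℂ u 0 ∧ AnalyticAt ℂ v 0 ∧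
      ∀ᶠ p in 𝓝 0, f p = p.1 ^ (a + 1) * u p + p.2.2 ^ (b + 1) * v p := by
  rw [toTrunc_of hf, Ideal.Quotient.eq_zero_iff_mem]
  rfl

lemma toTrunc_add (hf : AnalyticAt ℂ f 0) (hg : AnalyticAt ℂ g 0) :
    toTrunc a b (fun p => f p + g p) = toTrunc a b f + toTrunc a b g := by
  rw [toTrunc_of hf, toTrunc_of hg, toTrunc_of (hf.fun_add hg)]
  exact map_add (Ideal.Quotient.mk (truncIdeal a b)) ⟨f, hf⟩ ⟨g, hg⟩

lemma toTrunc_mul (hf : AnalyticAt ℂ f 0) (hg : AnalyticAt ℂ g 0) :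
    toTrunc a b (fun p => f p * g p) = toTrunc a b f * toTrunc a b g := by
  rw [toTrunc_of hf, toTrunc_of hg, toTrunc_of (hf.fun_mul hg)]
  exact map_mul (Ideal.Quotient.mk (truncIdeal a b)) ⟨f, hf⟩ ⟨g, hg⟩

lemma toTrunc_neg (hf : AnalyticAt ℂ f 0) :
    toTrunc a b (fun p => -f p) = -toTrunc a b f := by
  rw [toTrunc_of hf, toTrunc_of hf.fun_neg]
  exact map_neg (Ideal.Quotient.mk (truncIdeal a b)) ⟨f, hf⟩

lemma toTrunc_sub (hf : AnalyticAt ℂ f 0) (hg : AnalyticAt ℂ g 0) :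
    toTrunc a b (fun p => f p - g p) = toTrunc a b f - toTrunc a b g := by
  rw [toTrunc_of hf, toTrunc_of hg, toTrunc_of (hf.fun_sub hg)]
  exact map_sub (Ideal.Quotient.mk (truncIdeal a b)) ⟨f, hf⟩ ⟨g, hg⟩

lemma toTrunc_pow (hf : AnalyticAt ℂ f 0) (n : ℕ) :
    toTrunc a b (fun p => f p ^ n) = toTrunc a b f ^ n := by
  rw [toTrunc_of hf, toTrunc_of (hf.fun_pow n)]
  exact map_pow (Ideal.Quotient.mk (truncIdeal a b)) ⟨f, hf⟩ n

lemma toTrunc_one : toTrunc a b (fun _ => 1) = 1 := by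
  rw [toTrunc_of analyticAt_const]; rfl

lemma toTrunc_zero : toTrunc a b (fun _ => 0) = 0 := by
  rw [toTrunc_of analyticAt_const]; rfl

lemma toTrunc_congr (h : f =ᶠ[𝓝 0] g) : toTrunc a b f = toTrunc a b g := by
  by_cases hf : AnalyticAt ℂ f 0
  · have hg := hf.congr h
    rw [← sub_eq_zero, ← toTrunc_sub hf hg, toTrunc_eq_zero (hf.fun_sub hg)]
    refine ⟨0, 0, analyticAt_const, analyticAt_const, ?_⟩
    filter_upwards [h] with p hp
    simp [hp]
  · have hg : ¬ AnalyticAt ℂ g 0 := fun hg => hf (hg.congr h.symm)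
    rw [toTrunc, toTrunc, dif_neg hf, dif_neg hg]

lemma toTrunc_sum {ι : Type*} (s : Finset ι) {f : ι → ℂ × ℂ × ℂ → ℂ}
    (hf : ∀ i ∈ s, AnalyticAt ℂ (f i) 0) :
    toTrunc a b (fun p => ∑ i ∈ s, f i p) = ∑ i ∈ s, toTrunc a b (f i) := by
  classical
  induction s using Finset.induction_on with
  | empty => simpa using toTrunc_zero
  | insert i s hi ih =>
    simp only [Finset.sum_insert hi]
    have h2 := fun j hj => hf j (Finset.mem_insert_of_mem hj)
    rw [toTrunc_add (hf i (Finset.mem_insert_self _ _)) (Finset.analyticAt_fun_sum _ h2), ih h2]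

/-- The class of `z`. -/
def zT (a b : ℕ) : TruncRing a b := toTrunc a b fun p => p.1

/-- The class of `τ`. -/
def tT (a b : ℕ) : TruncRing a b := toTrunc a b fun p => p.2.2

lemma an_z : AnalyticAt ℂ (fun p : ℂ × ℂ × ℂ => p.1) 0 := analyticAt_fst
lemma an_chi : AnalyticAt ℂ (fun p : ℂ × ℂ × ℂ => p.2.1) 0 := analyticAt_fst.comp analyticAt_snd
lemma an_tau : AnalyticAt ℂ (fun p : ℂ × ℂ × ℂ => p.2.2) 0 := analyticAt_snd.comp analyticAt_snd

lemma zT_pow : zT a b ^ (a + 1) = 0 := by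
  rw [zT, ← toTrunc_pow an_z, toTrunc_eq_zero (an_z.fun_pow _)]
  exact ⟨fun _ => 1, fun _ => 0, analyticAt_const, analyticAt_const,
    Eventually.of_forall fun p => by simp⟩

lemma tT_pow : tT a b ^ (b + 1) = 0 := by
  rw [tT, ← toTrunc_pow an_tau, toTrunc_eq_zero (an_tau.fun_pow _)]
  exact ⟨fun _ => 0, fun _ => 1, analyticAt_const, analyticAt_const,
    Eventually.of_forall fun p => by simp⟩

end ToTrunc

/-- Monomials in `z`, `τ` with jet-polynomial coefficients in `χ`. -/
def jetMonomials (Q Q' : ℂ → ℂ → ℂ → ℂ) (K a b : ℕ) : Submonoid (Maps Q Q' → TruncRing a b) where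
  carrier := {φ | ∃ (e : Maps Q Q' → ℂ → ℂ) (i j : ℕ), JetPoly K e ∧
    (∀ H, AnalyticAt ℂ (e H) 0) ∧
    φ = fun H => toTrunc a b (fun p => e H p.2.1) * zT a b ^ i * tT a b ^ j}
  mul_mem' := by
    rintro _ _ ⟨e, i, j, he, hea, rfl⟩ ⟨e', i', j', he', hea', rfl⟩
    refine ⟨_, i + i', j + j', he.mul he', fun H => (hea H).mul (hea' H), ?_⟩
    funext H
    have h1 : ∀ {f : ℂ → ℂ}, AnalyticAt ℂ f 0 →
      AnalyticAt ℂ (fun p : ℂ × ℂ × ℂ => f p.2.1) 0 := fun {f} hf =>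
        AnalyticAt.fun_comp (g := f) hf an_chi
    rw [toTrunc_mul (f := fun p => e H p.2.1) (g := fun p => e' H p.2.1) (h1 (hea H)) (h1 (hea' H))]
    simp only [Pi.mul_apply]
    ring
  one_mem' := ⟨fun _ _ => 1, 0, 0, .const 1, fun _ => analyticAt_const, by
    funext H; simp [toTrunc_one]⟩

/-- Families of truncated germs, polynomial in `z`, `τ` with jet-polynomial coefficients. -/
def jetRing (Q Q' : ℂ → ℂ → ℂ → ℂ) (K a b : ℕ) : Subring (Maps Q Q' → TruncRing a b) :=
  Subring.closure (jetMonomials Q Q' K a b)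

/-- Families of analytic functions whose truncations are jet-polynomial. -/
def InJet (K a b : ℕ) (f : Maps Q Q' → ℂ × ℂ × ℂ → ℂ) : Prop :=
  (∀ H, AnalyticAt ℂ (f H) 0) ∧ (fun H => toTrunc a b (f H)) ∈ jetRing Q Q' K a b

lemma AnalyticAt.comp_chi {f : ℂ → ℂ} (hf : AnalyticAt ℂ f 0) :
    AnalyticAt ℂ (fun p : ℂ × ℂ × ℂ => f p.2.1) 0 :=
  AnalyticAt.fun_comp (g := f) hf an_chi

lemma AnalyticAt.comp_z {f : ℂ → ℂ} (hf : AnalyticAt ℂ f 0) :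
    AnalyticAt ℂ (fun p : ℂ × ℂ × ℂ => f p.1) 0 :=
  AnalyticAt.fun_comp (g := f) hf an_z

namespace InJet

variable {K a b : ℕ} {f g : Maps Q Q' → ℂ × ℂ × ℂ → ℂ}

lemma add (hf : InJet K a b f) (hg : InJet K a b g) : InJet K a b fun H p => f H p + g H p :=
  ⟨fun H => (hf.1 H).add (hg.1 H), by
    simp only [fun H => toTrunc_add (a := a) (b := b) (hf.1 H) (hg.1 H)]
    exact add_mem hf.2 hg.2⟩

lemma mul (hf : InJet K a b f) (hg : InJet K a b g) : InJet K a b fun H p => f H p * g H p :=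
  ⟨fun H => (hf.1 H).mul (hg.1 H), by
    simp only [fun H => toTrunc_mul (a := a) (b := b) (hf.1 H) (hg.1 H)]
    exact mul_mem hf.2 hg.2⟩

lemma sub (hf : InJet K a b f) (hg : InJet K a b g) : InJet K a b fun H p => f H p - g H p :=
  ⟨fun H => (hf.1 H).sub (hg.1 H), by
    simp only [fun H => toTrunc_sub (a := a) (b := b) (hf.1 H) (hg.1 H)]
    exact sub_mem hf.2 hg.2⟩

lemma pow (hf : InJet K a b f) (n : ℕ) : InJet K a b fun H p => f H p ^ n :=
  ⟨fun H => (hf.1 H).pow n, by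
    simp only [fun H => toTrunc_pow (a := a) (b := b) (hf.1 H) n]
    exact pow_mem hf.2 n⟩

lemma sum {ι : Type*} (s : Finset ι) {f : ι → Maps Q Q' → ℂ × ℂ × ℂ → ℂ}
    (hf : ∀ i ∈ s, InJet K a b (f i)) : InJet K a b fun H p => ∑ i ∈ s, f i H p :=
  ⟨fun H => Finset.analyticAt_fun_sum _ fun i hi => (hf i hi).1 H, by
    simp only [fun H => toTrunc_sum (a := a) (b := b) s fun i hi => (hf i hi).1 H]
    have := sum_mem (S := jetRing Q Q' K a b) (t := s)
      (f := fun i => fun H => toTrunc a b (f i H)) fun i hi => (hf i hi).2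
    convert this using 1
    funext H
    simp⟩

lemma of_toTrunc_eq (hf : InJet K a b f) (hg : ∀ H, AnalyticAt ℂ (g H) 0)
    (h : ∀ H, toTrunc a b (g H) = toTrunc a b (f H)) : InJet K a b g :=
  ⟨hg, by simp only [h]; exact hf.2⟩

lemma of_chi (hT : HasTriangularJacobians Q Q') {e : Maps Q Q' → ℂ → ℂ} (he : JetPoly K e) :
    InJet K a b fun H p => e H p.2.1 :=
  ⟨fun H => (he.analyticAt hT H).comp_chi,
    Subring.subset_closure ⟨e, 0, 0, he, he.analyticAt hT, by simp⟩⟩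

lemma const (c : ℂ) : InJet K a b fun (_ : Maps Q Q') _ => c :=
  ⟨fun _ => analyticAt_const,
    Subring.subset_closure ⟨fun _ _ => c, 0, 0, .const c, fun _ => analyticAt_const, by simp⟩⟩

lemma z : InJet K a b fun (_ : Maps Q Q') p => p.1 :=
  ⟨fun _ => an_z, Subring.subset_closure ⟨fun _ _ => 1, 1, 0, .const 1,
    fun _ => analyticAt_const, by simp [toTrunc_one, zT]⟩⟩

lemma tau : InJet K a b fun (_ : Maps Q Q') p => p.2.2 :=
  ⟨fun _ => an_tau, Subring.subset_closure ⟨fun _ _ => 1, 0, 1, .const 1,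
    fun _ => analyticAt_const, by simp [toTrunc_one, tT]⟩⟩

/-- Functions of `z` alone whose low-order Taylor coefficients are jet-polynomial. -/
lemma of_z (hT : HasTriangularJacobians Q Q') {e : Maps Q Q' → ℂ → ℂ}
    (hea : ∀ H, AnalyticAt ℂ (e H) 0)
    (he : ∀ i ≤ a, JetPoly K fun H (_ : ℂ) => tc i (e H)) :
    InJet K a b fun H p => e H p.1 := by
  have h : InJet (Q := Q) (Q' := Q') K a b
      fun H p => ∑ i ∈ Finset.range (a + 1), tc i (e H) * p.1 ^ i :=
    InJet.sum _ fun i hi => (of_chi hT (he i (by simpa [Nat.lt_succ_iff] using hi))).mul (z.pow i)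
  refine h.of_toTrunc_eq (fun H => (hea H).comp_z) fun H => ?_
  rw [← sub_eq_zero, ← toTrunc_sub (hea H).comp_z (h.1 H),
    toTrunc_eq_zero ((hea H).comp_z.fun_sub (h.1 H))]
  refine ⟨fun p => ds^[a + 1] (e H) p.1, fun _ => 0, ((hea H).iterate_ds _).comp_z,
    analyticAt_const, Eventually.of_forall fun p => ?_⟩
  rw [taylor_expand (e H) (a + 1) p.1]
  ring

/-- Normal form of the jet-polynomial families. -/
lemma exists_normal (hf : InJet K a b f) :
    ∃ e : ℕ → ℕ → Maps Q Q' → ℂ → ℂ, (∀ i j, JetPoly K (e i j)) ∧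
      (∀ i j H, AnalyticAt ℂ (e i j H) 0) ∧
      ∀ H, toTrunc a b (f H) = toTrunc a b fun p =>
        ∑ i ∈ Finset.range (a + 1), (∑ j ∈ Finset.range (b + 1),
          e i j H p.2.1 * p.2.2 ^ j) * p.1 ^ i := by
  have key : ∀ φ ∈ jetRing Q Q' K a b, ∃ e : ℕ → ℕ → Maps Q Q' → ℂ → ℂ,
      (∀ i j, JetPoly K (e i j)) ∧ (∀ i j H, AnalyticAt ℂ (e i j H) 0) ∧
      ∀ H, φ H = ∑ i ∈ Finset.range (a + 1), (∑ j ∈ Finset.range (b + 1),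
          toTrunc a b (fun p => e i j H p.2.1) * tT a b ^ j) * zT a b ^ i := by
    intro φ hφ
    rw [jetRing, Subring.mem_closure_iff, Submonoid.closure_eq] at hφ
    induction hφ using AddSubgroup.closure_induction with
    | mem φ h =>
      obtain ⟨e, i, j, he, hea, rfl⟩ := h
      by_cases hij : i ≤ a ∧ j ≤ b
      · refine ⟨fun i' j' => if i' = i ∧ j' = j then e else fun _ _ => 0, fun i' j' => ?_,
          fun i' j' H => ?_, fun H => ?_⟩
        · dsimp only; split_ifs
          exacts [he, .const 0]
        · dsimp only; split_ifs
          exacts [hea H, analyticAt_const]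
        · rw [Finset.sum_eq_single i, Finset.sum_eq_single j]
          · simp only [and_self, if_true]; ring
          · intro j' _ hj
            simp [hj, toTrunc_zero]
          · intro hj; simp at hj; omega
          · intro i' _ hi
            simp [hi, toTrunc_zero]
          · intro hi; simp at hi; omega
      · refine ⟨fun _ _ _ _ => 0, fun _ _ => .const 0, fun _ _ _ => analyticAt_const, fun H => ?_⟩
        simp only [toTrunc_zero, zero_mul, Finset.sum_const_zero]
        rw [not_and_or, not_le, not_le] at hij
        rcases hij with hi | hj
        · rw [show zT a b ^ i = 0 from pow_eq_zero_of_le hi zT_pow]; ring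
        · rw [show tT a b ^ j = 0 from pow_eq_zero_of_le hj tT_pow]; ring
    | zero =>
      exact ⟨fun _ _ _ _ => 0, fun _ _ => .const 0, fun _ _ _ => analyticAt_const, fun H => by
        simp [toTrunc_zero]⟩
    | add φ ψ _ _ ih ih' =>
      obtain ⟨e, he, hea, h⟩ := ih
      obtain ⟨e', he', hea', h'⟩ := ih'
      refine ⟨fun i j H z => e i j H z + e' i j H z, fun i j => (he i j).add (he' i j),
        fun i j H => (hea i j H).add (hea' i j H), fun H => ?_⟩
      simp only [Pi.add_apply, h, h', ← Finset.sum_add_distrib, ← add_mul]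
      refine Finset.sum_congr rfl fun i _ => ?_
      congr 1
      refine Finset.sum_congr rfl fun j _ => ?_
      rw [toTrunc_add (hea i j H).comp_chi (hea' i j H).comp_chi]
    | neg φ _ ih =>
      obtain ⟨e, he, hea, h⟩ := ih
      refine ⟨fun i j H z => -e i j H z, fun i j => (he i j).neg,
        fun i j H => (hea i j H).neg, fun H => ?_⟩
      simp only [Pi.neg_apply, h, ← Finset.sum_neg_distrib, ← neg_mul]
      refine Finset.sum_congr rfl fun i _ => ?_
      congr 1
      refine Finset.sum_congr rfl fun j _ => ?_
      rw [toTrunc_neg (hea i j H).comp_chi]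
  obtain ⟨e, he, hea, h⟩ := key _ hf.2
  refine ⟨e, he, hea, fun H => ?_⟩
  rw [h H]
  have h1 : ∀ i j, AnalyticAt ℂ (fun p : ℂ × ℂ × ℂ => e i j H p.2.1 * p.2.2 ^ j) 0 := fun i j =>
    (hea i j H).comp_chi.mul (an_tau.pow j)
  have h2 : ∀ i, AnalyticAt ℂ (fun p : ℂ × ℂ × ℂ => ∑ j ∈ Finset.range (b + 1),
      e i j H p.2.1 * p.2.2 ^ j) 0 := fun i => Finset.analyticAt_fun_sum _ fun j _ => h1 i j
  have h3 : ∀ i, AnalyticAt ℂ (fun p : ℂ × ℂ × ℂ => p.1 ^ i) 0 := fun i => an_z.pow i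
  have h4 : ∀ i, AnalyticAt ℂ (fun p : ℂ × ℂ × ℂ => p.2.2 ^ i) 0 := fun i => an_tau.pow i
  rw [toTrunc_sum _ fun i _ => (h2 i).fun_mul (h3 i)]
  refine Finset.sum_congr rfl fun i _ => ?_
  rw [toTrunc_mul (h2 i) (h3 i), toTrunc_sum _ fun j _ => h1 i j, toTrunc_pow an_z]
  congr 1
  refine Finset.sum_congr rfl fun j _ => ?_
  rw [toTrunc_mul (hea i j H).comp_chi (h4 j), toTrunc_pow an_tau]
  rfl

end InJet

/-- Finite Taylor expansion in the first variable. -/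
lemma exists_expand_fst {E : Type*} [NormedAddCommGroup E] [NormedSpace ℂ E] (N : ℕ)
    {f : ℂ × E → ℂ} (hf : AnalyticAt ℂ f 0) :
    ∃ (Φ : ℕ → E → ℂ) (g : ℂ × E → ℂ), (∀ n, AnalyticAt ℂ (Φ n) 0) ∧ AnalyticAt ℂ g 0 ∧
      ∀ᶠ p in 𝓝 (0 : ℂ × E), f p = ∑ n ∈ Finset.range N, p.1 ^ n * Φ n p.2 + p.1 ^ N * g p := by
  induction N with
  | zero =>
    exact ⟨fun _ _ => 0, f, fun _ => analyticAt_const, hf, Eventually.of_forall fun p => by simp⟩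
  | succ N ih =>
    obtain ⟨Φ, g, hΦ, hg, h⟩ := ih
    obtain ⟨g', hg', h'⟩ := exists_div_fst (y0 := (0 : E)) hg
    have h0 : AnalyticAt ℂ (fun y : E => g (0, y)) 0 := hg.comp_clm (ContinuousLinearMap.inr ℂ ℂ E)
    refine ⟨fun n => if n = N then fun y => g (0, y) else Φ n, g', fun n => ?_, hg', ?_⟩
    · dsimp only
      split_ifs
      exacts [h0, hΦ n]
    · filter_upwards [h, h'] with p hp hp'
      rw [hp, hp', Finset.sum_range_succ]
      have : ∀ n ∈ Finset.range N, p.1 ^ n * (if n = N then fun y => g (0, y) else Φ n) p.2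
          = p.1 ^ n * Φ n p.2 := fun n hn => by
        rw [if_neg (Finset.mem_range.1 hn).ne]
      rw [Finset.sum_congr rfl this, if_pos rfl, smul_eq_mul]
      ring

/-- Families vanishing at `0` that may be substituted into any analytic function. -/
structure Substitutable {E : Type} [NormedAddCommGroup E] [NormedSpace ℂ E] (K a b : ℕ)
    (ξ : Maps Q Q' → ℂ × ℂ × ℂ → E) : Prop where
  analytic : ∀ H, AnalyticAt ℂ (ξ H) 0
  zero : ∀ H, ξ H 0 = 0
  comp : ∀ Φ : E → ℂ, AnalyticAt ℂ Φ 0 → InJet K a b fun H p => Φ (ξ H p)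

/-- Membership in the ideal generated by `z` and `τ`. -/
def InMax (f : ℂ × ℂ × ℂ → ℂ) : Prop :=
  ∃ u v : ℂ × ℂ × ℂ → ℂ, AnalyticAt ℂ u 0 ∧ AnalyticAt ℂ v 0 ∧
    ∀ᶠ p in 𝓝 0, f p = p.1 * u p + p.2.2 * v p

lemma InMax.pow_eq_zero {f : ℂ × ℂ × ℂ → ℂ} (hf : InMax f) (a b : ℕ) :
    toTrunc a b f ^ (a + b + 1) = 0 := by
  obtain ⟨u, v, hu, hv, h⟩ := hf
  rw [toTrunc_congr h, toTrunc_add (an_z.fun_mul hu) (an_tau.fun_mul hv), toTrunc_mul an_z hu,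
    toTrunc_mul an_tau hv]
  refine Commute.add_pow_eq_zero_of_add_le_succ_of_pow_eq_zero (m := a + 1) (n := b + 1)
    (Commute.all _ _) ?_ ?_ (by omega)
  · rw [mul_pow, show toTrunc a b (fun p => p.1) ^ (a + 1) = 0 from zT_pow, zero_mul]
  · rw [mul_pow, show toTrunc a b (fun p => p.2.2) ^ (b + 1) = 0 from tT_pow, zero_mul]

namespace Substitutable

variable {E : Type} [NormedAddCommGroup E] [NormedSpace ℂ E] {K a b : ℕ}

lemma of_chi (hT : HasTriangularJacobians Q Q') {y : Maps Q Q' → ℂ → ℂ} (hy : IsBase y)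
    (h0 : ∀ H, y H 0 = 0) : Substitutable K a b fun H p => y H p.2.1 :=
  ⟨fun H => (hy.analyticAt hT H).comp_chi, h0, fun _ hΦ => .of_chi hT (.base (hy.comp hΦ h0))⟩

lemma cons {ξ : Maps Q Q' → ℂ × ℂ × ℂ → E} (hξ : Substitutable K a b ξ)
    {x : Maps Q Q' → ℂ × ℂ × ℂ → ℂ} (hx : InJet K a b x) (hm : ∀ H, InMax (x H)) :
    Substitutable K a b fun H p => (x H p, ξ H p) := by
  have hx0 : ∀ H, x H 0 = 0 := fun H => by
    obtain ⟨u, v, -, -, h⟩ := hm H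
    simpa using h.self_of_nhds
  refine ⟨fun H => (hx.1 H).prod (hξ.analytic H), fun H => by rw [hx0, hξ.zero]; rfl,
    fun Φ hΦ => ?_⟩
  obtain ⟨c, g, hc, hg, h⟩ := exists_expand_fst (a + b + 1) hΦ
  have ha : ∀ H, AnalyticAt ℂ (fun p => (x H p, ξ H p)) 0 :=
    fun H => (hx.1 H).prod (hξ.analytic H)
  have h0 : ∀ H, (x H 0, ξ H 0) = 0 := fun H => by rw [hx0, hξ.zero]; rfl
  have hcomp : ∀ {g : ℂ × E → ℂ}, AnalyticAt ℂ g 0 → ∀ H,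
      AnalyticAt ℂ (fun p => g (x H p, ξ H p)) 0 := fun {g} hg H =>
    AnalyticAt.fun_comp (g := g) (by rw [h0]; exact hg) (ha H)
  have h1 : InJet K a b fun H p => ∑ n ∈ Finset.range (a + b + 1), x H p ^ n * c n (ξ H p) :=
    InJet.sum _ fun n _ => (hx.pow n).mul (hξ.comp _ (hc n))
  refine h1.of_toTrunc_eq (hcomp hΦ) fun H => ?_
  have hT : Tendsto (fun p => (x H p, ξ H p)) (𝓝 0) (𝓝 0) := by
    have := (ha H).continuousAt
    rwa [ContinuousAt, h0] at this
  have h2 := hT.eventually h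
  have h3 : AnalyticAt ℂ (fun p => x H p ^ (a + b + 1)) 0 := (hx.1 H).pow _
  rw [toTrunc_congr h2, toTrunc_add (h1.1 H) (h3.fun_mul (hcomp hg H)),
    toTrunc_mul h3 (hcomp hg H), toTrunc_pow (hx.1 H), (hm H).pow_eq_zero, zero_mul, add_zero]

end Substitutable

lemma inMax_z : InMax fun p => p.1 :=
  ⟨fun _ => 1, fun _ => 0, analyticAt_const, analyticAt_const, Eventually.of_forall fun p => by simp⟩

lemma inMax_tau : InMax fun p => p.2.2 :=
  ⟨fun _ => 0, fun _ => 1, analyticAt_const, analyticAt_const, Eventually.of_forall fun p => by simp⟩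

lemma InMax.add {f g : ℂ × ℂ × ℂ → ℂ} (hf : InMax f) (hg : InMax g) :
    InMax fun p => f p + g p := by
  obtain ⟨u, v, hu, hv, h⟩ := hf
  obtain ⟨u', v', hu', hv', h'⟩ := hg
  refine ⟨_, _, hu.add hu', hv.add hv', ?_⟩
  filter_upwards [h, h'] with p h h'
  rw [h, h', Pi.add_apply, Pi.add_apply]; ring

lemma InMax.sum {ι : Type*} (s : Finset ι) {f : ι → ℂ × ℂ × ℂ → ℂ} (hf : ∀ i ∈ s, InMax (f i)) :
    InMax fun p => ∑ i ∈ s, f i p := by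
  classical
  induction s using Finset.induction_on with
  | empty =>
    exact ⟨fun _ => 0, fun _ => 0, analyticAt_const, analyticAt_const,
      Eventually.of_forall fun p => by simp⟩
  | insert i s hi ih =>
    simp only [Finset.sum_insert hi]
    exact (hf i (Finset.mem_insert_self _ _)).add
      (ih fun j hj => hf j (Finset.mem_insert_of_mem hj))

/-- `(z, τ, χ) ↦ (z, χ, τ)`. -/
def swapL : ℂ × ℂ × ℂ →L[ℂ] ℂ × ℂ × ℂ :=
  (ContinuousLinearMap.fst ℂ ℂ (ℂ × ℂ)).prod
    (((ContinuousLinearMap.snd ℂ ℂ ℂ).comp (ContinuousLinearMap.snd ℂ ℂ (ℂ × ℂ))).prod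
      ((ContinuousLinearMap.fst ℂ ℂ ℂ).comp (ContinuousLinearMap.snd ℂ ℂ (ℂ × ℂ))))

lemma InJet.of_analytic {K a b : ℕ} (hT : HasTriangularJacobians Q Q') {f : ℂ × ℂ × ℂ → ℂ}
    (hf : AnalyticAt ℂ f 0) : InJet K a b fun (_ : Maps Q Q') p => f p := by
  have h1 : Substitutable (Q := Q) (Q' := Q') K a b fun _ p => p.2.1 :=
    .of_chi hT (y := fun _ χ => χ) (.of_analytic analyticAt_id) fun _ => rfl
  have h2 := (h1.cons InJet.tau fun _ => inMax_tau).cons InJet.z fun _ => inMax_z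
  exact h2.comp (fun q => f (swapL q)) (hf.comp_clm swapL)

/-- The coefficients of `z^i τ^j` with `1 ≤ i ≤ a`, `j ≤ b`, are determined up to constants by the
class modulo `z^{a+1}`, `τ^{b+1}` and functions of `(χ, τ)` or of `(z, τ)` only. -/
lemma coeff_eventually_const {a b : ℕ} {ψ : ℕ → ℕ → ℂ → ℂ}
    {u v : ℂ × ℂ × ℂ → ℂ} {c d : ℂ × ℂ → ℂ} (hu : AnalyticAt ℂ u 0) (hv : AnalyticAt ℂ v 0)
    (hc : AnalyticAt ℂ c 0)
    (h : ∀ᶠ p : ℂ × ℂ × ℂ in 𝓝 0, ∑ i ∈ Finset.range (a + 1), (∑ j ∈ Finset.range (b + 1),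
      ψ i j p.2.1 * p.2.2 ^ j) * p.1 ^ i =
      p.1 ^ (a + 1) * u p + p.2.2 ^ (b + 1) * v p + c p.2 + d (p.1, p.2.2))
    {i j : ℕ} (hi0 : 1 ≤ i) (hi : i ≤ a) (hj : j ≤ b) : ψ i j =ᶠ[𝓝 0] fun _ => ψ i j 0 := by
  let P0 : ℂ × ℂ × ℂ →L[ℂ] ℂ × ℂ × ℂ := (ContinuousLinearMap.fst ℂ ℂ (ℂ × ℂ)).prod
    ((0 : ℂ × ℂ × ℂ →L[ℂ] ℂ).prod
      ((ContinuousLinearMap.snd ℂ ℂ ℂ).comp (ContinuousLinearMap.snd ℂ ℂ (ℂ × ℂ))))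
  let q0 : ℂ × ℂ →L[ℂ] ℂ × ℂ := (0 : ℂ × ℂ →L[ℂ] ℂ).prod (ContinuousLinearMap.snd ℂ ℂ ℂ)
  have hP0 : ∀ p, P0 p = (p.1, 0, p.2.2) := fun p => rfl
  have hu' := hu.sub (hu.comp_clm P0)
  have hv' := hv.sub (hv.comp_clm P0)
  have hc' := hc.sub (hc.comp_clm q0)
  obtain ⟨V, w, hV, hw, hvw⟩ := exists_expand_fst (a + 1) hv'
  set B : ℕ → ℂ × ℂ → ℂ := fun i q => ∑ j ∈ Finset.range (b + 1), (ψ i j q.1 - ψ i j 0) * q.2 ^ j -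
    q.2 ^ (b + 1) * V i q - if i = 0 then c q - c (q0 q) else 0 with hB
  have e1 : ∀ᶠ p : ℂ × ℂ × ℂ in 𝓝 0, ∑ i ∈ Finset.range (a + 1), B i p.2 * p.1 ^ i +
      p.1 ^ (a + 1) * (-(p.2.2 ^ (b + 1) * w p + (u p - u (P0 p)))) = 0 := by
    filter_upwards [h, eventually_comp_clm P0 h, hvw] with p h1 h2 h3
    have h4 : ∑ i ∈ Finset.range (a + 1), B i p.2 * p.1 ^ i =
        ∑ i ∈ Finset.range (a + 1), (∑ j ∈ Finset.range (b + 1), ψ i j p.2.1 * p.2.2 ^ j) * p.1 ^ i -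
        ∑ i ∈ Finset.range (a + 1), (∑ j ∈ Finset.range (b + 1), ψ i j 0 * p.2.2 ^ j) * p.1 ^ i -
        p.2.2 ^ (b + 1) * ∑ i ∈ Finset.range (a + 1), p.1 ^ i * V i p.2 - (c p.2 - c (q0 p.2)) := by
      have h5 : c p.2 - c (q0 p.2) = ∑ i ∈ Finset.range (a + 1),
          (if i = 0 then c p.2 - c (q0 p.2) else 0) * p.1 ^ i := by
        rw [Finset.sum_eq_single 0] <;> simp +contextual
      conv_rhs => rw [h5]
      rw [Finset.mul_sum, ← Finset.sum_sub_distrib, ← Finset.sum_sub_distrib,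
        ← Finset.sum_sub_distrib]
      refine Finset.sum_congr rfl fun i _ => ?_
      simp only [hB, sub_mul, Finset.sum_sub_distrib]
      ring
    have h3' : v p - v (P0 p) = _ := h3
    rw [hP0] at h2 h3' ⊢
    change _ = _ + c (0, p.2.2) + d (p.1, p.2.2) at h2
    have h6 : c (q0 p.2) = c (0, p.2.2) := rfl
    simp only at h2
    rw [h4, h1, h2, h6]
    linear_combination p.2.2 ^ (b + 1) * h3'
  have hw2 : AnalyticAt ℂ (fun p : ℂ × ℂ × ℂ =>
      -(p.2.2 ^ (b + 1) * w p + (u p - u (P0 p)))) 0 := (((an_tau.pow _).mul hw).add hu').neg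
  have hswap : Tendsto (fun r : (ℂ × ℂ) × ℂ => (r.2, r.1)) (𝓝 0 ×ˢ 𝓝 0) (𝓝 0) := by
    rw [← nhds_prod_eq]
    exact continuous_swap.tendsto' _ _ rfl
  have e2 := (hswap.eventually e1).curry
  have hcont : ∀ᶠ q in 𝓝 (0 : ℂ × ℂ), ContinuousAt (fun z : ℂ =>
      -(q.2 ^ (b + 1) * w (z, q) + (u (z, q) - u (P0 (z, q))))) 0 := by
    have h1 := (eventually_comp_clm (ContinuousLinearMap.inr ℂ ℂ (ℂ × ℂ)) hw2.eventually_analyticAt)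
    filter_upwards [h1] with q hq
    exact ContinuousAt.comp (f := fun z : ℂ => (z, q)) (x := (0 : ℂ)) hq.continuousAt
      (by fun_prop)
  have e3 : ∀ᶠ q in 𝓝 (0 : ℂ × ℂ), B i q = 0 := by
    filter_upwards [e2, hcont] with q h1 h2
    exact coeff_eq_zero_of_eventually (a := fun i => B i q) h2 h1 i (by omega)
  have hVi : ∀ᶠ q in 𝓝 (0 : ℂ × ℂ), AnalyticAt ℂ (V i) q := (hV i).eventually_analyticAt
  rw [show (0 : ℂ × ℂ) = (0, 0) from rfl, nhds_prod_eq] at e3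
  have hVi' : ∀ᶠ χ in 𝓝 (0 : ℂ), AnalyticAt ℂ (V i) (χ, 0) :=
    eventually_comp_clm (ContinuousLinearMap.inl ℂ ℂ ℂ) hVi
  filter_upwards [e3.curry, hVi'] with χ h1 h2
  have h3 : ContinuousAt (fun τ => -V i (χ, τ)) 0 :=
    (ContinuousAt.comp (f := fun τ : ℂ => (χ, τ)) (x := (0 : ℂ)) h2.continuousAt
      (by fun_prop)).neg
  have := coeff_eq_zero_of_eventually (a := fun j => ψ i j χ - ψ i j 0) (n := b + 1) h3 (by
    filter_upwards [h1] with τ h1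
    simp only [hB, if_neg (show i ≠ 0 by omega)] at h1
    linear_combination h1) j (by omega)
  exact sub_eq_zero.1 this

/-- Extraction of jet-polynomial coefficients. -/
lemma InJet.coeff {K a b : ℕ} {f : Maps Q Q' → ℂ × ℂ × ℂ → ℂ} (hf : InJet K a b f)
    {φ : ℕ → ℕ → Maps Q Q' → ℂ → ℂ} (hφ : ∀ i j H, AnalyticAt ℂ (φ i j H) 0)
    {c d : Maps Q Q' → ℂ × ℂ → ℂ} (hc : ∀ H, AnalyticAt ℂ (c H) 0)
    (hd : ∀ H, AnalyticAt ℂ (d H) 0)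
    (h : ∀ H, toTrunc a b (f H) = toTrunc a b fun p =>
      ∑ i ∈ Finset.range (a + 1), (∑ j ∈ Finset.range (b + 1),
          φ i j H p.2.1 * p.2.2 ^ j) * p.1 ^ i + c H p.2 + d H (p.1, p.2.2))
    {i j : ℕ} (hi0 : 1 ≤ i) (hi : i ≤ a) (hj : j ≤ b) :
    JetPoly K fun H χ => φ i j H χ - φ i j H 0 := by
  obtain ⟨e, he, hea, hn⟩ := hf.exists_normal
  refine ((he i j).sub (he i j).eval).congr fun H => ?_
  have hs : ∀ {φ : ℕ → ℕ → Maps Q Q' → ℂ → ℂ}, (∀ i j H, AnalyticAt ℂ (φ i j H) 0) →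
      AnalyticAt ℂ (fun p : ℂ × ℂ × ℂ => ∑ i ∈ Finset.range (a + 1), (∑ j ∈ Finset.range (b + 1),
          φ i j H p.2.1 * p.2.2 ^ j) * p.1 ^ i) 0 := fun {φ} hφ =>
    Finset.analyticAt_fun_sum _ fun i _ => (Finset.analyticAt_fun_sum _ fun j _ =>
      (hφ i j H).comp_chi.mul (an_tau.pow j)).mul (an_z.pow i)
  have h1 := (hn H).symm.trans (h H)
  let P : ℂ × ℂ × ℂ →L[ℂ] ℂ × ℂ := (ContinuousLinearMap.fst ℂ ℂ (ℂ × ℂ)).prod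
      ((ContinuousLinearMap.snd ℂ ℂ ℂ).comp (ContinuousLinearMap.snd ℂ ℂ (ℂ × ℂ)))
  have hc' : AnalyticAt ℂ (fun p : ℂ × ℂ × ℂ => c H p.2) 0 :=
    (hc H).comp_clm (ContinuousLinearMap.snd ℂ ℂ (ℂ × ℂ))
  have hd' : AnalyticAt ℂ (fun p : ℂ × ℂ × ℂ => d H (p.1, p.2.2)) 0 := (hd H).comp_clm P
  have h2 := ((hs hφ).fun_add hc').fun_add hd'
  rw [← sub_eq_zero, ← toTrunc_sub (hs hea) h2, toTrunc_eq_zero ((hs hea).fun_sub h2)] at h1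
  obtain ⟨u, v, hu, hv, h3⟩ := h1
  have := coeff_eventually_const (ψ := fun i j z => e i j H z - φ i j H z)
    hu hv (hc H) (d := d H) (by
      filter_upwards [h3] with p hp
      simp only [sub_mul, Finset.sum_sub_distrib]
      linear_combination hp) hi0 hi hj
  filter_upwards [this] with χ hχ
  linear_combination hχ

/-- The coefficient of `w^j` in `F(z, w)`. -/
def cf (F : ℂ → ℂ → ℂ) (j : ℕ) (z : ℂ) : ℂ := tc j (F z)

/-- The remainder of order `n` of the expansion of `F(z, w)` in `w`. -/
def rem (F : ℂ → ℂ → ℂ) (n : ℕ) (p : ℂ × ℂ) : ℂ := ds^[n] (F p.1) p.2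

section Germ

variable {F : ℂ → ℂ → ℂ}

lemma expand_snd (F : ℂ → ℂ → ℂ) (n : ℕ) (z w : ℂ) :
    F z w = ∑ j ∈ Finset.range n, cf F j z * w ^ j + w ^ n * rem F n (z, w) :=
  taylor_expand (F z) n w

/-- `(z, w) ↦ (w, z)`. -/
def swapPair : ℂ × ℂ →L[ℂ] ℂ × ℂ :=
  (ContinuousLinearMap.snd ℂ ℂ ℂ).prod (ContinuousLinearMap.fst ℂ ℂ ℂ)

lemma analyticAt_rem (hF : AnalyticAt ℂ (fun p : ℂ × ℂ => F p.1 p.2) 0) (n : ℕ) :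
    AnalyticAt ℂ (rem F n) 0 := by
  induction n generalizing F with
  | zero => exact hF
  | succ n ih =>
    refine ih (F := fun z => ds (F z)) ?_
    have h1 : AnalyticAt ℂ (fun p : ℂ × ℂ => F p.2 p.1) 0 := hF.comp_clm swapPair
    exact (AnalyticAt.dslope_fst (f := fun w z => F z w) (y0 := 0) h1).comp_clm swapPair

lemma analyticAt_cf (hF : AnalyticAt ℂ (fun p : ℂ × ℂ => F p.1 p.2) 0) (n : ℕ) :
    AnalyticAt ℂ (cf F n) 0 :=
  (analyticAt_rem hF n).comp_clm (ContinuousLinearMap.inl ℂ ℂ ℂ)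

lemma tc_const_mul {f : ℂ → ℂ} (hf : AnalyticAt ℂ f 0) (a : ℂ) (n : ℕ) :
    tc n (fun z => a * f z) = a * tc n f := by
  induction n generalizing f with
  | zero => rfl
  | succ n ih =>
    rw [tc_succ, tc_succ, tc_congr (ds_const_mul hf a), ih hf.ds]

lemma deriv_iterate_eq_cf (hF : AnalyticAt ℂ (fun p : ℂ × ℂ => F p.1 p.2) 0) (j : ℕ) :
    ∀ᶠ z in 𝓝 0, deriv^[j] (F z) 0 = (j.factorial : ℂ) * cf F j z := by
  filter_upwards [eventually_comp_clm (ContinuousLinearMap.inl ℂ ℂ ℂ) hF.eventually_analyticAt]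
    with z hz
  refine deriv_iterate_eq_tc ?_ j
  exact AnalyticAt.fun_comp (g := fun p : ℂ × ℂ => F p.1 p.2) (f := fun w : ℂ => (z, w)) (x := 0)
    hz (by fun_prop)

lemma deriv_iterate_congr {f g : ℂ → ℂ} (h : f =ᶠ[𝓝 0] g) (n : ℕ) :
    deriv^[n] f =ᶠ[𝓝 0] deriv^[n] g := by
  induction n generalizing f g with
  | zero => exact h
  | succ n ih => exact ih h.deriv

lemma pd_eq_tc (hF : AnalyticAt ℂ (fun p : ℂ × ℂ => F p.1 p.2) 0) (i j : ℕ) :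
    pd F i j 0 0 = (i.factorial : ℂ) * ((j.factorial : ℂ) * tc i (cf F j)) := by
  have h := (deriv_iterate_congr (deriv_iterate_eq_cf hF j) i).self_of_nhds
  rw [pd, h, deriv_iterate_eq_tc (analyticAt_const.fun_mul (analyticAt_cf hF j)),
    tc_const_mul (analyticAt_cf hF j)]

/-- The conjugate germ `F̄(χ, τ)`. -/
def conjGerm (F : ℂ → ℂ → ℂ) (χ τ : ℂ) : ℂ := cj (F (cj χ) (cj τ))

lemma analyticAt_conjGerm (hF : AnalyticAt ℂ (fun p : ℂ × ℂ => F p.1 p.2) 0) :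
    AnalyticAt ℂ (fun p : ℂ × ℂ => conjGerm F p.1 p.2) 0 := by
  refine AnalyticAt.conj_comp (isConjMap_prod isConjMap_cj isConjMap_cj) (x := (0 : ℂ × ℂ))
    (f := fun p : ℂ × ℂ => F p.1 p.2) ?_
  convert hF using 1
  · rfl
  · exact Prod.ext cj_zero cj_zero

lemma tendsto_cj : Tendsto cj (𝓝 0) (𝓝 0) := continuous_cj.tendsto' _ _ cj_zero

lemma tc_conj {f : ℂ → ℂ} (hf : AnalyticAt ℂ f 0) (n : ℕ) :
    tc n (fun z => cj (f (cj z))) = cj (tc n f) := by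
  induction n generalizing f with
  | zero => simp [tc_zero, cj_zero]
  | succ n ih =>
    have h : ds (fun z => cj (f (cj z))) =ᶠ[𝓝 0] fun z => cj (ds f (cj z)) := by
      have hc : ContinuousAt (fun z => cj (ds f (cj z))) 0 := by
        refine continuous_cj.continuousAt.comp (f := fun z => ds f (cj z)) ?_
        refine ContinuousAt.comp (f := cj) (x := (0 : ℂ)) ?_ continuous_cj.continuousAt
        rw [cj_zero]; exact hf.ds.continuousAt
      refine dslope_eq_of_expand (h := fun z => cj (f (cj z))) (a := cj (f 0)) hc ?_
      refine Eventually.of_forall fun z => ?_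
      rw [ds_expand f (cj z), cj_add, cj_mul, cj_cj, smul_eq_mul]
    rw [tc_succ, tc_succ, tc_congr h, ih hf.ds]

lemma eventually_analyticAt_fst (hF : AnalyticAt ℂ (fun p : ℂ × ℂ => F p.1 p.2) 0) :
    ∀ᶠ z in 𝓝 0, AnalyticAt ℂ (F z) 0 := by
  filter_upwards [eventually_comp_clm (ContinuousLinearMap.inl ℂ ℂ ℂ) hF.eventually_analyticAt]
    with z hz
  exact AnalyticAt.fun_comp (g := fun p : ℂ × ℂ => F p.1 p.2) (f := fun w : ℂ => (z, w)) (x := 0)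
    hz (by fun_prop)

lemma cf_conjGerm (hF : AnalyticAt ℂ (fun p : ℂ × ℂ => F p.1 p.2) 0) (n : ℕ) :
    cf (conjGerm F) n =ᶠ[𝓝 0] fun χ => cj (cf F n (cj χ)) := by
  filter_upwards [tendsto_cj.eventually (eventually_analyticAt_fst hF)] with χ hχ
  exact tc_conj hχ n

end Germ

namespace Maps

lemma analytic_F (H : Maps Q Q') : AnalyticAt ℂ (fun p : ℂ × ℂ => H.F p.1 p.2) 0 := H.2.1.1
lemma analytic_G (H : Maps Q Q') : AnalyticAt ℂ (fun p : ℂ × ℂ => H.G p.1 p.2) 0 := H.2.1.2.1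
lemma F_zero (H : Maps Q Q') : H.F 0 0 = 0 := H.2.1.2.2.1
lemma G_zero (H : Maps Q Q') : H.G 0 0 = 0 := H.2.1.2.2.2.1

/-- The conjugate of the first component. -/
def Fb (H : Maps Q Q') : ℂ → ℂ → ℂ := conjGerm H.F

/-- The conjugate of the second component. -/
def Gb (H : Maps Q Q') : ℂ → ℂ → ℂ := conjGerm H.G

lemma analytic_Fb (H : Maps Q Q') : AnalyticAt ℂ (fun p : ℂ × ℂ => H.Fb p.1 p.2) 0 :=
  analyticAt_conjGerm H.analytic_F
lemma analytic_Gb (H : Maps Q Q') : AnalyticAt ℂ (fun p : ℂ × ℂ => H.Gb p.1 p.2) 0 :=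
  analyticAt_conjGerm H.analytic_G
lemma Fb_zero (H : Maps Q Q') : H.Fb 0 0 = 0 := by simp [Fb, conjGerm, cj_zero, F_zero]
lemma Gb_zero (H : Maps Q Q') : H.Gb 0 0 = 0 := by simp [Gb, conjGerm, cj_zero, G_zero]

lemma identity (H : Maps Q Q') : ∀ᶠ p : ℂ × ℂ × ℂ in 𝓝 0,
    H.G p.1 (Q p.1 p.2.1 p.2.2) =
      Q' (H.F p.1 (Q p.1 p.2.1 p.2.2)) (H.Fb p.2.1 p.2.2) (H.Gb p.2.1 p.2.2) :=
  H.2.1.2.2.2.2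

lemma identity_chi_zero (hQ : IsNormalCoord Q) (H : Maps Q Q') : ∀ᶠ q : ℂ × ℂ in 𝓝 0,
    H.G q.1 q.2 = Q' (H.F q.1 q.2) (H.Fb 0 q.2) (H.Gb 0 q.2) := by
  filter_upwards [eventually_comp_clm inclSnd H.identity, hQ.2.1] with q h1 h2
  rw [inclSnd_apply] at h1
  simpa only [h2] using h1

lemma G_z_zero (hQ : IsNormalCoord Q) (hQ' : IsNormalCoord Q') (H : Maps Q Q') :
    ∀ᶠ z in 𝓝 (0 : ℂ), H.G z 0 = 0 := by
  have h1 := eventually_comp_clm (ContinuousLinearMap.inl ℂ ℂ ℂ) (H.identity_chi_zero hQ)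
  have h3 : AnalyticAt ℂ (fun z : ℂ => (H.F z 0, (0 : ℂ))) 0 :=
    (H.analytic_F.comp_clm (ContinuousLinearMap.inl ℂ ℂ ℂ)).prod analyticAt_const
  have h4 : Tendsto (fun z : ℂ => (H.F z 0, (0 : ℂ))) (𝓝 0) (𝓝 0) := by
    have := h3.continuousAt
    rwa [ContinuousAt, F_zero] at this
  filter_upwards [h1, h4.eventually hQ'.2.1] with z h1 h2
  simp only [ContinuousLinearMap.inl_apply, Fb_zero, Gb_zero] at h1
  rw [h1, h2]

lemma pd_G_one_zero (hQ : IsNormalCoord Q) (hQ' : IsNormalCoord Q') (H : Maps Q Q') :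
    pd H.G 1 0 0 0 = 0 := by
  have h : (fun z => H.G z 0) =ᶠ[𝓝 0] fun _ => 0 := H.G_z_zero hQ hQ'
  simp only [pd, Function.iterate_zero, id, Function.iterate_one]
  rw [h.deriv_eq, deriv_const]

lemma hasTriangularJacobians (hQ : IsNormalCoord Q) (hQ' : IsNormalCoord Q') :
    HasTriangularJacobians Q Q' := fun H => by
  have h0 := H.pd_G_one_zero hQ hQ'
  have h1 : JacDet H.F H.G ≠ 0 := H.2.2
  rw [JacDet, h0, mul_zero, sub_zero] at h1
  exact ⟨h0, left_ne_zero_of_mul h1, right_ne_zero_of_mul h1⟩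

end Maps

/-- Taylor coefficients of order at most `K` are jet-polynomial. -/
lemma JetPoly.tc_cf_F {K i j : ℕ} (h : i + j ≤ K) :
    JetPoly K fun (H : Maps Q Q') _ => _root_.tc i (cf H.F j) := by
  by_cases h0 : i + j = 0
  · obtain ⟨rfl, rfl⟩ : i = 0 ∧ j = 0 := by omega
    exact (JetPoly.const 0).congr fun H => Eventually.of_forall fun _ => H.F_zero.symm
  · have h1 : JetPoly K fun (H : Maps Q Q') _ => H.jet ((i, j), true) :=
      JetPoly.jet (mem_jetSet.2 (by simp; omega))
    refine ((JetPoly.const (((i.factorial : ℂ) * j.factorial)⁻¹)).mul h1).congr fun H =>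
      Eventually.of_forall fun _ => ?_
    simp only [Maps.jet, if_true]
    have := i.factorial_ne_zero
    have := j.factorial_ne_zero
    rw [pd_eq_tc H.analytic_F]
    field_simp

lemma JetPoly.tc_cf_G {K i j : ℕ} (h : i + j ≤ K) :
    JetPoly K fun (H : Maps Q Q') _ => _root_.tc i (cf H.G j) := by
  by_cases h0 : i + j = 0
  · obtain ⟨rfl, rfl⟩ : i = 0 ∧ j = 0 := by omega
    exact (JetPoly.const 0).congr fun H => Eventually.of_forall fun _ => H.G_zero.symm
  · have h1 : JetPoly K fun (H : Maps Q Q') _ => H.jet ((i, j), false) :=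
      JetPoly.jet (mem_jetSet.2 (by simp; omega))
    refine ((JetPoly.const (((i.factorial : ℂ) * j.factorial)⁻¹)).mul h1).congr fun H =>
      Eventually.of_forall fun _ => ?_
    simp only [Maps.jet, Bool.false_eq_true, if_false]
    have := i.factorial_ne_zero
    have := j.factorial_ne_zero
    rw [pd_eq_tc H.analytic_G]
    field_simp

lemma JetPoly.conj {K : ℕ} {a : Maps Q Q' → ℂ} (h : JetPoly K fun H (_ : ℂ) => a H) :
    JetPoly K fun H (_ : ℂ) => cj (a H) := h.bar

lemma JetPoly.cf_conjGerm {K n : ℕ} {F : Maps Q Q' → ℂ → ℂ → ℂ}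
    (hF : ∀ H, AnalyticAt ℂ (fun p : ℂ × ℂ => F H p.1 p.2) 0)
    (h : JetPoly K fun H => cf (F H) n) : JetPoly K fun H => cf (conjGerm (F H)) n :=
  h.bar.congr fun H => (_root_.cf_conjGerm (hF H) n).symm

section Ring

variable {A : Type*} [CommRing A]

lemma pow_add_mul_pow_eq {t x v : A} {b : ℕ} (ht : t ^ (b + 1) = 0) (n : ℕ) :
    t ^ b * (x + t * v) ^ n = t ^ b * x ^ n := by
  obtain ⟨c, hc⟩ := sub_dvd_pow_sub_pow (x + t * v) x n
  rw [← sub_eq_zero, ← mul_sub, hc]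
  linear_combination v * c * ht

/-- The `(n+1)`-st power of the ideal `(s, t)` modulo `s ^ 2`. -/
def InPow (s t : A) (n : ℕ) (x : A) : Prop := ∃ u v, x = t ^ (n + 1) * u + s * t ^ n * v

lemma InPow.mul {s t x y : A} {i j : ℕ} (hs : s * s = 0) (hx : InPow s t i x)
    (hy : InPow s t j y) : InPow s t (i + j + 1) (x * y) := by
  obtain ⟨u, v, rfl⟩ := hx
  obtain ⟨u', v', rfl⟩ := hy
  refine ⟨u * u', u * v' + v * u', ?_⟩
  linear_combination t ^ i * t ^ j * v * v' * hs

lemma InPow.mul_pow {s t x y : A} {i : ℕ} (hs : s * s = 0) (hx : InPow s t i x)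
    (hy : InPow s t 0 y) (n : ℕ) : InPow s t (i + n) (x * y ^ n) := by
  induction n with
  | zero => simpa using hx
  | succ n ih =>
    rw [pow_succ, ← mul_assoc]
    have h := InPow.mul hs ih hy
    rwa [add_zero, add_assoc] at h

lemma InPow.eq_zero {s t x : A} {k : ℕ} (ht : t ^ (k + 1) = 0) (hx : InPow s t (k + 1) x) :
    x = 0 := by
  obtain ⟨u, v, rfl⟩ := hx
  linear_combination (t * u + s * v) * ht

lemma InPow.mul_eq_zero {s t x z : A} {k : ℕ} (ht : t ^ (k + 1) = 0) (hz : z * s = 0)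
    (hx : InPow s t k x) : z * x = 0 := by
  obtain ⟨u, v, rfl⟩ := hx
  linear_combination (z * u) * ht + t ^ k * v * hz

end Ring

section Trunc

variable {a b : ℕ}

/-- The top coefficient only depends on the restriction to `z = τ = 0`. -/
lemma toTrunc_lead {φ : ℂ × ℂ × ℂ → ℂ} (hφ : AnalyticAt ℂ φ 0) :
    toTrunc a b (fun p => p.1 ^ a * p.2.2 ^ b * φ p) =
      toTrunc a b fun p => p.1 ^ a * p.2.2 ^ b * φ (0, p.2.1, 0) := by
  have hm : AnalyticAt ℂ (fun p : ℂ × ℂ × ℂ => p.1 ^ a * p.2.2 ^ b) 0 :=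
    (an_z.fun_pow a).fun_mul (an_tau.fun_pow b)
  have h0 : AnalyticAt ℂ (fun p : ℂ × ℂ × ℂ => φ (0, p.2.1, 0)) 0 :=
    hφ.comp_clm ((0 : ℂ × ℂ × ℂ →L[ℂ] ℂ).prod (((ContinuousLinearMap.fst ℂ ℂ ℂ).comp
      (ContinuousLinearMap.snd ℂ ℂ (ℂ × ℂ))).prod 0))
  obtain ⟨g, hg, h1⟩ := exists_div_fst (y0 := (0 : ℂ × ℂ)) hφ
  have h2 : AnalyticAt ℂ (fun q : ℂ × ℂ => φ (0, q.2, q.1)) 0 :=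
    hφ.comp_clm ((0 : ℂ × ℂ →L[ℂ] ℂ).prod ((ContinuousLinearMap.snd ℂ ℂ ℂ).prod
      (ContinuousLinearMap.fst ℂ ℂ ℂ)))
  obtain ⟨g', hg', h3⟩ := exists_div_fst (y0 := (0 : ℂ)) h2
  let L : ℂ × ℂ × ℂ →L[ℂ] ℂ × ℂ :=
    swapPair.comp (ContinuousLinearMap.snd ℂ ℂ (ℂ × ℂ))
  have h3' := eventually_comp_clm L h3
  rw [← sub_eq_zero, ← toTrunc_sub (hm.fun_mul hφ) (hm.fun_mul h0),
    toTrunc_eq_zero ((hm.fun_mul hφ).fun_sub (hm.fun_mul h0))]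
  refine ⟨_, _, (an_tau.pow b).mul hg, (an_z.pow a).mul (hg'.comp_clm L), ?_⟩
  filter_upwards [h1, h3'] with p h1 h3
  simp only [smul_eq_mul] at h1 h3
  change φ (0, p.2.1, p.2.2) = φ (0, p.2.1, 0) + p.2.2 * g' (L p) at h3
  change φ p = φ (0, p.2.1, p.2.2) + p.1 * g p at h1
  simp only [Pi.mul_apply, Pi.pow_apply]
  rw [h1, h3]
  ring

lemma toTrunc_lead_pow {A u v φ : ℂ × ℂ × ℂ → ℂ} (hu : AnalyticAt ℂ u 0) (hv : AnalyticAt ℂ v 0)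
    (hφ : AnalyticAt ℂ φ 0) (hA : ∀ᶠ p in 𝓝 0, A p = p.1 * u p + p.2.2 * v p) :
    toTrunc a b (fun p => p.2.2 ^ b * A p ^ a * φ p) =
      toTrunc a b fun p => p.1 ^ a * p.2.2 ^ b * (u (0, p.2.1, 0) ^ a * φ (0, p.2.1, 0)) := by
  rw [← toTrunc_lead (φ := fun p => u p ^ a * φ p) ((hu.fun_pow a).fun_mul hφ)]
  have h1 : (fun p => p.2.2 ^ b * A p ^ a * φ p) =ᶠ[𝓝 0]
      fun p => p.2.2 ^ b * (p.1 * u p + p.2.2 * v p) ^ a * φ p := by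
    filter_upwards [hA] with p hp
    rw [hp]
  have e1 := an_z.fun_mul hu
  have e2 := an_tau.fun_mul hv
  rw [toTrunc_congr h1,
    toTrunc_mul ((an_tau.fun_pow b).fun_mul ((e1.fun_add e2).fun_pow a)) hφ,
    toTrunc_mul (an_tau.fun_pow b) ((e1.fun_add e2).fun_pow a), toTrunc_pow (e1.fun_add e2),
    toTrunc_add e1 e2, toTrunc_pow an_tau, toTrunc_mul an_tau hv,
    toTrunc_mul ((an_z.fun_pow a).fun_mul (an_tau.fun_pow b)) ((hu.fun_pow a).fun_mul hφ),
    toTrunc_mul (an_z.fun_pow a) (an_tau.fun_pow b), toTrunc_mul (hu.fun_pow a) hφ,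
    toTrunc_pow hu, toTrunc_pow an_z, toTrunc_pow an_tau, toTrunc_mul an_z hu]
  have h : toTrunc a b (fun p => p.2.2) ^ (b + 1) = 0 := tT_pow
  rw [pow_add_mul_pow_eq h]
  ring

/-- Finite difference quotient in the first variable. -/
lemma exists_diff_fst {E : Type*} [NormedAddCommGroup E] [NormedSpace ℂ E] {Φ : ℂ × E → ℂ}
    (hΦ : AnalyticAt ℂ Φ 0) : ∃ Ψ : ℂ × ℂ × E → ℂ, AnalyticAt ℂ Ψ 0 ∧
      ∀ᶠ q in 𝓝 0, Φ (q.2.1 + q.1, q.2.2) = Φ q.2 + q.1 * Ψ q := by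
  let L : ℂ × ℂ × E →L[ℂ] ℂ × E :=
    ((ContinuousLinearMap.fst ℂ ℂ E).comp (ContinuousLinearMap.snd ℂ ℂ (ℂ × E)) +
      ContinuousLinearMap.fst ℂ ℂ (ℂ × E)).prod
      ((ContinuousLinearMap.snd ℂ ℂ E).comp (ContinuousLinearMap.snd ℂ ℂ (ℂ × E)))
  obtain ⟨Ψ, hΨ, h⟩ := exists_div_fst (y0 := (0 : ℂ × E)) (hΦ.comp_clm L)
  refine ⟨Ψ, hΨ, h.mono fun q hq => ?_⟩
  simpa [L] using hq

lemma AnalyticAt.comp_zero {E E' : Type*} [NormedAddCommGroup E] [NormedSpace ℂ E]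
    [NormedAddCommGroup E'] [NormedSpace ℂ E'] {Φ : E → ℂ} {ξ : E' → E} (hΦ : AnalyticAt ℂ Φ 0)
    (hξ : AnalyticAt ℂ ξ 0) (h0 : ξ 0 = 0) : AnalyticAt ℂ (fun p => Φ (ξ p)) 0 :=
  AnalyticAt.fun_comp (g := Φ) (by rwa [h0]) hξ

lemma AnalyticAt.eventually_comp {E E' : Type*} [NormedAddCommGroup E] [NormedSpace ℂ E]
    [NormedAddCommGroup E'] [NormedSpace ℂ E'] {P : E → Prop} {ξ : E' → E}
    (hξ : AnalyticAt ℂ ξ 0) (h0 : ξ 0 = 0) (hP : ∀ᶠ y in 𝓝 0, P y) : ∀ᶠ x in 𝓝 0, P (ξ x) := by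
  have h1 : Tendsto ξ (𝓝 0) (𝓝 0) := by
    have := hξ.continuousAt
    rwa [ContinuousAt, h0] at this
  exact h1.eventually hP

/-- Changing the argument of an analytic function by an element annihilated by the prefactor. -/
lemma toTrunc_subst {E : Type*} [NormedAddCommGroup E] [NormedSpace ℂ E] {Φ : ℂ × E → ℂ}
    (hΦ : AnalyticAt ℂ Φ 0) {x x' w : ℂ × ℂ × ℂ → ℂ} {y : ℂ × ℂ × ℂ → E}
    (hx : AnalyticAt ℂ x 0) (hx' : AnalyticAt ℂ x' 0) (hy : AnalyticAt ℂ y 0)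
    (hw : AnalyticAt ℂ w 0) (hx0 : x 0 = 0) (hx'0 : x' 0 = 0) (hy0 : y 0 = 0)
    (h : toTrunc a b w * (toTrunc a b x - toTrunc a b x') = 0) :
    toTrunc a b (fun p => w p * Φ (x p, y p)) = toTrunc a b fun p => w p * Φ (x' p, y p) := by
  obtain ⟨Ψ, hΨ, hd⟩ := exists_diff_fst hΦ
  have hξ : AnalyticAt ℂ (fun p => (x p - x' p, x' p, y p)) 0 :=
    (hx.fun_sub hx').prod (hx'.prod hy)
  have hξ0 : (fun p => (x p - x' p, x' p, y p)) 0 = 0 := by simp [hx0, hx'0, hy0]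
  have h1 := hξ.eventually_comp hξ0 hd
  have h2 : (fun p => w p * Φ (x p, y p)) =ᶠ[𝓝 0]
      fun p => w p * Φ (x' p, y p) + w p * (x p - x' p) * Ψ (x p - x' p, x' p, y p) := by
    filter_upwards [h1] with p hp
    simp only [add_sub_cancel] at hp
    rw [hp]; ring
  have h3 : AnalyticAt ℂ (fun p => Φ (x' p, y p)) 0 :=
    hΦ.comp_zero (hx'.prod hy) (by simp [hx'0, hy0])
  have h4 : AnalyticAt ℂ (fun p => Ψ (x p - x' p, x' p, y p)) 0 := hΨ.comp_zero hξ hξ0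
  have h5 := hw.fun_mul (hx.fun_sub hx')
  rw [toTrunc_congr h2, toTrunc_add (hw.fun_mul h3) (h5.fun_mul h4), toTrunc_mul h5 h4,
    toTrunc_mul hw (hx.fun_sub hx'), toTrunc_sub hx hx', h, zero_mul, add_zero]

end Trunc

/-- `(z, χ, τ) ↦ (χ, τ)`. -/
def projChiTau : ℂ × ℂ × ℂ →L[ℂ] ℂ × ℂ := ContinuousLinearMap.snd ℂ ℂ (ℂ × ℂ)

/-- `(z, χ, τ) ↦ (z, τ)`. -/
def projZTau : ℂ × ℂ × ℂ →L[ℂ] ℂ × ℂ := (ContinuousLinearMap.fst ℂ ℂ (ℂ × ℂ)).prod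
  ((ContinuousLinearMap.snd ℂ ℂ ℂ).comp (ContinuousLinearMap.snd ℂ ℂ (ℂ × ℂ)))

/-- `(z, χ, τ) ↦ (0, τ)`. -/
def projTau : ℂ × ℂ × ℂ →L[ℂ] ℂ × ℂ := (0 : ℂ × ℂ × ℂ →L[ℂ] ℂ).prod
  ((ContinuousLinearMap.snd ℂ ℂ ℂ).comp (ContinuousLinearMap.snd ℂ ℂ (ℂ × ℂ)))

section

variable {F : ℂ → ℂ → ℂ}

lemma AnalyticAt.comp_chi_tau (hF : AnalyticAt ℂ (fun p : ℂ × ℂ => F p.1 p.2) 0) :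
    AnalyticAt ℂ (fun p : ℂ × ℂ × ℂ => F p.2.1 p.2.2) 0 := hF.comp_clm projChiTau

lemma AnalyticAt.comp_tau (hF : AnalyticAt ℂ (fun p : ℂ × ℂ => F p.1 p.2) 0) :
    AnalyticAt ℂ (fun p : ℂ × ℂ × ℂ => F 0 p.2.2) 0 := hF.comp_clm projTau

end

lemma toTrunc_tau_mul {a b n : ℕ} (hn : b < n) {v : ℂ × ℂ × ℂ → ℂ} (hv : AnalyticAt ℂ v 0) :
    toTrunc a b (fun p => p.2.2 ^ n * v p) = 0 := by
  rw [toTrunc_eq_zero ((an_tau.fun_pow n).fun_mul hv)]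
  refine ⟨fun _ => 0, _, analyticAt_const, (an_tau.pow (n - (b + 1))).mul hv,
    Eventually.of_forall fun p => ?_⟩
  simp only [Pi.mul_apply, Pi.pow_apply]
  rw [mul_zero, zero_add, ← mul_assoc, ← pow_add]
  congr 2
  omega

lemma toTrunc_eq_of_tau_pow {a b n : ℕ} (hn : b < n) {f g v : ℂ × ℂ × ℂ → ℂ}
    (hf : AnalyticAt ℂ f 0) (hv : AnalyticAt ℂ v 0)
    (h : ∀ᶠ p in 𝓝 0, f p = g p + p.2.2 ^ n * v p) : toTrunc a b f = toTrunc a b g := by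
  have h1 := (an_tau.fun_pow n).fun_mul hv
  have h2 : g =ᶠ[𝓝 0] fun p => f p - p.2.2 ^ n * v p := by
    filter_upwards [h] with p hp
    rw [hp]; ring
  rw [toTrunc_congr h2, toTrunc_sub hf h1, toTrunc_tau_mul hn hv, sub_zero]

namespace InJet

variable {K a b : ℕ}

lemma of_chi_tau (hT : HasTriangularJacobians Q Q') {e : Maps Q Q' → ℂ → ℂ → ℂ}
    (hea : ∀ H, AnalyticAt ℂ (fun q : ℂ × ℂ => e H q.1 q.2) 0)
    (he : ∀ j ≤ b, JetPoly K fun H => cf (e H) j) :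
    InJet K a b fun H p => e H p.2.1 p.2.2 := by
  have h1 : InJet (Q := Q) (Q' := Q') K a b
      fun H p => ∑ j ∈ Finset.range (b + 1), cf (e H) j p.2.1 * p.2.2 ^ j :=
    InJet.sum _ fun j hj => (of_chi hT (he j (by simpa [Nat.lt_succ_iff] using hj))).mul
      (tau.pow j)
  refine h1.of_toTrunc_eq (fun H => (hea H).comp_chi_tau) fun H => ?_
  have h2 : AnalyticAt ℂ (fun p : ℂ × ℂ × ℂ => rem (e H) (b + 1) (p.2.1, p.2.2)) 0 :=
    (analyticAt_rem (hea H) (b + 1)).comp_clm projChiTau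
  have h3 := toTrunc_add (a := a) (b := b) (h1.1 H) ((an_tau.fun_pow (b + 1)).fun_mul h2)
  rw [toTrunc_tau_mul (Nat.lt_succ_self b) h2, add_zero] at h3
  rw [← h3]
  exact toTrunc_congr (Eventually.of_forall fun p => expand_snd (e H) (b + 1) p.2.1 p.2.2)

lemma of_tau (hT : HasTriangularJacobians Q Q') {e : Maps Q Q' → ℂ → ℂ → ℂ}
    (hea : ∀ H, AnalyticAt ℂ (fun q : ℂ × ℂ => e H q.1 q.2) 0)
    (he : ∀ j ≤ b, JetPoly K fun H (_ : ℂ) => cf (e H) j 0) :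
    InJet K a b fun H p => e H 0 p.2.2 :=
  of_chi_tau hT (e := fun H _ τ => e H 0 τ)
    (fun H => (hea H).comp_clm ((0 : ℂ × ℂ →L[ℂ] ℂ).prod (ContinuousLinearMap.snd ℂ ℂ ℂ))) he

end InJet

lemma InMax.of_tau_dvd {f g : ℂ × ℂ × ℂ → ℂ} (hg : AnalyticAt ℂ g 0)
    (h : ∀ᶠ p in 𝓝 0, f p = p.2.2 * g p) : InMax f :=
  ⟨fun _ => 0, g, analyticAt_const, hg, h.mono fun p hp => by rw [hp]; ring⟩

/-- A germ vanishing on `τ = 0` near the origin is divisible by `τ`. -/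
lemma eq_tau_mul_rem {F : ℂ → ℂ → ℂ} {z : ℂ} (h0 : F z 0 = 0) (τ : ℂ) :
    F z τ = τ * rem F 1 (z, τ) := by
  rw [expand_snd F 1 z τ]
  simp [cf, tc_zero, h0]

lemma JetPoly.cf_Fb_zero {K j : ℕ} (h : j ≤ K) :
    JetPoly K fun (H : Maps Q Q') (_ : ℂ) => cf H.Fb j 0 := by
  refine (JetPoly.tc_cf_F (i := 0) (j := j) (by omega)).conj.congr fun H =>
    Eventually.of_forall fun _ => ?_
  have := (_root_.cf_conjGerm H.analytic_F j).self_of_nhds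
  simp only [cj_zero] at this
  exact this.symm

lemma JetPoly.cf_Gb_zero {K j : ℕ} (h : j ≤ K) :
    JetPoly K fun (H : Maps Q Q') (_ : ℂ) => cf H.Gb j 0 := by
  refine (JetPoly.tc_cf_G (i := 0) (j := j) (by omega)).conj.congr fun H =>
    Eventually.of_forall fun _ => ?_
  have := (_root_.cf_conjGerm H.analytic_G j).self_of_nhds
  simp only [cj_zero] at this
  exact this.symm

section GCoeff

variable {m α : ℕ} {R' T' : ℂ × ℂ × ℂ → ℂ} {S' : ℂ × ℂ → ℂ}

/-- `R'(x, y, t) = y R''(y, x, t)`. -/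
lemma NormalForm.exists_div_snd (nf : NormalForm Q' m α R' T' S') :
    ∃ g : ℂ × ℂ × ℂ → ℂ, AnalyticAt ℂ g 0 ∧
      ∀ᶠ p : ℂ × ℂ × ℂ in 𝓝 0, R' (p.2.1, p.1, p.2.2) = p.1 * g p := by
  let L : ℂ × ℂ × ℂ →L[ℂ] ℂ × ℂ × ℂ := ((ContinuousLinearMap.fst ℂ ℂ ℂ).comp
    (ContinuousLinearMap.snd ℂ ℂ (ℂ × ℂ))).prod ((ContinuousLinearMap.fst ℂ ℂ (ℂ × ℂ)).prod
      ((ContinuousLinearMap.snd ℂ ℂ ℂ).comp (ContinuousLinearMap.snd ℂ ℂ (ℂ × ℂ))))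
  obtain ⟨g, hg, h⟩ := exists_div_fst (y0 := (0 : ℂ × ℂ)) (nf.analytic_R.comp_clm L)
  refine ⟨g, hg, ?_⟩
  filter_upwards [h, eventually_comp_clm projChiTau nf.snd_zero] with p h1 h2
  change R' (p.2.1, p.1, p.2.2) = R' (p.2.1, 0, p.2.2) + p.1 • g p at h1
  rw [h1, smul_eq_mul]
  change R' (p.2.1, 0, p.2.2) = 0 at h2
  rw [h2, zero_add]

lemma Maps.G_eq (hQ : IsNormalCoord Q) (nf : NormalForm Q' m α R' T' S') {g : ℂ × ℂ × ℂ → ℂ}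
    (hg : ∀ᶠ p : ℂ × ℂ × ℂ in 𝓝 0, R' (p.2.1, p.1, p.2.2) = p.1 * g p) (H : Maps Q Q') :
    ∀ᶠ q : ℂ × ℂ in 𝓝 0, H.G q.1 q.2 = H.Gb 0 q.2 +
      H.Gb 0 q.2 ^ m * H.Fb 0 q.2 * g (H.Fb 0 q.2, H.F q.1 q.2, H.Gb 0 q.2) := by
  let L : ℂ × ℂ →L[ℂ] ℂ × ℂ := (0 : ℂ × ℂ →L[ℂ] ℂ).prod (ContinuousLinearMap.snd ℂ ℂ ℂ)
  have hFb : AnalyticAt ℂ (fun q : ℂ × ℂ => H.Fb 0 q.2) 0 := H.analytic_Fb.comp_clm L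
  have hGb : AnalyticAt ℂ (fun q : ℂ × ℂ => H.Gb 0 q.2) 0 := H.analytic_Gb.comp_clm L
  have h1 := (hFb.prod (H.analytic_F.prod hGb)).eventually_comp
    (by simp [H.Fb_zero, H.F_zero, H.Gb_zero]) hg
  have h2 := (H.analytic_F.prod (hFb.prod hGb)).eventually_comp
    (by simp [H.Fb_zero, H.F_zero, H.Gb_zero]) nf.eq_Q
  filter_upwards [h1, h2, H.identity_chi_zero hQ] with q h1 h2 h3
  rw [h3, h2, h1]
  ring

/-- If `m ≥ 1`, the first coefficient of `G` is constant. -/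
lemma Maps.cf_G_one_const (hQ : IsNormalCoord Q) (nf : NormalForm Q' m α R' T' S') (hm : 1 ≤ m)
    (H : Maps Q Q') : cf H.G 1 =ᶠ[𝓝 0] fun _ => cf H.G 1 0 := by
  obtain ⟨g, hg, h⟩ := nf.exists_div_snd
  have hFb := H.analytic_Fb.comp_tau
  have hGb := H.analytic_Gb.comp_tau
  have hg' : AnalyticAt ℂ (fun p : ℂ × ℂ × ℂ => g (H.Fb 0 p.2.2, H.F p.2.1 p.2.2, H.Gb 0 p.2.2)) 0 :=
    hg.comp_zero (hFb.prod (H.analytic_F.comp_chi_tau.prod hGb))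
      (by simp [H.Fb_zero, H.F_zero, H.Gb_zero])
  have hr1 : AnalyticAt ℂ (fun p : ℂ × ℂ × ℂ => rem H.Gb 1 (0, p.2.2)) 0 :=
    (analyticAt_rem H.analytic_Gb 1).comp_clm projTau
  have hr2 : AnalyticAt ℂ (fun p : ℂ × ℂ × ℂ => rem H.Fb 1 (0, p.2.2)) 0 :=
    (analyticAt_rem H.analytic_Fb 1).comp_clm projTau
  have hr3 : AnalyticAt ℂ (fun p : ℂ × ℂ × ℂ => rem H.G 2 (p.2.1, p.2.2)) 0 :=
    (analyticAt_rem H.analytic_G 2).comp_clm projChiTau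
  obtain ⟨m, rfl⟩ : ∃ l, m = l + 1 := ⟨m - 1, by omega⟩
  have := coeff_eventually_const (a := 1) (b := 1)
    (ψ := fun i j χ => if i = 1 then cf H.G j χ else 0) (u := fun _ => 0)
    (c := fun _ => 0) (d := fun q => q.1 * H.Gb 0 q.2) analyticAt_const
    (an_z.fun_mul ((((hGb.fun_pow m).fun_mul hr1).fun_mul (hr2.fun_mul hg')).fun_sub hr3))
    analyticAt_const ?_ (i := 1) (j := 1) le_rfl le_rfl le_rfl
  · simpa using this
  · filter_upwards [eventually_comp_clm projChiTau (H.G_eq hQ nf h)] with p hp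
    change H.G p.2.1 p.2.2 = H.Gb 0 p.2.2 + H.Gb 0 p.2.2 ^ (m + 1) * H.Fb 0 p.2.2 *
      g (H.Fb 0 p.2.2, H.F p.2.1 p.2.2, H.Gb 0 p.2.2) at hp
    have e := expand_snd H.G 2 p.2.1 p.2.2
    rw [Finset.sum_range_succ, Finset.sum_range_one] at e
    simp only [Finset.sum_range_succ, Finset.sum_range_zero, zero_ne_one, if_true, if_false]
    have e1 := eq_tau_mul_rem H.Gb_zero p.2.2
    have e2 := eq_tau_mul_rem H.Fb_zero p.2.2
    rw [pow_succ, hp] at e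
    generalize g (H.Fb 0 p.2.2, H.F p.2.1 p.2.2, H.Gb 0 p.2.2) = G0 at *
    rw [e2] at e
    have e3 : H.Gb 0 p.2.2 * H.Gb 0 p.2.2 ^ m =
      p.2.2 * rem H.Gb 1 (0, p.2.2) * H.Gb 0 p.2.2 ^ m := by rw [← e1]
    linear_combination (-p.1) * e + p.1 * (p.2.2 * rem H.Fb 1 (0, p.2.2)) * G0 * e3

/-- The coefficients of `G` are jet-polynomial. -/
lemma JetPoly.cf_G (hQ : IsNormalCoord Q) (hQ' : IsNormalCoord Q')
    (nf : NormalForm Q' m α R' T' S') {l K n : ℕ} (hnK : n ≤ K) (hn : n ≤ l + 1 + m)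
    (hb : IsBase fun H : Maps Q Q' => cf H.F 0)
    (hf : ∀ j ≤ l, JetPoly K fun H : Maps Q Q' => cf H.F j) :
    JetPoly K fun H : Maps Q Q' => cf H.G n := by
  have hT : HasTriangularJacobians Q Q' := Maps.hasTriangularJacobians hQ hQ'
  obtain ⟨g, hg, h⟩ := nf.exists_div_snd
  have hFb : InJet (Q := Q) (Q' := Q') K 1 n fun H p => H.Fb 0 p.2.2 :=
    .of_tau hT (fun H => H.analytic_Fb) fun j hj => .cf_Fb_zero (hj.trans hnK)
  have hGb : InJet (Q := Q) (Q' := Q') K 1 n fun H p => H.Gb 0 p.2.2 :=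
    .of_tau hT (fun H => H.analytic_Gb) fun j hj => .cf_Gb_zero (hj.trans hnK)
  let x : Maps Q Q' → ℂ × ℂ × ℂ → ℂ := fun H p =>
    ∑ j ∈ Finset.range l, cf H.F (j + 1) p.2.1 * p.2.2 ^ (j + 1)
  have hx : InJet K 1 n x := InJet.sum _ fun j hj =>
    (InJet.of_chi hT (hf (j + 1) (Finset.mem_range.1 hj))).mul (InJet.tau.pow (j + 1))
  have hxm : ∀ H, InMax (x H) := fun H => InMax.sum _ fun j hj =>
    .of_tau_dvd ((analyticAt_cf H.analytic_F (j + 1)).comp_chi.fun_mul (an_tau.fun_pow j))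
      (Eventually.of_forall fun p => by rw [pow_succ]; ring)
  have hr1 : ∀ H : Maps Q Q', AnalyticAt ℂ (fun p : ℂ × ℂ × ℂ => rem H.Gb 1 (0, p.2.2)) 0 :=
    fun H => (analyticAt_rem H.analytic_Gb 1).comp_clm projTau
  have hr2 : ∀ H : Maps Q Q', AnalyticAt ℂ (fun p : ℂ × ℂ × ℂ => rem H.Fb 1 (0, p.2.2)) 0 :=
    fun H => (analyticAt_rem H.analytic_Fb 1).comp_clm projTau
  have hr3 : ∀ H : Maps Q Q', AnalyticAt ℂ (fun p : ℂ × ℂ × ℂ => rem H.F (l + 1) (p.2.1, p.2.2)) 0 :=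
    fun H => (analyticAt_rem H.analytic_F (l + 1)).comp_clm projChiTau
  have hr4 : ∀ H : Maps Q Q', AnalyticAt ℂ (fun p : ℂ × ℂ × ℂ => rem H.G (n + 1) (p.2.1, p.2.2)) 0 :=
    fun H => (analyticAt_rem H.analytic_G (n + 1)).comp_clm projChiTau
  have hξ : Substitutable (Q := Q) (Q' := Q') K 1 n
      fun H p => (x H p, H.Fb 0 p.2.2, H.Gb 0 p.2.2, cf H.F 0 p.2.1) :=
    (((Substitutable.of_chi hT hb fun H => H.F_zero).cons hGb fun H =>
      .of_tau_dvd (hr1 H) (Eventually.of_forall fun p => eq_tau_mul_rem H.Gb_zero _)).cons hFb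
        fun H => .of_tau_dvd (hr2 H) (Eventually.of_forall fun p => eq_tau_mul_rem H.Fb_zero _)).cons
          hx hxm
  let π1 : ℂ × ℂ × ℂ × ℂ →L[ℂ] ℂ := ContinuousLinearMap.fst ℂ ℂ (ℂ × ℂ × ℂ)
  let π2 : ℂ × ℂ × ℂ × ℂ →L[ℂ] ℂ × ℂ × ℂ := ContinuousLinearMap.snd ℂ ℂ (ℂ × ℂ × ℂ)
  let L : ℂ × ℂ × ℂ × ℂ →L[ℂ] ℂ × ℂ × ℂ := ((ContinuousLinearMap.fst ℂ ℂ (ℂ × ℂ)).comp π2).prod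
    ((π1 + (ContinuousLinearMap.snd ℂ ℂ ℂ).comp ((ContinuousLinearMap.snd ℂ ℂ (ℂ × ℂ)).comp π2)).prod
      ((ContinuousLinearMap.fst ℂ ℂ ℂ).comp ((ContinuousLinearMap.snd ℂ ℂ (ℂ × ℂ)).comp π2)))
  have hL : ∀ a b c d, L (a, b, c, d) = (b, a + d, c) := fun a b c d => rfl
  have hΦ : AnalyticAt ℂ (fun q => g (L q)) 0 := hg.comp_clm L
  have hw : InJet (Q := Q) (Q' := Q') K 1 n
      fun H p => p.1 * H.Gb 0 p.2.2 ^ m * H.Fb 0 p.2.2 := (InJet.z.mul (hGb.pow m)).mul hFb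
  have hmain := hw.mul (hξ.comp _ hΦ)
  have key : ∀ H : Maps Q Q', toTrunc 1 n (fun p => p.1 * H.Gb 0 p.2.2 ^ m * H.Fb 0 p.2.2 *
      g (L (x H p, H.Fb 0 p.2.2, H.Gb 0 p.2.2, cf H.F 0 p.2.1))) =
      toTrunc 1 n fun p => ∑ i ∈ Finset.range (1 + 1), (∑ j ∈ Finset.range (n + 1),
          (if i = 1 then cf H.G j p.2.1 else 0) * p.2.2 ^ j) * p.1 ^ i +
            (fun _ : ℂ × ℂ => (0 : ℂ)) p.2 + (fun q : ℂ × ℂ => -(q.1 * H.Gb 0 q.2)) (p.1, p.2.2) := by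
    intro H
    have hx1 : AnalyticAt ℂ (fun p : ℂ × ℂ × ℂ => H.F p.2.1 p.2.2 - cf H.F 0 p.2.1) 0 :=
      H.analytic_F.comp_chi_tau.fun_sub (analyticAt_cf H.analytic_F 0).comp_chi
    have hdiff : ∀ p : ℂ × ℂ × ℂ, H.F p.2.1 p.2.2 - cf H.F 0 p.2.1 - x H p =
        p.2.2 ^ (l + 1) * rem H.F (l + 1) (p.2.1, p.2.2) := fun p => by
      have := expand_snd H.F (l + 1) p.2.1 p.2.2
      rw [Finset.sum_range_succ', pow_zero, mul_one] at this
      rw [this]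
      simp only [x]
      ring
    have hξa := hξ.analytic H
    have hxt : toTrunc 1 n (fun p => H.F p.2.1 p.2.2 - cf H.F 0 p.2.1) - toTrunc 1 n (x H) =
        toTrunc 1 n fun p => p.2.2 ^ (l + 1) * rem H.F (l + 1) (p.2.1, p.2.2) := by
      rw [← toTrunc_sub hx1 (hx.1 H)]
      exact toTrunc_congr (Eventually.of_forall hdiff)
    have hsub := toTrunc_subst (a := 1) (b := n)
      (x := fun p : ℂ × ℂ × ℂ => H.F p.2.1 p.2.2 - cf H.F 0 p.2.1)
      (Φ := fun q => g (L q)) (y := fun p => (H.Fb 0 p.2.2, H.Gb 0 p.2.2, cf H.F 0 p.2.1))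
      hΦ hx1 (hx.1 H) (analyticAt_snd.fun_comp hξa) (hw.1 H)
      (by simp [cf, tc_zero]) (congrArg Prod.fst (hξ.zero H)) (congrArg Prod.snd (hξ.zero H)) (by
        rw [hxt, ← toTrunc_mul (hw.1 H) ((an_tau.fun_pow _).fun_mul (hr3 H))]
        rw [← toTrunc_tau_mul (a := 1) (b := n) (n := l + 2 + m) (by omega)
          (((an_z.fun_mul ((hr1 H).fun_pow m)).fun_mul (hr2 H)).fun_mul (hr3 H))]
        refine toTrunc_congr (Eventually.of_forall fun p => ?_)
        simp only
        rw [eq_tau_mul_rem H.Gb_zero p.2.2, eq_tau_mul_rem H.Fb_zero p.2.2]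
        ring)
    rw [← hsub]
    refine toTrunc_eq_of_tau_pow (n := n + 1) (Nat.lt_succ_self n)
      (v := fun p => p.1 * rem H.G (n + 1) (p.2.1, p.2.2)) ?_ (an_z.fun_mul (hr4 H)) ?_
    · exact (hw.1 H).fun_mul (hΦ.comp_zero (hx1.prod (analyticAt_snd.fun_comp hξa)) (by
        simp [cf, tc_zero, H.Fb_zero, H.Gb_zero, H.F_zero]))
    · filter_upwards [eventually_comp_clm projChiTau (H.G_eq hQ nf h)] with p hp
      change H.G p.2.1 p.2.2 = H.Gb 0 p.2.2 + H.Gb 0 p.2.2 ^ m * H.Fb 0 p.2.2 *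
        g (H.Fb 0 p.2.2, H.F p.2.1 p.2.2, H.Gb 0 p.2.2) at hp
      have e := expand_snd H.G (n + 1) p.2.1 p.2.2
      rw [hp] at e
      rw [hL, sub_add_cancel, Finset.sum_range_succ, Finset.sum_range_one]
      simp only [zero_ne_one, if_true, if_false, zero_mul, Finset.sum_const_zero]
      linear_combination p.1 * e
  have hφ := InJet.coeff hmain (φ := fun i j H => if i = 1 then cf H.G j else fun _ => 0)
    (fun i j H => by
      split_ifs
      exacts [analyticAt_cf H.analytic_G j, analyticAt_const])
    (c := fun _ _ => 0) (d := fun H q => -(q.1 * H.Gb 0 q.2)) (fun H => analyticAt_const)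
    (fun H => (analyticAt_fst.fun_mul (H.analytic_Gb.comp_clm
      ((0 : ℂ × ℂ →L[ℂ] ℂ).prod (ContinuousLinearMap.snd ℂ ℂ ℂ)))).fun_neg)
    (fun H => by
      refine (key H).trans (congrArg _ (funext fun p => ?_))
      simp only [ite_apply]) (i := 1) (j := n) le_rfl le_rfl le_rfl
  simp only [if_true] at hφ
  refine (hφ.add (JetPoly.tc_cf_G (i := 0) (j := n) (by omega))).congr fun H =>
    Eventually.of_forall fun χ => ?_
  simp only [tc_zero]
  ring

end GCoeff

section Ring

variable {A : Type*} [CommRing A] {s t : A}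

/-- The quotient `(x ^ n - y ^ n) / (x - y)`. -/
def geomQuot (n : ℕ) (x y : A) : A := ∑ i ∈ Finset.range n, x ^ i * y ^ (n - 1 - i)

lemma InPow.sum {ι : Type*} (I : Finset ι) {n : ℕ} {x : ι → A} (hx : ∀ i ∈ I, InPow s t n (x i)) :
    InPow s t n (∑ i ∈ I, x i) := by
  classical
  induction I using Finset.induction_on with
  | empty => exact ⟨0, 0, by simp⟩
  | insert i I hi ih =>
    obtain ⟨u, v, h⟩ := hx i (Finset.mem_insert_self _ _)
    obtain ⟨u', v', h'⟩ := ih fun j hj => hx j (Finset.mem_insert_of_mem hj)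
    refine ⟨u + u', v + v', ?_⟩
    rw [Finset.sum_insert hi, h, h']
    ring

lemma inPow_self : InPow s t 0 t := ⟨1, 0, by ring⟩

lemma InPow.mul_geomQuot {r q : A} (hs : s * s = 0) (hr : InPow s t 0 r) (hq : InPow s t 0 q)
    (n : ℕ) : InPow s t n (r * geomQuot (n + 1) q t) := by
  rw [geomQuot, Finset.mul_sum]
  refine InPow.sum _ fun i hi => ?_
  have h := (InPow.mul_pow hs (InPow.mul_pow hs hr hq i) inPow_self (n - i))
  have : 0 + i + (n - i) = n := by have := Finset.mem_range.1 hi; omega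
  rw [this] at h
  simpa [mul_assoc] using h

end Ring

section Trunc

variable {a b : ℕ} {f g : ℂ × ℂ × ℂ → ℂ}

lemma analyticAt_geomQuot (hf : AnalyticAt ℂ f 0) (hg : AnalyticAt ℂ g 0) (n : ℕ) :
    AnalyticAt ℂ (fun p => geomQuot n (f p) (g p)) 0 :=
  Finset.analyticAt_fun_sum _ fun _ _ => (hf.pow _).mul (hg.pow _)

lemma toTrunc_geomQuot (hf : AnalyticAt ℂ f 0) (hg : AnalyticAt ℂ g 0) (n : ℕ) :
    toTrunc a b (fun p => geomQuot n (f p) (g p)) =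
      geomQuot n (toTrunc a b f) (toTrunc a b g) := by
  unfold geomQuot
  rw [toTrunc_sum _ fun i _ => (hf.fun_pow _).fun_mul (hg.fun_pow _)]
  refine Finset.sum_congr rfl fun i _ => ?_
  rw [toTrunc_mul (hf.fun_pow _) (hg.fun_pow _), toTrunc_pow hf, toTrunc_pow hg]

lemma InJet.geomQuot {K : ℕ} {f g : Maps Q Q' → ℂ × ℂ × ℂ → ℂ} (hf : InJet K a b f)
    (hg : InJet K a b g) (n : ℕ) : InJet K a b fun H p => geomQuot n (f H p) (g H p) :=
  InJet.sum _ fun _ _ => (hf.pow _).mul (hg.pow _)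

lemma zT_sq {a : ℕ} (ha : 1 ≤ a) : zT a b ^ a * zT a b ^ a = 0 := by
  obtain ⟨l, rfl⟩ : ∃ l, a = l + 1 := ⟨a - 1, by omega⟩
  linear_combination zT (l + 1) b ^ l * zT_pow (a := l + 1) (b := b)

end Trunc

/-- The defining function as a function on `ℂ³`. -/
def qf (Q : ℂ → ℂ → ℂ → ℂ) (p : ℂ × ℂ × ℂ) : ℂ := Q p.1 p.2.1 p.2.2

namespace NormalForm

variable {m α : ℕ} {R T : ℂ × ℂ × ℂ → ℂ} {S : ℂ × ℂ → ℂ}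

lemma analytic_qf (nf : NormalForm Q m α R T S) : AnalyticAt ℂ (qf Q) 0 :=
  (an_tau.fun_add ((an_tau.fun_pow m).fun_mul nf.analytic_R)).congr (nf.eq_Q.mono fun _ h => h.symm)

lemma R_zero (nf : NormalForm Q m α R T S) : R 0 = 0 := nf.fst_zero.self_of_nhds

lemma qf_zero (nf : NormalForm Q m α R T S) : qf Q 0 = 0 := by
  have := nf.eq_Q.self_of_nhds
  simp only [nf.R_zero] at this
  simpa [qf] using this

lemma analytic_zS (nf : NormalForm Q m α R T S) :
    AnalyticAt ℂ (fun p : ℂ × ℂ × ℂ => S (p.1, p.2.1)) 0 :=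
  nf.analytic_S.comp_clm ((ContinuousLinearMap.fst ℂ ℂ (ℂ × ℂ)).prod
    ((ContinuousLinearMap.fst ℂ ℂ ℂ).comp (ContinuousLinearMap.snd ℂ ℂ (ℂ × ℂ))))

lemma toTrunc_R (nf : NormalForm Q m α R T S) (a b : ℕ) : toTrunc a b R =
    zT a b ^ α * toTrunc a b (fun p => S (p.1, p.2.1)) + tT a b * toTrunc a b T := by
  have h1 := (an_z.fun_pow α).fun_mul nf.analytic_zS
  rw [toTrunc_congr nf.eq_R, toTrunc_add h1 (an_tau.fun_mul nf.analytic_T),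
    toTrunc_mul (an_z.fun_pow α) nf.analytic_zS, toTrunc_mul an_tau nf.analytic_T, toTrunc_pow an_z]
  rfl

lemma toTrunc_qf (nf : NormalForm Q m α R T S) (a b : ℕ) : toTrunc a b (qf Q) =
    tT a b + tT a b ^ m * toTrunc a b R := by
  have h : qf Q =ᶠ[𝓝 0] fun p => p.2.2 + p.2.2 ^ m * R p := nf.eq_Q
  rw [toTrunc_congr h, toTrunc_add an_tau ((an_tau.fun_pow m).fun_mul nf.analytic_R),
    toTrunc_mul (an_tau.fun_pow m) nf.analytic_R, toTrunc_pow an_tau]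
  rfl

lemma inPow_R (nf : NormalForm Q m α R T S) (b : ℕ) :
    InPow (zT α b ^ α) (tT α b) 0 (toTrunc α b R) :=
  ⟨toTrunc α b T, toTrunc α b (fun p => S (p.1, p.2.1)), by rw [nf.toTrunc_R α b]; ring⟩

lemma inPow_qf (nf : NormalForm Q m α R T S) (b : ℕ) :
    InPow (zT α b ^ α) (tT α b) 0 (toTrunc α b (qf Q)) := by
  refine ⟨1 + tT α b ^ m * toTrunc α b T, tT α b ^ m * toTrunc α b (fun p => S (p.1, p.2.1)), ?_⟩
  rw [nf.toTrunc_qf, nf.toTrunc_R α b]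
  ring

/-- The difference `G(z, Q) - G(z, τ)`, divided by `τ ^ m`, and its class. -/
lemma exists_left (nf : NormalForm Q m α R T S) (hα : 1 ≤ α) (k : ℕ) {G : ℂ → ℂ → ℂ}
    (hG : AnalyticAt ℂ (fun q : ℂ × ℂ => G q.1 q.2) 0) :
    ∃ D : ℂ × ℂ × ℂ → ℂ, AnalyticAt ℂ D 0 ∧
      (∀ᶠ p in 𝓝 0, G p.1 (qf Q p) - G p.1 p.2.2 = p.2.2 ^ m * (R p * D p)) ∧
      toTrunc α k (fun p => R p * D p) = toTrunc α k fun p => R p *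
        (∑ j ∈ Finset.range (k + 1), cf G j p.1 * geomQuot j (qf Q p) p.2.2 +
          cf G (k + 1) 0 * geomQuot (k + 1) (qf Q p) p.2.2) := by
  have hb : AnalyticAt ℂ (fun q : ℂ × ℂ => rem G (k + 2) (q.2, q.1)) 0 :=
    (analyticAt_rem hG (k + 2)).comp_clm swapPair
  obtain ⟨Ψ, hΨ, hd⟩ := exists_diff_fst hb
  have hq := nf.analytic_qf
  have hR := nf.analytic_R
  have hη : AnalyticAt ℂ (fun p : ℂ × ℂ × ℂ => (p.2.2 ^ m * R p, p.2.2, p.1)) 0 :=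
    ((an_tau.fun_pow m).fun_mul hR).prod (an_tau.prod an_z)
  have hη0 : (fun p : ℂ × ℂ × ℂ => (p.2.2 ^ m * R p, p.2.2, p.1)) 0 = 0 := by simp [nf.R_zero]
  have hΨ' : AnalyticAt ℂ (fun p : ℂ × ℂ × ℂ => Ψ (p.2.2 ^ m * R p, p.2.2, p.1)) 0 :=
    hΨ.comp_zero hη hη0
  have hb' : AnalyticAt ℂ (fun p : ℂ × ℂ × ℂ => rem G (k + 2) (p.1, qf Q p)) 0 :=
    (analyticAt_rem hG (k + 2)).comp_zero (an_z.prod hq) (by simp [nf.qf_zero])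
  have hgq := analyticAt_geomQuot hq an_tau
  have hcf : ∀ j, AnalyticAt ℂ (fun p : ℂ × ℂ × ℂ => cf G j p.1) 0 := fun j =>
    (analyticAt_cf hG j).comp_z
  have hterm : ∀ j, AnalyticAt ℂ (fun p => cf G j p.1 * geomQuot j (qf Q p) p.2.2) 0 := fun j =>
    (hcf j).fun_mul (hgq j)
  have hsum : ∀ n, AnalyticAt ℂ (fun p : ℂ × ℂ × ℂ =>
      ∑ j ∈ Finset.range n, cf G j p.1 * geomQuot j (qf Q p) p.2.2) 0 := fun n =>
    Finset.analyticAt_fun_sum _ fun j _ => hterm j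
  have hA2 := (hgq (k + 2)).fun_mul hb'
  have hA3 := (an_tau.fun_pow (k + 2)).fun_mul hΨ'
  have hD := ((hsum (k + 2)).fun_add hA2).fun_add hA3
  refine ⟨_, hD, ?_, ?_⟩
  · filter_upwards [hη.eventually_comp hη0 hd, nf.eq_Q] with p h1 h2
    change qf Q p = _ at h2
    rw [← h2] at h1
    have e1 := expand_snd G (k + 2) p.1 (qf Q p)
    have e2 := expand_snd G (k + 2) p.1 p.2.2
    have e3 : ∀ n, geomQuot n (qf Q p) p.2.2 * (qf Q p - p.2.2) = qf Q p ^ n - p.2.2 ^ n :=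
      fun n => Commute.geom_sum₂_mul (Commute.all _ _) n
    have e4 : p.2.2 ^ m * R p = qf Q p - p.2.2 := by rw [h2]; ring
    have e5 : ∑ j ∈ Finset.range (k + 2), cf G j p.1 * qf Q p ^ j -
        ∑ j ∈ Finset.range (k + 2), cf G j p.1 * p.2.2 ^ j =
        (∑ j ∈ Finset.range (k + 2), cf G j p.1 * geomQuot j (qf Q p) p.2.2) *
          (qf Q p - p.2.2) := by
      rw [← Finset.sum_sub_distrib, Finset.sum_mul]
      refine Finset.sum_congr rfl fun j _ => ?_
      rw [mul_assoc, e3]; ring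
    rw [← mul_assoc, e4]
    rw [e4] at h1
    linear_combination e1 - e2 + e5 + (-rem G (k + 2) (p.1, qf Q p)) * e3 (k + 2) +
      p.2.2 ^ (k + 2) * h1
  · obtain ⟨h, hh, hz⟩ := exists_div_fst (f := fun q : ℂ × ℂ => cf G (k + 1) q.1) (y0 := (0 : ℂ))
      ((analyticAt_cf hG (k + 1)).comp_clm (ContinuousLinearMap.fst ℂ ℂ ℂ))
    have hh' : AnalyticAt ℂ (fun p : ℂ × ℂ × ℂ => h (p.1, p.2.2)) 0 := hh.comp_clm projZTau
    have hz' : (fun p : ℂ × ℂ × ℂ => cf G (k + 1) p.1) =ᶠ[𝓝 0]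
        fun p => cf G (k + 1) 0 + p.1 * h (p.1, p.2.2) := by
      filter_upwards [eventually_comp_clm projZTau hz] with p hp
      exact hp
    have hc : AnalyticAt ℂ (fun _ : ℂ × ℂ × ℂ => cf G (k + 1) 0) 0 := analyticAt_const
    have t1 : toTrunc α k (fun p => cf G (k + 1) p.1) = toTrunc α k (fun _ => cf G (k + 1) 0) +
        zT α k * toTrunc α k fun p => h (p.1, p.2.2) := by
      rw [toTrunc_congr hz', toTrunc_add hc (an_z.fun_mul hh'), toTrunc_mul an_z hh']; rfl
    have hs := zT_sq (b := k) hα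
    have i1 := InPow.mul_geomQuot hs (nf.inPow_R k) (nf.inPow_qf k) k
    have i2 := InPow.mul_geomQuot hs (nf.inPow_R k) (nf.inPow_qf k) (k + 1)
    have i3 := i2.eq_zero tT_pow
    have i4 := i1.mul_eq_zero tT_pow (z := zT α k) (by rw [← pow_succ']; exact zT_pow)
    have s1 : (fun p : ℂ × ℂ × ℂ => ∑ j ∈ Finset.range (k + 2),
        cf G j p.1 * geomQuot j (qf Q p) p.2.2) = fun p => ∑ j ∈ Finset.range (k + 1),
        cf G j p.1 * geomQuot j (qf Q p) p.2.2 + cf G (k + 1) p.1 * geomQuot (k + 1) (qf Q p) p.2.2 :=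
      funext fun p => Finset.sum_range_succ _ _
    rw [toTrunc_mul hR hD, toTrunc_add ((hsum (k + 2)).fun_add hA2) hA3,
      toTrunc_add (hsum (k + 2)) hA2, s1, toTrunc_add (hsum (k + 1)) (hterm (k + 1)),
      toTrunc_mul (hcf (k + 1)) (hgq (k + 1)), t1, toTrunc_mul (hgq (k + 2)) hb',
      toTrunc_tau_mul (show k < k + 2 by omega) hΨ',
      toTrunc_mul hR ((hsum (k + 1)).fun_add (hc.fun_mul (hgq (k + 1)))),
      toTrunc_add (hsum (k + 1)) (hc.fun_mul (hgq (k + 1))), toTrunc_mul hc (hgq (k + 1)),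
      toTrunc_geomQuot hq an_tau (k + 1), toTrunc_geomQuot hq an_tau (k + 2)]
    change zT α k * (toTrunc α k R * geomQuot (k + 1) (toTrunc α k (qf Q))
      (toTrunc α k fun p => p.2.2)) = 0 at i4
    change toTrunc α k R * geomQuot (k + 2) (toTrunc α k (qf Q))
      (toTrunc α k fun p => p.2.2) = 0 at i3
    linear_combination toTrunc α k (fun p => h (p.1, p.2.2)) * i4 +
      toTrunc α k (fun p => rem G (k + 2) (p.1, qf Q p)) * i3

end NormalForm

namespace Maps

/-- The function `F(z, Q(z, χ, τ))`. -/
def fq (H : Maps Q Q') (p : ℂ × ℂ × ℂ) : ℂ := H.F p.1 (qf Q p)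

/-- The quotient of the conjugate of `G` by `τ`. -/
def gam (H : Maps Q Q') (p : ℂ × ℂ × ℂ) : ℂ := rem H.Gb 1 (p.2.1, p.2.2)

lemma analytic_gam (H : Maps Q Q') : AnalyticAt ℂ H.gam 0 :=
  (analyticAt_rem H.analytic_Gb 1).comp_clm projChiTau

lemma Gb_chi_zero (hQ : IsNormalCoord Q) (hQ' : IsNormalCoord Q') (H : Maps Q Q') :
    ∀ᶠ χ in 𝓝 (0 : ℂ), H.Gb χ 0 = 0 := by
  filter_upwards [tendsto_cj.eventually (H.G_z_zero hQ hQ')] with χ h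
  simp only [Gb, conjGerm, cj_zero, h]

lemma eventually_Gb_eq (hQ : IsNormalCoord Q) (hQ' : IsNormalCoord Q') (H : Maps Q Q') :
    ∀ᶠ p : ℂ × ℂ × ℂ in 𝓝 0, H.Gb p.2.1 p.2.2 = p.2.2 * H.gam p := by
  filter_upwards [eventually_comp_clm ((ContinuousLinearMap.fst ℂ ℂ ℂ).comp projChiTau)
    (H.Gb_chi_zero hQ hQ')] with p h
  exact eq_tau_mul_rem h _

section

variable {m α : ℕ} {R T R' T' : ℂ × ℂ × ℂ → ℂ} {S S' : ℂ × ℂ → ℂ}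

lemma analytic_fq (nf : NormalForm Q m α R T S) (H : Maps Q Q') : AnalyticAt ℂ H.fq 0 :=
  H.analytic_F.comp_zero (an_z.prod nf.analytic_qf) (by simp [nf.qf_zero])

lemma fq_zero (nf : NormalForm Q m α R T S) (H : Maps Q Q') : H.fq 0 = 0 := by
  simp [fq, nf.qf_zero, F_zero]

/-- The mapping identity in normal form, up to functions of `(χ, τ)` and of `(z, τ)`. -/
lemma exists_identity (hQ : IsNormalCoord Q) (hQ' : IsNormalCoord Q')
    (nf : NormalForm Q m α R T S) (nf' : NormalForm Q' m α R' T' S') (hα : 1 ≤ α) (k : ℕ)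
    (H : Maps Q Q') : ∃ c d : ℂ × ℂ → ℂ, AnalyticAt ℂ c 0 ∧ AnalyticAt ℂ d 0 ∧
      toTrunc α k (fun p => R p *
        (∑ j ∈ Finset.range (k + 1), cf H.G j p.1 * geomQuot j (qf Q p) p.2.2 +
          cf H.G (k + 1) 0 * geomQuot (k + 1) (qf Q p) p.2.2)) =
      toTrunc α k fun p => H.gam p ^ m * R' (H.fq p, H.Fb p.2.1 p.2.2, H.Gb p.2.1 p.2.2) +
        c p.2 + d (p.1, p.2.2) := by
  obtain ⟨D, hD, h1, h2⟩ := nf.exists_left hα k H.analytic_G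
  rw [← h2]
  let L0 : ℂ × ℂ →L[ℂ] ℂ × ℂ := (0 : ℂ × ℂ →L[ℂ] ℂ).prod (ContinuousLinearMap.snd ℂ ℂ ℂ)
  have hF := H.analytic_F
  have hFb := H.analytic_Fb
  have hGb := H.analytic_Gb
  have hr := analyticAt_rem H.analytic_Gb 1
  have k1 : AnalyticAt ℂ (fun q : ℂ × ℂ => H.F 0 q.2) 0 := hF.comp_clm L0
  have k2 : AnalyticAt ℂ (fun q : ℂ × ℂ => H.Fb 0 q.2) 0 := hFb.comp_clm L0
  have k3 : AnalyticAt ℂ (fun q : ℂ × ℂ => H.Gb 0 q.2) 0 := hGb.comp_clm L0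
  have k4 : AnalyticAt ℂ (fun q : ℂ × ℂ => rem H.Gb 1 (0, q.2)) 0 := hr.comp_clm L0
  have k5 : AnalyticAt ℂ (fun q : ℂ × ℂ => rem H.Gb 1 (q.1, q.2)) 0 := hr
  let c1 : ℂ × ℂ → ℂ := fun q => rem H.Gb 1 (q.1, q.2) ^ m *
    R' (H.F 0 q.2, H.Fb q.1 q.2, H.Gb q.1 q.2)
  let c2 : ℂ × ℂ → ℂ := fun q => rem H.Gb 1 (0, q.2) ^ m * R' (H.F 0 q.2, H.Fb 0 q.2, H.Gb 0 q.2)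
  let d1 : ℂ × ℂ → ℂ := fun q => rem H.Gb 1 (0, q.2) ^ m *
    R' (H.F q.1 q.2, H.Fb 0 q.2, H.Gb 0 q.2)
  have hc1 : AnalyticAt ℂ c1 0 := (k5.fun_pow m).fun_mul (nf'.analytic_R.comp_zero
    (k1.prod (hFb.prod hGb)) (by simp [H.F_zero, H.Fb_zero, H.Gb_zero]))
  have hc2 : AnalyticAt ℂ c2 0 := (k4.fun_pow m).fun_mul (nf'.analytic_R.comp_zero
    (k1.prod (k2.prod k3)) (by simp [H.F_zero, H.Fb_zero, H.Gb_zero]))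
  have hd1 : AnalyticAt ℂ d1 0 := (k4.fun_pow m).fun_mul (nf'.analytic_R.comp_zero
    (hF.prod (k2.prod k3)) (by simp [H.F_zero, H.Fb_zero, H.Gb_zero]))
  have hc : AnalyticAt ℂ (fun q => -c1 q + c2 q) 0 := hc1.fun_neg.fun_add hc2
  have hd : AnalyticAt ℂ (fun q => -d1 q) 0 := hd1.fun_neg
  refine ⟨fun q => -c1 q + c2 q, fun q => -d1 q, hc, hd, toTrunc_congr ?_⟩
  have hfq := H.analytic_fq nf
  have hη := hfq.prod (H.analytic_Fb.comp_chi_tau.prod H.analytic_Gb.comp_chi_tau)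
  have hη0 : (fun p : ℂ × ℂ × ℂ => (H.fq p, H.Fb p.2.1 p.2.2, H.Gb p.2.1 p.2.2)) 0 = 0 := by
    simp [H.fq_zero nf, H.Fb_zero, H.Gb_zero]
  have hRη := nf'.analytic_R.comp_zero hη hη0
  have hX : AnalyticAt ℂ (fun p : ℂ × ℂ × ℂ => R p * D p -
      (H.gam p ^ m * R' (H.fq p, H.Fb p.2.1 p.2.2, H.Gb p.2.1 p.2.2) +
        (-c1 p.2 + c2 p.2) + -d1 (p.1, p.2.2))) 0 :=
    (nf.analytic_R.fun_mul hD).fun_sub ((((H.analytic_gam.fun_pow m).fun_mul hRη).fun_add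
      (hc.comp_clm projChiTau)).fun_add (hd.comp_clm projZTau))
  have hz : ∀ᶠ p : ℂ × ℂ × ℂ in 𝓝 0, H.G p.1 (qf Q p) = H.Gb p.2.1 p.2.2 +
      H.Gb p.2.1 p.2.2 ^ m * R' (H.fq p, H.Fb p.2.1 p.2.2, H.Gb p.2.1 p.2.2) := by
    filter_upwards [H.identity, hη.eventually_comp hη0 nf'.eq_Q] with p e1 e2
    exact e1.trans e2
  have hq0 : ∀ᶠ q : ℂ × ℂ in 𝓝 0, Q 0 q.1 q.2 = q.2 := hQ.2.2.1
  have e3 : ∀ᶠ p : ℂ × ℂ × ℂ in 𝓝 0, qf Q (0, p.2.1, p.2.2) = p.2.2 :=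
    eventually_comp_clm projChiTau hq0
  have e4 : ∀ᶠ p : ℂ × ℂ × ℂ in 𝓝 0, qf Q (p.1, 0, p.2.2) = p.2.2 :=
    eventually_comp_clm projZTau hQ.2.1
  have e5 := eventually_comp_clm (inclFst.comp projChiTau) hz
  have e6 := eventually_comp_clm (inclSnd.comp projZTau) hz
  have e7 : ∀ᶠ p : ℂ × ℂ × ℂ in 𝓝 0, qf Q (0, 0, p.2.2) = p.2.2 :=
    eventually_comp_clm projTau hq0
  have e8 := eventually_comp_clm (inclFst.comp projTau) hz
  have g1 := H.eventually_Gb_eq hQ hQ'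
  have g0 : ∀ τ : ℂ, H.Gb 0 τ = τ * rem H.Gb 1 (0, τ) := fun τ => eq_tau_mul_rem H.Gb_zero τ
  have hfin := tau_cancel (m := m) hX (by
    filter_upwards [hz, h1, e3, e4, e5, e6, e7, e8, g1] with p hz h1 e3 e4 e5 e6 e7 e8 g1
    simp only [ContinuousLinearMap.comp_apply, inclFst_apply, inclSnd_apply, fq, projChiTau,
      projZTau, projTau, ContinuousLinearMap.prod_apply, ContinuousLinearMap.coe_fst',
      ContinuousLinearMap.coe_snd', _root_.zero_apply] at e5 e6 e8
    rw [e3] at e5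
    rw [e4] at e6
    rw [e7] at e8
    have p1 : H.Gb p.2.1 p.2.2 ^ m = p.2.2 ^ m * H.gam p ^ m := by rw [g1, mul_pow]
    have p2 : H.Gb 0 p.2.2 ^ m = p.2.2 ^ m * rem H.Gb 1 (0, p.2.2) ^ m := by
      rw [g0, mul_pow]
    rw [p1] at hz e5
    rw [p2] at e6 e8
    simp only [c1, c2, d1]
    simp only [gam] at *
    linear_combination (-1 : ℂ) * h1 + hz - e6 - e5 + e8)
  filter_upwards [hfin] with p hp
  exact sub_eq_zero.1 hp

end

end Maps

lemma IsBaseUnit.entry11_conj :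
    IsBaseUnit (fun (H : Maps Q Q') (_ : ℂ) => cj (H.J 1 1)) := by
  refine ⟨fun p => p.2.2 1 1, fun _ _ _ _ => analyticAt_entry_snd 1 1 _, ?_,
    fun _ => EventuallyEq.rfl⟩
  rintro A hA _ ⟨B, hB, rfl⟩ h
  exact hB.2.2 (cj_eq_zero.1 h)

lemma InMax.of_zero {f : ℂ × ℂ × ℂ → ℂ} (hf : AnalyticAt ℂ f 0)
    (h : ∀ᶠ χ in 𝓝 (0 : ℂ), f (0, χ, 0) = 0) : InMax f := by
  obtain ⟨g, hg, h1⟩ := exists_div_fst (y0 := (0 : ℂ × ℂ)) hf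
  obtain ⟨g', hg', h2⟩ := exists_div_fst (y0 := (0 : ℂ))
    (hf.comp_clm (inclFst.comp ((ContinuousLinearMap.snd ℂ ℂ ℂ).prod
      (ContinuousLinearMap.fst ℂ ℂ ℂ))))
  refine ⟨g, fun p => g' (p.2.2, p.2.1), hg, hg'.comp_clm (((ContinuousLinearMap.snd ℂ ℂ ℂ).prod
      (ContinuousLinearMap.fst ℂ ℂ ℂ)).comp projChiTau), ?_⟩
  filter_upwards [h1, eventually_comp_clm (((ContinuousLinearMap.snd ℂ ℂ ℂ).prod
      (ContinuousLinearMap.fst ℂ ℂ ℂ)).comp projChiTau) h2,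
    eventually_comp_clm ((ContinuousLinearMap.fst ℂ ℂ ℂ).comp projChiTau) h] with p h1 h2 h3
  change f p = f (0, p.2.1, p.2.2) + p.1 * g p at h1
  change f (0, p.2.1, p.2.2) = f (0, p.2.1, 0) + p.2.2 * g' (p.2.2, p.2.1) at h2
  change f (0, p.2.1, 0) = 0 at h3
  rw [h1, h2, h3]
  ring

section

variable {m α : ℕ} {R T R' T' : ℂ × ℂ × ℂ → ℂ} {S S' : ℂ × ℂ → ℂ}

namespace NormalForm

lemma qf_chi_zero (hQ : IsNormalCoord Q) : ∀ᶠ χ in 𝓝 (0 : ℂ), qf Q (0, χ, 0) = 0 :=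
  eventually_comp_clm (ContinuousLinearMap.inl ℂ ℂ ℂ) hQ.2.2.1

lemma S_zero (nf : NormalForm Q m α R T S) : S 0 = 0 := by
  have h1 : ∀ᶠ z in 𝓝 (0 : ℂ), z ^ α * S (z, 0) = 0 := by
    filter_upwards [eventually_comp_clm (ContinuousLinearMap.inl ℂ ℂ ℂ) nf.snd_zero,
      eventually_comp_clm (ContinuousLinearMap.inl ℂ ℂ (ℂ × ℂ)) nf.eq_R] with z h1 h2
    change R (z, 0, 0) = 0 at h1
    change R (z, 0, 0) = z ^ α * S (z, 0) + 0 * T _ at h2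
    rw [h1] at h2
    linear_combination -h2
  have h2 : AnalyticAt ℂ (fun z : ℂ => S (z, 0)) 0 :=
    nf.analytic_S.comp_clm (ContinuousLinearMap.inl ℂ ℂ ℂ)
  exact (eventually_eq_zero_of_pow_smul h2 (ContinuousLinearMap.id ℂ ℂ) 1 rfl (m := α)
    (h1.mono fun z hz => hz)).self_of_nhds

end NormalForm

namespace Maps

lemma cf_F_zero_eq (H : Maps Q Q') : tc 1 (cf H.F 0) = H.J 0 0 := by
  have := pd_eq_tc H.analytic_F 1 0
  simp only [Nat.factorial, Nat.cast_one, one_mul, mul_one] at this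
  simpa [J, Jmat] using this.symm

lemma cf_F_one_eq (H : Maps Q Q') : cf H.F 1 0 = H.J 0 1 := by
  have := pd_eq_tc H.analytic_F 0 1
  simp only [Nat.factorial, Nat.cast_one, one_mul, mul_one, tc_zero] at this
  simpa [J, Jmat] using this.symm

lemma cf_G_one_eq (H : Maps Q Q') : cf H.G 1 0 = H.J 1 1 := by
  have := pd_eq_tc H.analytic_G 0 1
  simp only [Nat.factorial, Nat.cast_one, one_mul, mul_one, tc_zero] at this
  simpa [J, Jmat] using this.symm

/-- The leading coefficient. -/
def unit (m α : ℕ) (S : ℂ × ℂ → ℂ) (H : Maps Q Q') (χ : ℂ) : ℂ :=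
  cj (H.J 1 1) ^ m * (H.J 0 0 + 0 ^ m * 0 ^ (α - 1) * S (0, χ) * H.J 0 1) ^ α

lemma isBaseUnit_unit (nf : NormalForm Q m α R T S) :
    IsBaseUnit fun H : Maps Q Q' => unit m α S H := by
  have hS : AnalyticAt ℂ (fun χ : ℂ => 0 ^ m * 0 ^ (α - 1) * S (0, χ)) 0 :=
    analyticAt_const.fun_mul (nf.analytic_S.comp_clm (ContinuousLinearMap.inr ℂ ℂ ℂ))
  refine (IsBaseUnit.entry11_conj.pow m).mul (IsBaseUnit.pow ?_ α)
  refine IsBaseUnit.of_eval ((IsBase.entry_fst 0 0).add ((IsBase.of_analytic hS).mul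
    (IsBase.entry_fst 0 1))) IsBaseUnit.entry00 fun H => ?_
  have : S (0, 0) = 0 := nf.S_zero
  simp [this]

lemma exists_lead (hQ : IsNormalCoord Q) (nf : NormalForm Q m α R T S) (hα : 1 ≤ α)
    (H : Maps Q Q') : ∃ u v : ℂ × ℂ × ℂ → ℂ, AnalyticAt ℂ u 0 ∧ AnalyticAt ℂ v 0 ∧
      (∀ᶠ p in 𝓝 0, H.fq p = p.1 * u p + p.2.2 * v p) ∧
      ∀ᶠ χ in 𝓝 (0 : ℂ), u (0, χ, 0) = H.J 0 0 + 0 ^ m * 0 ^ (α - 1) * S (0, χ) * H.J 0 1 := by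
  obtain ⟨w, hw, hqw⟩ : ∃ w : ℂ × ℂ × ℂ → ℂ, AnalyticAt ℂ w 0 ∧
      ∀ᶠ p in 𝓝 0, qf Q p = p.2.2 * w p + 0 ^ m * (p.1 ^ α * S (p.1, p.2.1)) := by
    rcases m with _ | m
    · refine ⟨fun p => 1 + T p, analyticAt_const.fun_add nf.analytic_T, ?_⟩
      filter_upwards [nf.eq_Q, nf.eq_R] with p h1 h2
      change qf Q p = _ at h1
      rw [h1, h2]
      ring
    · refine ⟨fun p => 1 + p.2.2 ^ m * R p,
        analyticAt_const.fun_add ((an_tau.fun_pow m).fun_mul nf.analytic_R), ?_⟩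
      filter_upwards [nf.eq_Q] with p h1
      change qf Q p = _ at h1
      rw [h1]
      ring
  have hr : AnalyticAt ℂ (fun p : ℂ × ℂ × ℂ => rem H.F 1 (p.1, qf Q p)) 0 :=
    (analyticAt_rem H.analytic_F 1).comp_zero (an_z.prod nf.analytic_qf) (by simp [nf.qf_zero])
  have hf0 : AnalyticAt ℂ (fun p : ℂ × ℂ × ℂ => ds (cf H.F 0) p.1) 0 :=
    (analyticAt_cf H.analytic_F 0).ds.comp_z
  refine ⟨fun p => ds (cf H.F 0) p.1 +
      0 ^ m * p.1 ^ (α - 1) * S (p.1, p.2.1) * rem H.F 1 (p.1, qf Q p),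
    fun p => w p * rem H.F 1 (p.1, qf Q p),
    hf0.fun_add (((analyticAt_const.fun_mul (an_z.fun_pow _)).fun_mul nf.analytic_zS).fun_mul hr),
    hw.fun_mul hr, ?_, ?_⟩
  · filter_upwards [hqw] with p hp
    have e1 := expand_snd H.F 1 p.1 (qf Q p)
    rw [Finset.sum_range_one, pow_zero, pow_one, mul_one] at e1
    have e2 : cf H.F 0 p.1 = p.1 * ds (cf H.F 0) p.1 := by
      have := ds_expand (cf H.F 0) p.1
      have h0 : cf H.F 0 0 = 0 := H.F_zero
      rw [h0] at this
      simpa using this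
    obtain ⟨n, rfl⟩ : ∃ n, α = n + 1 := ⟨α - 1, by omega⟩
    rw [Nat.add_sub_cancel, fq, e1, e2]
    nth_rewrite 1 [hp]
    ring
  · filter_upwards [NormalForm.qf_chi_zero hQ] with χ h
    simp only [h]
    rw [← cf_F_zero_eq, ← cf_F_one_eq]
    rfl

lemma gam_chi (hQ : IsNormalCoord Q) (nf' : NormalForm Q' m α R' T' S') (H : Maps Q Q') :
    ∀ᶠ χ in 𝓝 (0 : ℂ), H.gam (0, χ, 0) ^ m = cj (H.J 1 1) ^ m := by
  rcases m.eq_zero_or_pos with rfl | hm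
  · exact Eventually.of_forall fun _ => by simp
  · filter_upwards [cf_conjGerm H.analytic_G 1,
      tendsto_cj.eventually (H.cf_G_one_const hQ nf' hm)] with χ h1 h2
    have : H.gam (0, χ, 0) = cf (conjGerm H.G) 1 χ := rfl
    rw [this, h1, h2, cf_G_one_eq]

/-- The class of a multiple of `τ ^ b * F(z, Q) ^ α`. -/
lemma toTrunc_lead_term (hQ : IsNormalCoord Q) (nf : NormalForm Q m α R T S)
    (nf' : NormalForm Q' m α R' T' S') (hα : 1 ≤ α) (H : Maps Q Q') {b : ℕ}
    {φ : ℂ × ℂ × ℂ → ℂ} (hφ : AnalyticAt ℂ φ 0) :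
    toTrunc α b (fun p => p.2.2 ^ b * H.fq p ^ α * (H.gam p ^ m * φ p)) =
      toTrunc α b fun p => p.1 ^ α * p.2.2 ^ b * (unit m α S H p.2.1 * φ (0, p.2.1, 0)) := by
  obtain ⟨u, v, hu, hv, h, h0⟩ := H.exists_lead hQ nf hα
  rw [toTrunc_lead_pow hu hv ((H.analytic_gam.fun_pow m).fun_mul hφ) h]
  refine toTrunc_congr ?_
  filter_upwards [eventually_comp_clm ((ContinuousLinearMap.fst ℂ ℂ ℂ).comp projChiTau) h0,
    eventually_comp_clm ((ContinuousLinearMap.fst ℂ ℂ ℂ).comp projChiTau)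
      (H.gam_chi hQ nf')] with p h1 h2
  change u (0, p.2.1, 0) = H.J 0 0 + 0 ^ m * 0 ^ (α - 1) * S (0, p.2.1) * H.J 0 1 at h1
  change H.gam (0, p.2.1, 0) ^ m = cj (H.J 1 1) ^ m at h2
  rw [h1, h2, unit]
  ring

end Maps

end

lemma top_coeff_eq_sum (a b : ℕ) (x : ℂ) (p : ℂ × ℂ × ℂ) :
    p.1 ^ a * p.2.2 ^ b * x = ∑ i ∈ Finset.range (a + 1), (∑ j ∈ Finset.range (b + 1),
      (if i = a ∧ j = b then x else 0) * p.2.2 ^ j) * p.1 ^ i := by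
  rw [Finset.sum_eq_single a, Finset.sum_eq_single b]
  · simp only [and_self, if_true]; ring
  · intro j _ hj; simp [hj]
  · intro h; simp at h
  · intro i _ hi; simp [hi]
  · intro h; simp at h

lemma top_coeff_eventually_const {a b : ℕ} (ha : 1 ≤ a) {φ : ℂ → ℂ} (hφ : AnalyticAt ℂ φ 0)
    {c d : ℂ × ℂ → ℂ} (hc : AnalyticAt ℂ c 0) (hd : AnalyticAt ℂ d 0)
    (h : toTrunc a b (fun p => p.1 ^ a * p.2.2 ^ b * φ p.2.1) =
      toTrunc a b fun p => c p.2 + d (p.1, p.2.2)) : φ =ᶠ[𝓝 0] fun _ => φ 0 := by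
  have hc' : AnalyticAt ℂ (fun p : ℂ × ℂ × ℂ => c p.2) 0 := hc.comp_clm projChiTau
  have hd' : AnalyticAt ℂ (fun p : ℂ × ℂ × ℂ => d (p.1, p.2.2)) 0 := hd.comp_clm projZTau
  have h1 : AnalyticAt ℂ (fun p : ℂ × ℂ × ℂ => p.1 ^ a * p.2.2 ^ b * φ p.2.1) 0 :=
    ((an_z.fun_pow a).fun_mul (an_tau.fun_pow b)).fun_mul hφ.comp_chi
  rw [← sub_eq_zero, ← toTrunc_sub h1 (hc'.fun_add hd'),
    toTrunc_eq_zero (h1.fun_sub (hc'.fun_add hd'))] at h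
  obtain ⟨u, v, hu, hv, h⟩ := h
  have := coeff_eventually_const (a := a) (b := b)
    (ψ := fun i j χ => if i = a ∧ j = b then φ χ else 0) hu hv hc (d := d) (by
      filter_upwards [h] with p hp
      rw [← top_coeff_eq_sum]
      linear_combination hp) (i := a) (j := b) ha le_rfl le_rfl
  simpa using this

section

variable {m α : ℕ} {R T R' T' : ℂ × ℂ × ℂ → ℂ} {S S' : ℂ × ℂ → ℂ}

namespace Maps

lemma fq_chi_zero (hQ : IsNormalCoord Q) (H : Maps Q Q') :
    ∀ᶠ χ in 𝓝 (0 : ℂ), H.fq (0, χ, 0) = 0 := by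
  filter_upwards [NormalForm.qf_chi_zero hQ] with χ h
  simp only [fq, h, H.F_zero]

lemma analytic_Fb_chi_tau (H : Maps Q Q') :
    AnalyticAt ℂ (fun p : ℂ × ℂ × ℂ => H.Fb p.2.1 p.2.2) 0 := H.analytic_Fb.comp_chi_tau

lemma analytic_Gb_chi_tau (H : Maps Q Q') :
    AnalyticAt ℂ (fun p : ℂ × ℂ × ℂ => H.Gb p.2.1 p.2.2) 0 := H.analytic_Gb.comp_chi_tau

lemma eventually_R'_eq (nf : NormalForm Q m α R T S) (nf' : NormalForm Q' m α R' T' S')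
    (H : Maps Q Q') : ∀ᶠ p : ℂ × ℂ × ℂ in 𝓝 0, R' (H.fq p, H.Fb p.2.1 p.2.2, H.Gb p.2.1 p.2.2) =
      H.fq p ^ α * S' (H.fq p, H.Fb p.2.1 p.2.2) +
        H.Gb p.2.1 p.2.2 * T' (H.fq p, H.Fb p.2.1 p.2.2, H.Gb p.2.1 p.2.2) :=
  ((H.analytic_fq nf).prod (H.analytic_Fb_chi_tau.prod H.analytic_Gb_chi_tau)).eventually_comp
    (by simp [H.fq_zero nf, H.Fb_zero, H.Gb_zero]) nf'.eq_R

lemma cf_Fb_zero_zero (H : Maps Q Q') : cf H.Fb 0 0 = 0 := H.Fb_zero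

lemma base_identity (hQ : IsNormalCoord Q) (hQ' : IsNormalCoord Q')
    (nf : NormalForm Q m α R T S) (nf' : NormalForm Q' m α R' T' S') (hα : 1 ≤ α)
    (H : Maps Q Q') : ∀ᶠ χ in 𝓝 (0 : ℂ),
      H.J 1 1 * S (0, χ) = unit m α S H χ * S' (0, cf H.Fb 0 χ) := by
  obtain ⟨c, d, hc, hd, h⟩ := H.exists_identity hQ hQ' nf nf' hα 0
  have hT := hasTriangularJacobians hQ hQ'
  have hfq := H.analytic_fq nf
  have hFb := H.analytic_Fb_chi_tau
  have hGb := H.analytic_Gb_chi_tau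
  have hS' : AnalyticAt ℂ (fun p : ℂ × ℂ × ℂ => S' (H.fq p, H.Fb p.2.1 p.2.2)) 0 :=
    nf'.analytic_S.comp_zero (hfq.prod hFb) (by simp [H.fq_zero nf, H.Fb_zero])
  have hT' : AnalyticAt ℂ (fun p : ℂ × ℂ × ℂ => T' (H.fq p, H.Fb p.2.1 p.2.2, H.Gb p.2.1 p.2.2)) 0 :=
    nf'.analytic_T.comp_zero (hfq.prod (hFb.prod hGb)) (by simp [H.fq_zero nf, H.Fb_zero, H.Gb_zero])
  have hS0 : AnalyticAt ℂ (fun χ : ℂ => S (0, χ)) 0 :=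
    nf.analytic_S.comp_clm (ContinuousLinearMap.inr ℂ ℂ ℂ)
  have hf0 := analyticAt_cf H.analytic_Fb 0
  have hS0' : AnalyticAt ℂ (fun χ : ℂ => S' (0, cf H.Fb 0 χ)) 0 :=
    nf'.analytic_S.comp_zero (analyticAt_const.prod hf0) (by simp [H.cf_Fb_zero_zero])
  have hU := (isBaseUnit_unit (Q' := Q') nf).isBase.analyticAt hT H
  have hl : AnalyticAt ℂ (fun χ => H.J 1 1 * S (0, χ)) 0 := analyticAt_const.fun_mul hS0
  have hr : AnalyticAt ℂ (fun χ => unit m α S H χ * S' (0, cf H.Fb 0 χ)) 0 := hU.fun_mul hS0'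
  have hc' : AnalyticAt ℂ (fun p : ℂ × ℂ × ℂ => c p.2) 0 := hc.comp_clm projChiTau
  have hd' : AnalyticAt ℂ (fun p : ℂ × ℂ × ℂ => d (p.1, p.2.2)) 0 := hd.comp_clm projZTau
  have t1 : toTrunc α 0 (fun p => R p *
        (∑ j ∈ Finset.range (0 + 1), cf H.G j p.1 * geomQuot j (qf Q p) p.2.2 +
          cf H.G (0 + 1) 0 * geomQuot (0 + 1) (qf Q p) p.2.2)) =
      toTrunc α 0 fun p => p.1 ^ α * p.2.2 ^ 0 * (H.J 1 1 * S (0, p.2.1)) := by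
    rw [← toTrunc_lead (φ := fun p => H.J 1 1 * S (p.1, p.2.1))
      (analyticAt_const.fun_mul nf.analytic_zS)]
    have h2 : AnalyticAt ℂ (fun p => T p * H.J 1 1) 0 := nf.analytic_T.fun_mul analyticAt_const
    have h3 : ∀ᶠ p in 𝓝 0, R p *
        (∑ j ∈ Finset.range (0 + 1), cf H.G j p.1 * geomQuot j (qf Q p) p.2.2 +
          cf H.G (0 + 1) 0 * geomQuot (0 + 1) (qf Q p) p.2.2) =
        p.1 ^ α * p.2.2 ^ 0 * (H.J 1 1 * S (p.1, p.2.1)) + p.2.2 ^ 1 * (T p * H.J 1 1) := by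
      filter_upwards [nf.eq_R] with p hp
      simp only [geomQuot, zero_add, Finset.sum_range_one, Finset.sum_range_zero, H.cf_G_one_eq]
      rw [hp]
      ring
    rw [toTrunc_congr h3, toTrunc_add (((an_z.fun_pow α).fun_mul (an_tau.fun_pow 0)).fun_mul
      (analyticAt_const.fun_mul nf.analytic_zS)) ((an_tau.fun_pow 1).fun_mul h2),
      toTrunc_tau_mul zero_lt_one h2, add_zero]
  have t2 : toTrunc α 0 (fun p => H.gam p ^ m * R' (H.fq p, H.Fb p.2.1 p.2.2, H.Gb p.2.1 p.2.2)) =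
      toTrunc α 0 fun p => p.1 ^ α * p.2.2 ^ 0 *
        (unit m α S H p.2.1 * S' (0, cf H.Fb 0 p.2.1)) := by
    have e1 : toTrunc α 0 (fun p => p.1 ^ α * p.2.2 ^ 0 *
        (unit m α S H p.2.1 * S' (0, cf H.Fb 0 p.2.1))) = toTrunc α 0 fun p =>
        p.1 ^ α * p.2.2 ^ 0 * (unit m α S H p.2.1 * S' (H.fq (0, p.2.1, 0), H.Fb p.2.1 0)) := by
      refine toTrunc_congr ?_
      filter_upwards [eventually_comp_clm ((ContinuousLinearMap.fst ℂ ℂ ℂ).comp projChiTau)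
        (H.fq_chi_zero hQ)] with p hp
      change H.fq (0, p.2.1, 0) = 0 at hp
      rw [hp]
      rfl
    rw [e1, ← H.toTrunc_lead_term hQ nf nf' hα hS']
    have h2 := ((H.analytic_gam.fun_pow m).fun_mul H.analytic_gam).fun_mul hT'
    refine toTrunc_eq_of_tau_pow zero_lt_one (v := fun p => H.gam p ^ m * H.gam p *
      T' (H.fq p, H.Fb p.2.1 p.2.2, H.Gb p.2.1 p.2.2)) ?_ h2 ?_
    · exact (H.analytic_gam.fun_pow m).fun_mul (nf'.analytic_R.comp_zero (hfq.prod (hFb.prod hGb))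
        (by simp [H.fq_zero nf, H.Fb_zero, H.Gb_zero]))
    · filter_upwards [H.eventually_R'_eq nf nf', H.eventually_Gb_eq hQ hQ'] with p h1 h2
      rw [h1]
      nth_rewrite 1 [h2]
      ring
  have hR' : AnalyticAt ℂ (fun p => H.gam p ^ m *
      R' (H.fq p, H.Fb p.2.1 p.2.2, H.Gb p.2.1 p.2.2)) 0 :=
    (H.analytic_gam.fun_pow m).fun_mul (nf'.analytic_R.comp_zero (hfq.prod (hFb.prod hGb))
        (by simp [H.fq_zero nf, H.Fb_zero, H.Gb_zero]))
  have hm : ∀ {φ : ℂ → ℂ}, AnalyticAt ℂ φ 0 →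
      AnalyticAt ℂ (fun p : ℂ × ℂ × ℂ => p.1 ^ α * p.2.2 ^ 0 * φ p.2.1) 0 := fun hφ =>
    ((an_z.fun_pow α).fun_mul (an_tau.fun_pow 0)).fun_mul hφ.comp_chi
  rw [t1, toTrunc_add (hR'.fun_add hc') hd', toTrunc_add hR' hc', t2] at h
  have t3 := top_coeff_eventually_const hα (hl.fun_sub hr) hc hd (b := 0) (by
    rw [toTrunc_add hc' hd', toTrunc_congr (g := fun p => p.1 ^ α * p.2.2 ^ 0 *
      (H.J 1 1 * S (0, p.2.1)) - p.1 ^ α * p.2.2 ^ 0 *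
        (unit m α S H p.2.1 * S' (0, cf H.Fb 0 p.2.1)))
      (Eventually.of_forall fun p => by ring), toTrunc_sub (hm hl) (hm hr)]
    linear_combination h)
  have hS0 : S (0, 0) = 0 := nf.S_zero
  have hS0' : S' (0, 0) = 0 := nf'.S_zero
  filter_upwards [t3] with χ hχ
  simp only [H.cf_Fb_zero_zero, hS0, hS0', mul_zero, sub_zero] at hχ
  exact sub_eq_zero.1 hχ

end Maps

end

section Ring

variable {A : Type*} [CommRing A] {z t x x' u v u' v' w : A} {a b : ℕ}

lemma mul_pow_mul_pow_eq_zero (hz : z ^ (a + 1) = 0) (ht : t ^ (b + 1) = 0)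
    (hx : x = z * u + t * v) (hx' : x' = z * u' + t * v') {i j : ℕ} (hij : a ≤ i + j + 1) :
    (z ^ 2 * t ^ b * w) * (x ^ i * x' ^ j) = 0 := by
  have h1 : t ^ b * x ^ i = t ^ b * (z * u) ^ i := by rw [hx, pow_add_mul_pow_eq ht]
  have h2 : t ^ b * x' ^ j = t ^ b * (z * u') ^ j := by rw [hx', pow_add_mul_pow_eq ht]
  have h3 : z ^ 2 * z ^ i * z ^ j = 0 := by
    rw [← pow_add, ← pow_add, show 2 + i + j = (a + 1) + (i + j + 1 - a) by omega, pow_add, hz,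
      zero_mul]
  calc (z ^ 2 * t ^ b * w) * (x ^ i * x' ^ j) = z ^ 2 * w * x' ^ j * (t ^ b * x ^ i) := by ring
    _ = z ^ 2 * w * (z * u) ^ i * (t ^ b * x' ^ j) := by rw [h1]; ring
    _ = (z ^ 2 * z ^ i * z ^ j) * (w * u ^ i * u' ^ j * t ^ b) := by rw [h2]; ring
    _ = 0 := by rw [h3, zero_mul]

lemma pow_eq_pow_of_sub_eq (hz : z ^ (a + 1) = 0) (ht : t ^ (b + 1) = 0)
    (hx : x = z * u + t * v) (hx' : x' = z * u' + t * v') (h : x - x' = z ^ 2 * t ^ b * w) :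
    x ^ a = x' ^ a := by
  rw [← sub_eq_zero, ← geom_sum₂_mul, Finset.sum_mul]
  refine Finset.sum_eq_zero fun i hi => ?_
  rw [h, mul_comm]
  exact mul_pow_mul_pow_eq_zero hz ht hx hx' (by have := Finset.mem_range.1 hi; omega)

end Ring

section

variable {m α : ℕ} {R T R' T' : ℂ × ℂ × ℂ → ℂ} {S S' : ℂ × ℂ → ℂ}

namespace Maps

/-- The part of `F̄(χ, τ)` of order less than `k` in `τ`. -/
def lowFb (k : ℕ) (H : Maps Q Q') (p : ℂ × ℂ × ℂ) : ℂ :=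
  ∑ j ∈ Finset.range k, cf H.Fb j p.2.1 * p.2.2 ^ j

/-- The part of `F(z, Q(z, χ, τ))` relevant in order `k`. -/
def lowF (k : ℕ) (H : Maps Q Q') (p : ℂ × ℂ × ℂ) : ℂ :=
  ∑ j ∈ Finset.range k, cf H.F j p.1 * qf Q p ^ j +
    (cf H.F k 0 + tc 1 (cf H.F k) * p.1) * qf Q p ^ k + cf H.F (k + 1) 0 * qf Q p ^ (k + 1)

lemma analytic_lowFb (k : ℕ) (H : Maps Q Q') : AnalyticAt ℂ (H.lowFb k) 0 :=
  Finset.analyticAt_fun_sum _ fun j _ =>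
    (analyticAt_cf H.analytic_Fb j).comp_chi.fun_mul (an_tau.fun_pow j)

lemma lowFb_chi {k : ℕ} (hk : 1 ≤ k) (H : Maps Q Q') (χ : ℂ) :
    H.lowFb k (0, χ, 0) = cf H.Fb 0 χ := by
  obtain ⟨l, rfl⟩ : ∃ l, k = l + 1 := ⟨k - 1, by omega⟩
  simp [lowFb, Finset.sum_range_succ']

lemma lowFb_zero {k : ℕ} (hk : 1 ≤ k) (H : Maps Q Q') : H.lowFb k 0 = 0 :=
  (H.lowFb_chi hk 0).trans H.cf_Fb_zero_zero

lemma Fb_eq_lowFb_add (k : ℕ) (H : Maps Q Q') (p : ℂ × ℂ × ℂ) :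
    H.Fb p.2.1 p.2.2 = H.lowFb k p + p.2.2 ^ k * rem H.Fb k p.2 :=
  expand_snd H.Fb k p.2.1 p.2.2

lemma analytic_lowF (nf : NormalForm Q m α R T S) (k : ℕ) (H : Maps Q Q') :
    AnalyticAt ℂ (H.lowF k) 0 :=
  ((Finset.analyticAt_fun_sum _ fun j _ => (analyticAt_cf H.analytic_F j).comp_z.fun_mul
    (nf.analytic_qf.fun_pow j)).fun_add ((analyticAt_const.fun_add
      (analyticAt_const.fun_mul an_z)).fun_mul (nf.analytic_qf.fun_pow k))).fun_add
    (analyticAt_const.fun_mul (nf.analytic_qf.fun_pow (k + 1)))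

lemma lowF_chi (hQ : IsNormalCoord Q) {k : ℕ} (hk : 1 ≤ k) (H : Maps Q Q') :
    ∀ᶠ χ in 𝓝 (0 : ℂ), H.lowF k (0, χ, 0) = 0 := by
  obtain ⟨l, rfl⟩ : ∃ l, k = l + 1 := ⟨k - 1, by omega⟩
  filter_upwards [NormalForm.qf_chi_zero hQ] with χ h
  have h0 : cf H.F 0 0 = 0 := H.F_zero
  simp [lowF, h, Finset.sum_range_succ', h0]

lemma lowF_zero (hQ : IsNormalCoord Q) {k : ℕ} (hk : 1 ≤ k) (H : Maps Q Q') : H.lowF k 0 = 0 :=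
  (H.lowF_chi hQ hk).self_of_nhds

lemma exists_fq_sub_lowF (nf : NormalForm Q m α R T S) (hα : 1 ≤ α) {k : ℕ} (hk : 1 ≤ k)
    (H : Maps Q Q') : ∃ w, toTrunc α k H.fq - toTrunc α k (H.lowF k) =
      zT α k ^ 2 * tT α k ^ k * w := by
  have hq := nf.analytic_qf
  have a1 : AnalyticAt ℂ (fun p : ℂ × ℂ × ℂ => ds^[2] (cf H.F k) p.1) 0 :=
    ((analyticAt_cf H.analytic_F k).iterate_ds 2).comp_z
  have a2 : AnalyticAt ℂ (fun p : ℂ × ℂ × ℂ => ds (cf H.F (k + 1)) p.1) 0 :=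
    (analyticAt_cf H.analytic_F (k + 1)).ds.comp_z
  have a3 : AnalyticAt ℂ (fun p : ℂ × ℂ × ℂ => rem H.F (k + 2) (p.1, qf Q p)) 0 :=
    (analyticAt_rem H.analytic_F (k + 2)).comp_zero (an_z.prod hq) (by simp [nf.qf_zero])
  have e1 : toTrunc α k H.fq - toTrunc α k (H.lowF k) = toTrunc α k fun p =>
      p.1 ^ 2 * ds^[2] (cf H.F k) p.1 * qf Q p ^ k +
        p.1 * ds (cf H.F (k + 1)) p.1 * qf Q p ^ (k + 1) +
        qf Q p ^ (k + 2) * rem H.F (k + 2) (p.1, qf Q p) := by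
    rw [← toTrunc_sub (H.analytic_fq nf) (H.analytic_lowF nf k)]
    refine toTrunc_congr (Eventually.of_forall fun p => ?_)
    have e1 := expand_snd H.F (k + 2) p.1 (qf Q p)
    have e2 := taylor_expand (cf H.F k) 2 p.1
    have e3 := ds_expand (cf H.F (k + 1)) p.1
    simp only [Finset.sum_range_succ, Finset.sum_range_zero, tc_zero, pow_zero, mul_one, zero_add,
      pow_one] at e1 e2
    simp only [fq, lowF]
    linear_combination e1 + qf Q p ^ k * e2 + qf Q p ^ (k + 1) * e3
  have hs := zT_sq (b := k) hα
  have hp := nf.inPow_qf k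
  have hz : zT α k * zT α k ^ α = 0 := by rw [← pow_succ', zT_pow]
  have p1 := InPow.mul_pow hs hp hp (k - 1)
  have p2 := InPow.mul_pow hs hp hp k
  have p3 := InPow.mul_pow hs hp hp (k + 1)
  rw [← pow_succ', zero_add] at p1 p2 p3
  have p2' := p2.mul_eq_zero tT_pow hz
  have p3' := p3.eq_zero tT_pow
  obtain ⟨u, v, huv⟩ := p1
  rw [Nat.sub_add_cancel hk] at huv
  have b1 := (an_z.fun_pow 2).fun_mul a1
  have b2 := an_z.fun_mul a2
  rw [e1, toTrunc_add ((b1.fun_mul (hq.fun_pow k)).fun_add (b2.fun_mul (hq.fun_pow (k + 1))))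
    ((hq.fun_pow (k + 2)).fun_mul a3),
    toTrunc_add (b1.fun_mul (hq.fun_pow k)) (b2.fun_mul (hq.fun_pow (k + 1))),
    toTrunc_mul b1 (hq.fun_pow k), toTrunc_mul b2 (hq.fun_pow (k + 1)),
    toTrunc_mul (hq.fun_pow (k + 2)) a3, toTrunc_pow hq, toTrunc_pow hq, toTrunc_pow hq,
    toTrunc_mul an_z a2, toTrunc_mul (an_z.fun_pow 2) a1, toTrunc_pow an_z]
  change ∃ w, zT α k ^ 2 * _ * _ + zT α k * _ * _ + _ = _
  refine ⟨toTrunc α k (fun p : ℂ × ℂ × ℂ => ds^[2] (cf H.F k) p.1) * u, ?_⟩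
  rw [huv, p3']
  linear_combination toTrunc α k (fun p => ds (cf H.F (k + 1)) p.1) * p2' +
    zT α k * toTrunc α k (fun p => ds^[2] (cf H.F k) p.1) * tT α k ^ (k - 1) * v * hz

lemma toTrunc_inMax {f : ℂ × ℂ × ℂ → ℂ} (hf : InMax f) (a b : ℕ) :
    ∃ u v, toTrunc a b f = zT a b * u + tT a b * v := by
  obtain ⟨u, v, hu, hv, h⟩ := hf
  exact ⟨_, _, by rw [toTrunc_congr h, toTrunc_add (an_z.fun_mul hu) (an_tau.fun_mul hv),
    toTrunc_mul an_z hu, toTrunc_mul an_tau hv]; rfl⟩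

lemma inMax_lowF (hQ : IsNormalCoord Q) (nf : NormalForm Q m α R T S) {k : ℕ} (hk : 1 ≤ k)
    (H : Maps Q Q') : InMax (H.lowF k) := InMax.of_zero (H.analytic_lowF nf k) (H.lowF_chi hQ hk)

/-- The mapping identity in order `k`, with the dependence on `F̄_k` made explicit. -/
lemma toTrunc_right (hQ : IsNormalCoord Q) (hQ' : IsNormalCoord Q')
    (nf : NormalForm Q m α R T S) (nf' : NormalForm Q' m α R' T' S') (hα : 1 ≤ α) {k : ℕ}
    (hk : 1 ≤ k) {Ψ : ℂ × ℂ × ℂ → ℂ} (hΨ : AnalyticAt ℂ Ψ 0)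
    (hd : ∀ᶠ q : ℂ × ℂ × ℂ in 𝓝 0, S' (q.2.2, q.2.1 + q.1) = S' (q.2.2, q.2.1) + q.1 * Ψ q)
    (H : Maps Q Q') :
    toTrunc α k (fun p => H.gam p ^ m * R' (H.fq p, H.Fb p.2.1 p.2.2, H.Gb p.2.1 p.2.2)) =
      toTrunc α k (fun p => H.gam p ^ m * (H.lowF k p ^ α * S' (H.lowF k p, H.lowFb k p)) +
        H.gam p ^ m * H.Gb p.2.1 p.2.2 * T' (H.lowF k p, H.lowFb k p, H.Gb p.2.1 p.2.2)) +
      toTrunc α k fun p => p.1 ^ α * p.2.2 ^ k *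
        (unit m α S H p.2.1 * (Ψ (0, cf H.Fb 0 p.2.1, 0) * cf H.Fb k p.2.1)) := by
  have hA := H.analytic_fq nf
  have hAl := H.analytic_lowF nf k
  have hFl := H.analytic_lowFb k
  have hFb := H.analytic_Fb_chi_tau
  have hGb := H.analytic_Gb_chi_tau
  have hW := H.analytic_gam.fun_pow m
  have hA0 := H.fq_zero nf
  have hAl0 := H.lowF_zero hQ hk
  have hFl0 := H.lowFb_zero hk
  have hr : AnalyticAt ℂ (fun p : ℂ × ℂ × ℂ => rem H.Fb k p.2) 0 :=
    (analyticAt_rem H.analytic_Fb k).comp_clm projChiTau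
  have hre := (an_tau.fun_pow k).fun_mul hr
  have hξ : AnalyticAt ℂ (fun p => (p.2.2 ^ k * rem H.Fb k p.2, H.lowFb k p, H.fq p)) 0 :=
    hre.prod (hFl.prod hA)
  have hξ0 : (fun p => (p.2.2 ^ k * rem H.Fb k p.2, H.lowFb k p, H.fq p)) 0 = 0 := by
    simp [hA0, hFl0, show k ≠ 0 by omega]
  have hφ := hr.fun_mul (hΨ.comp_zero hξ hξ0)
  obtain ⟨w, hw⟩ := H.exists_fq_sub_lowF nf hα hk
  obtain ⟨u, v, huv⟩ := toTrunc_inMax (InMax.of_zero hA (H.fq_chi_zero hQ)) α k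
  obtain ⟨u', v', huv'⟩ := toTrunc_inMax (H.inMax_lowF hQ nf hk) α k
  have hpow := pow_eq_pow_of_sub_eq zT_pow tT_pow huv huv' hw
  have hkill : toTrunc α k H.fq ^ α * (toTrunc α k H.fq - toTrunc α k (H.lowF k)) = 0 := by
    have := mul_pow_mul_pow_eq_zero (i := α) (j := 0) (w := w) zT_pow tT_pow huv huv' (by omega)
    rw [hw]
    linear_combination this
  have hTk : toTrunc α k (fun p => H.Gb p.2.1 p.2.2) = tT α k * toTrunc α k H.gam := by
    rw [toTrunc_congr (H.eventually_Gb_eq hQ hQ'), toTrunc_mul an_tau H.analytic_gam]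
    rfl
  have hTkill : tT α k * (toTrunc α k H.fq - toTrunc α k (H.lowF k)) = 0 := by
    rw [hw]
    linear_combination zT α k ^ 2 * w * (tT_pow : tT α k ^ (k + 1) = 0)
  have hTkill' : tT α k * (toTrunc α k (fun p => H.Fb p.2.1 p.2.2) - toTrunc α k (H.lowFb k)) = 0 := by
    rw [toTrunc_congr (Eventually.of_forall (H.Fb_eq_lowFb_add k)), toTrunc_add hFl hre,
      toTrunc_mul (an_tau.fun_pow k) hr, toTrunc_pow an_tau]
    change tT α k * (_ + tT α k ^ k * _ - _) = 0
    linear_combination toTrunc α k (fun p => rem H.Fb k p.2) * (tT_pow : tT α k ^ (k + 1) = 0)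
  have hWA := hW.fun_mul (hA.fun_pow α)
  have hWG := hW.fun_mul hGb
  have s1 := toTrunc_subst (a := α) (b := k) (Φ := S') (w := fun p => H.gam p ^ m * H.fq p ^ α)
    nf'.analytic_S hA hAl hFl hWA hA0 hAl0 hFl0 (by
      rw [toTrunc_mul hW (hA.fun_pow α), toTrunc_pow hA, mul_assoc, hkill, mul_zero])
  have s2 := toTrunc_subst (a := α) (b := k) (Φ := T')
    (w := fun p => H.gam p ^ m * H.Gb p.2.1 p.2.2)
    (y := fun p => (H.Fb p.2.1 p.2.2, H.Gb p.2.1 p.2.2)) nf'.analytic_T hA hAl (hFb.prod hGb)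
    hWG hA0 hAl0 (by simp [H.Fb_zero, H.Gb_zero]) (by
      rw [toTrunc_mul hW hGb, hTk]
      linear_combination toTrunc α k (fun p => H.gam p ^ m) * toTrunc α k H.gam * hTkill)
  have hT2 : AnalyticAt ℂ (fun q : ℂ × ℂ × ℂ => T' (q.2.1, q.1, q.2.2)) 0 :=
    nf'.analytic_T.comp_clm (((ContinuousLinearMap.fst ℂ ℂ ℂ).comp projChiTau).prod projZTau)
  have s3 := toTrunc_subst (a := α) (b := k) (Φ := fun q : ℂ × ℂ × ℂ => T' (q.2.1, q.1, q.2.2))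
    (w := fun p => H.gam p ^ m * H.Gb p.2.1 p.2.2)
    (y := fun p => (H.lowF k p, H.Gb p.2.1 p.2.2)) hT2 hFb hFl (hAl.prod hGb)
    hWG H.Fb_zero hFl0 (by simp [hAl0, H.Gb_zero]) (by
      rw [toTrunc_mul hW hGb, hTk]
      linear_combination toTrunc α k (fun p => H.gam p ^ m) * toTrunc α k H.gam * hTkill')
  have hSl : AnalyticAt ℂ (fun p => S' (H.lowF k p, H.lowFb k p)) 0 :=
    nf'.analytic_S.comp_zero (hAl.prod hFl) (by simp [hAl0, hFl0])
  have hSA : AnalyticAt ℂ (fun p => S' (H.fq p, H.lowFb k p)) 0 :=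
    nf'.analytic_S.comp_zero (hA.prod hFl) (by simp [hA0, hFl0])
  have hTA : AnalyticAt ℂ (fun p => T' (H.fq p, H.Fb p.2.1 p.2.2, H.Gb p.2.1 p.2.2)) 0 :=
    nf'.analytic_T.comp_zero (hA.prod (hFb.prod hGb)) (by simp [hA0, H.Fb_zero, H.Gb_zero])
  have hTl : AnalyticAt ℂ (fun p => T' (H.lowF k p, H.lowFb k p, H.Gb p.2.1 p.2.2)) 0 :=
    nf'.analytic_T.comp_zero (hAl.prod (hFl.prod hGb)) (by simp [hAl0, hFl0, H.Gb_zero])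
  have s4 := H.toTrunc_lead_term hQ nf nf' hα (b := k) hφ
  have s5 : toTrunc α k (fun p => p.1 ^ α * p.2.2 ^ k *
        (unit m α S H p.2.1 * (Ψ (0, cf H.Fb 0 p.2.1, 0) * cf H.Fb k p.2.1))) =
      toTrunc α k fun p => p.1 ^ α * p.2.2 ^ k * (unit m α S H p.2.1 *
        (rem H.Fb k (p.2.1, 0) * Ψ (0 ^ k * rem H.Fb k (p.2.1, 0), H.lowFb k (0, p.2.1, 0),
          H.fq (0, p.2.1, 0)))) := by
    refine toTrunc_congr ?_
    filter_upwards [eventually_comp_clm ((ContinuousLinearMap.fst ℂ ℂ ℂ).comp projChiTau)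
      (H.fq_chi_zero hQ)] with p hp
    change H.fq (0, p.2.1, 0) = 0 at hp
    rw [hp, H.lowFb_chi hk, zero_pow (by omega), zero_mul]
    change _ = _ * (_ * (cf H.Fb k p.2.1 * _))
    ring
  rw [s5, ← s4]
  have hlead := ((an_tau.fun_pow k).fun_mul (hA.fun_pow α)).fun_mul (hW.fun_mul hφ)
  rw [toTrunc_congr (g := fun p => (H.gam p ^ m * H.fq p ^ α * S' (H.fq p, H.lowFb k p) +
      H.gam p ^ m * H.Gb p.2.1 p.2.2 * T' (H.fq p, H.Fb p.2.1 p.2.2, H.Gb p.2.1 p.2.2)) +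
      p.2.2 ^ k * H.fq p ^ α * (H.gam p ^ m * (rem H.Fb k p.2 *
        Ψ (p.2.2 ^ k * rem H.Fb k p.2, H.lowFb k p, H.fq p)))),
    toTrunc_add ((hWA.fun_mul hSA).fun_add (hWG.fun_mul hTA)) hlead,
    toTrunc_add (hWA.fun_mul hSA) (hWG.fun_mul hTA), s1, s2, s3,
    toTrunc_add (hW.fun_mul ((hAl.fun_pow α).fun_mul hSl)) (hWG.fun_mul hTl),
    toTrunc_mul hWA hSl, toTrunc_mul hW (hA.fun_pow α), toTrunc_pow hA, hpow,
    toTrunc_mul hW ((hAl.fun_pow α).fun_mul hSl), toTrunc_mul (hAl.fun_pow α) hSl, toTrunc_pow hAl,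
    mul_assoc]
  filter_upwards [H.eventually_R'_eq nf nf', hξ.eventually_comp hξ0 hd] with p h1 h2
  rw [h1]
  rw [← H.Fb_eq_lowFb_add k p] at h2
  linear_combination H.gam p ^ m * H.fq p ^ α * h2

end Maps

end

section

variable {m α k : ℕ} {R T R' T' : ℂ × ℂ × ℂ → ℂ} {S S' : ℂ × ℂ → ℂ}

lemma IsBase.cf_Fb {j : ℕ} (h : IsBase fun H : Maps Q Q' => cf H.F j) :
    IsBase fun H : Maps Q Q' => cf H.Fb j :=
  h.bar.congr fun H => (_root_.cf_conjGerm H.analytic_F j).symm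

lemma JetPoly.cf_Fb {K j : ℕ} (h : JetPoly K fun H : Maps Q Q' => cf H.F j) :
    JetPoly K fun H : Maps Q Q' => cf H.Fb j := .cf_conjGerm (fun H => H.analytic_F) h

lemma JetPoly.cf_Gb {K j : ℕ} (h : JetPoly K fun H : Maps Q Q' => cf H.G j) :
    JetPoly K fun H : Maps Q Q' => cf H.Gb j := .cf_conjGerm (fun H => H.analytic_G) h

lemma InJet.lowFb (hT : HasTriangularJacobians Q Q') {K a b : ℕ}
    (hf : ∀ j < k, JetPoly K fun H : Maps Q Q' => cf H.F j) :
    InJet K a b fun H : Maps Q Q' => H.lowFb k :=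
  InJet.sum _ fun j hj => (InJet.of_chi hT (hf j (Finset.mem_range.1 hj)).cf_Fb).mul (InJet.tau.pow j)

lemma InJet.lowF (hT : HasTriangularJacobians Q Q') (nf : NormalForm Q m α R T S) {a b : ℕ}
    (hf : ∀ j < k, JetPoly (k + 1) fun H : Maps Q Q' => cf H.F j) :
    InJet (k + 1) a b fun H : Maps Q Q' => H.lowF k := by
  have hq := InJet.of_analytic (K := k + 1) (a := a) (b := b) hT nf.analytic_qf
  refine ((InJet.sum _ fun j hj => (InJet.of_z hT (fun H => analyticAt_cf H.analytic_F j)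
    fun i _ => (hf j (Finset.mem_range.1 hj)).tc hT i).mul (hq.pow j)).add
    (((InJet.of_chi hT (JetPoly.tc_cf_F (i := 0) (j := k) (by omega))).add
      ((InJet.of_chi hT (JetPoly.tc_cf_F (i := 1) (j := k) (by omega))).mul .z)).mul
        (hq.pow k))).add
    ((InJet.of_chi hT (JetPoly.tc_cf_F (i := 0) (j := k + 1) (by omega))).mul (hq.pow (k + 1)))

lemma InJet.gam_pow (hQ : IsNormalCoord Q) (hQ' : IsNormalCoord Q')
    (nf' : NormalForm Q' m α R' T' S') (hk : 1 ≤ k) {a : ℕ}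
    (hb : IsBase fun H : Maps Q Q' => cf H.F 0)
    (hf : ∀ j < k, JetPoly (k + 1) fun H : Maps Q Q' => cf H.F j) :
    InJet (k + 1) a k fun (H : Maps Q Q') p => H.gam p ^ m := by
  have hT := Maps.hasTriangularJacobians hQ hQ'
  rcases m.eq_zero_or_pos with rfl | hm
  · simpa using InJet.const 1
  · refine InJet.pow ?_ m
    refine InJet.of_chi_tau hT (e := fun H χ τ => rem H.Gb 1 (χ, τ))
      (fun H => analyticAt_rem H.analytic_Gb 1) fun j hj => ?_
    exact (JetPoly.cf_G hQ hQ' nf' (l := k - 1) (K := k + 1) (n := j + 1) (by omega) (by omega) hb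
      fun i hi => hf i (by omega)).cf_Gb

lemma InJet.left (hQ : IsNormalCoord Q) (hQ' : IsNormalCoord Q') (nf : NormalForm Q m α R T S)
    (nf' : NormalForm Q' m α R' T' S') (hk : 1 ≤ k) {a : ℕ}
    (hb : IsBase fun H : Maps Q Q' => cf H.F 0)
    (hf : ∀ j < k, JetPoly (k + 1) fun H : Maps Q Q' => cf H.F j) :
    InJet (k + 1) a k fun (H : Maps Q Q') p => R p *
        (∑ j ∈ Finset.range (k + 1), cf H.G j p.1 * _root_.geomQuot j (qf Q p) p.2.2 +
          cf H.G (k + 1) 0 * _root_.geomQuot (k + 1) (qf Q p) p.2.2) := by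
  have hT := Maps.hasTriangularJacobians hQ hQ'
  have hq := InJet.of_analytic (K := k + 1) (a := a) (b := k) hT nf.analytic_qf
  refine (InJet.of_analytic hT nf.analytic_R).mul ((InJet.sum _ fun j hj =>
    (InJet.of_z hT (fun H => analyticAt_cf H.analytic_G j) fun i _ => JetPoly.tc hT ?_ i).mul
      (hq.geomQuot .tau j)).add
    ((InJet.of_chi hT (JetPoly.tc_cf_G (i := 0) (j := k + 1) (by omega))).mul
      (hq.geomQuot .tau (k + 1))))
  have := Finset.mem_range.1 hj
  exact JetPoly.cf_G hQ hQ' nf' (l := k - 1) (by omega) (by omega) hb fun i hi => hf i (by omega)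

lemma InJet.right (hQ : IsNormalCoord Q) (hQ' : IsNormalCoord Q') (nf : NormalForm Q m α R T S)
    (nf' : NormalForm Q' m α R' T' S') (hk : 1 ≤ k)
    (hb : IsBase fun H : Maps Q Q' => cf H.F 0)
    (hf : ∀ j < k, JetPoly (k + 1) fun H : Maps Q Q' => cf H.F j) :
    InJet (k + 1) α k fun (H : Maps Q Q') p =>
      H.gam p ^ m * (H.lowF k p ^ α * S' (H.lowF k p, H.lowFb k p)) +
        H.gam p ^ m * H.Gb p.2.1 p.2.2 * T' (H.lowF k p, H.lowFb k p, H.Gb p.2.1 p.2.2) := by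
  have hT := Maps.hasTriangularJacobians hQ hQ'
  have hΓ := InJet.gam_pow (a := α) hQ hQ' nf' hk hb hf
  have hA := InJet.lowF (a := α) (b := k) hT nf hf
  have hGb : InJet (k + 1) α k fun (H : Maps Q Q') p => H.Gb p.2.1 p.2.2 :=
    InJet.of_chi_tau hT (fun H => H.analytic_Gb) fun j hj => (JetPoly.cf_G hQ hQ' nf'
      (l := k - 1) (by omega) (by omega) hb fun i hi => hf i (by omega)).cf_Gb
  have hl : InJet (k + 1) α k fun (H : Maps Q Q') p => H.lowFb k p - cf H.Fb 0 p.2.1 :=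
    (InJet.lowFb hT hf).sub (.of_chi hT (.base hb.cf_Fb))
  have hs : Substitutable (k + 1) α k fun (H : Maps Q Q') p =>
      (H.lowF k p, (H.Gb p.2.1 p.2.2, (H.lowFb k p - cf H.Fb 0 p.2.1, cf H.Fb 0 p.2.1))) := by
    refine (((Substitutable.of_chi hT hb.cf_Fb fun H => H.cf_Fb_zero_zero).cons hl
      fun H => ?_).cons hGb fun H => ?_).cons hA fun H => H.inMax_lowF hQ nf hk
    · refine InMax.of_zero (hl.1 H) (Eventually.of_forall fun χ => ?_)
      simp only [H.lowFb_chi hk, sub_self]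
    · exact InMax.of_zero (hGb.1 H) (H.Gb_chi_zero hQ hQ')
  let e1 : ℂ × ℂ × ℂ × ℂ →L[ℂ] ℂ := ContinuousLinearMap.fst ℂ ℂ (ℂ × ℂ × ℂ)
  let e2 : ℂ × ℂ × ℂ × ℂ →L[ℂ] ℂ × ℂ × ℂ := ContinuousLinearMap.snd ℂ ℂ (ℂ × ℂ × ℂ)
  let e3 : ℂ × ℂ × ℂ × ℂ →L[ℂ] ℂ := (ContinuousLinearMap.fst ℂ ℂ ℂ +
    ContinuousLinearMap.snd ℂ ℂ ℂ).comp ((ContinuousLinearMap.snd ℂ ℂ (ℂ × ℂ)).comp e2)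
  let e4 : ℂ × ℂ × ℂ × ℂ →L[ℂ] ℂ := (ContinuousLinearMap.fst ℂ ℂ (ℂ × ℂ)).comp e2
  have hS := hs.comp _ (nf'.analytic_S.comp_clm (e1.prod e3))
  have hT' := hs.comp _ (nf'.analytic_T.comp_clm (e1.prod (e3.prod e4)))
  have e : ∀ (H : Maps Q Q') (p : ℂ × ℂ × ℂ), e3 (H.lowF k p, (H.Gb p.2.1 p.2.2,
      (H.lowFb k p - cf H.Fb 0 p.2.1, cf H.Fb 0 p.2.1))) = H.lowFb k p :=
    fun H p => sub_add_cancel _ _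
  simp only [ContinuousLinearMap.prod_apply, e] at hS hT'
  exact (hΓ.mul ((hA.pow α).mul hS)).add ((hΓ.mul hGb).mul hT')

/-- The product of `F̄_k` with a function depending on the `1`-jet is jet-polynomial up to its
value at `0`. -/
lemma JetPoly.top (hQ : IsNormalCoord Q) (hQ' : IsNormalCoord Q') (nf : NormalForm Q m α R T S)
    (nf' : NormalForm Q' m α R' T' S') (hα : 1 ≤ α) (hk : 1 ≤ k)
    (hb : IsBase fun H : Maps Q Q' => cf H.F 0)
    (hf : ∀ j < k, JetPoly (k + 1) fun H : Maps Q Q' => cf H.F j)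
    {Ψ : ℂ × ℂ × ℂ → ℂ} (hΨ : AnalyticAt ℂ Ψ 0)
    (hd : ∀ᶠ q : ℂ × ℂ × ℂ in 𝓝 0, S' (q.2.2, q.2.1 + q.1) = S' (q.2.2, q.2.1) + q.1 * Ψ q)
    {V : Maps Q Q' → ℂ → ℂ} (hV : ∀ H χ, V H χ =
      Maps.unit m α S H χ * (Ψ (0, cf H.Fb 0 χ, 0) * cf H.Fb k χ)) :
    JetPoly (k + 1) fun H χ => V H χ - V H 0 := by
  have hT := Maps.hasTriangularJacobians hQ hQ'
  have hL := InJet.left (a := α) hQ hQ' nf nf' hk hb hf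
  have hR := InJet.right hQ hQ' nf nf' hk hb hf
  have hVa : ∀ H, AnalyticAt ℂ (V H) 0 := fun H => by
    rw [funext (hV H)]
    refine ((Maps.isBaseUnit_unit nf).isBase.analyticAt hT H).fun_mul (AnalyticAt.fun_mul ?_
      (analyticAt_cf H.analytic_Fb k))
    exact hΨ.comp_zero (analyticAt_const.prod ((analyticAt_cf H.analytic_Fb 0).prod
      analyticAt_const)) (by simp [H.cf_Fb_zero_zero])
  choose c d hc hd' h using fun H : Maps Q Q' => H.exists_identity hQ hQ' nf nf' hα k
  have hfin := (hL.sub hR).coeff (a := α) (b := k)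
    (φ := fun i j H χ => if i = α ∧ j = k then V H χ else 0) (c := c) (d := d) (i := α) (j := k)
    (fun i j H => ?_) hc hd' (fun H => ?_) hα le_rfl le_rfl
  · simpa using hfin
  · by_cases hij : i = α ∧ j = k
    · simpa [hij] using hVa H
    · simpa [hij] using analyticAt_const
  · have hc' : AnalyticAt ℂ (fun p : ℂ × ℂ × ℂ => c H p.2) 0 := (hc H).comp_clm projChiTau
    have hd'' : AnalyticAt ℂ (fun p : ℂ × ℂ × ℂ => d H (p.1, p.2.2)) 0 :=
      (hd' H).comp_clm projZTau
    have htop : AnalyticAt ℂ (fun p : ℂ × ℂ × ℂ => p.1 ^ α * p.2.2 ^ k * V H p.2.1) 0 :=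
      ((an_z.fun_pow α).fun_mul (an_tau.fun_pow k)).fun_mul (hVa H).comp_chi
    have hR' : AnalyticAt ℂ (fun p => H.gam p ^ m *
        R' (H.fq p, H.Fb p.2.1 p.2.2, H.Gb p.2.1 p.2.2)) 0 :=
      (H.analytic_gam.fun_pow m).fun_mul (nf'.analytic_R.comp_zero ((H.analytic_fq nf).prod
        (H.analytic_Fb_chi_tau.prod H.analytic_Gb_chi_tau))
          (by simp [H.fq_zero nf, H.Fb_zero, H.Gb_zero]))
    have h1 := h H
    have h2 := H.toTrunc_right hQ hQ' nf nf' hα hk hΨ hd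
    simp only [← hV] at h2
    simp only [← top_coeff_eq_sum]
    rw [toTrunc_sub (hL.1 H) (hR.1 H), h1, toTrunc_add (hR'.fun_add hc') hd'',
      toTrunc_add hR' hc', h2, toTrunc_add (htop.fun_add hc') hd'', toTrunc_add htop hc']
    ring

end

section

variable {m α : ℕ} {R T R' T' : ℂ × ℂ × ℂ → ℂ} {S S' : ℂ × ℂ → ℂ}

lemma eventuallyEq_of_pow_mul_eq {β : ℕ} {f g : ℂ → ℂ} (hf : AnalyticAt ℂ f 0)
    (hg : AnalyticAt ℂ g 0) (h : ∀ᶠ z in 𝓝 (0 : ℂ), z ^ β * f z = z ^ β * g z) :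
    f =ᶠ[𝓝 0] g := by
  have := eventually_eq_zero_of_pow_smul (hf.sub hg) (ContinuousLinearMap.id ℂ ℂ) 1 rfl (m := β) (by
    filter_upwards [h] with z hz
    simp [mul_sub, hz])
  filter_upwards [this] with z hz
  exact sub_eq_zero.1 hz

lemma eq_of_pow_mul_eq {β γ : ℕ} {f g : ℂ → ℂ} (hf : AnalyticAt ℂ f 0) (hg : AnalyticAt ℂ g 0)
    (hf0 : f 0 ≠ 0) (hg0 : g 0 ≠ 0) (h : ∀ᶠ z in 𝓝 (0 : ℂ), z ^ β * f z = z ^ γ * g z) :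
    β = γ := by
  have h1 : analyticOrderAt (fun z => z ^ β * f z) 0 = β :=
    ((analyticAt_id.pow β).mul hf).analyticOrderAt_eq_natCast.2
      ⟨f, hf, hf0, by simp⟩
  have h2 : analyticOrderAt (fun z => z ^ γ * g z) 0 = γ :=
    ((analyticAt_id.pow γ).mul hg).analyticOrderAt_eq_natCast.2
      ⟨g, hg, hg0, by simp⟩
  rw [analyticOrderAt_congr h, h2] at h1
  exact_mod_cast h1.symm

/-- Two germs with equal `β`-th powers and the same nonzero value agree. -/
lemma eventuallyEq_of_pow_eq {β : ℕ} (hβ : β ≠ 0) {f g : ℂ → ℂ} (hf : AnalyticAt ℂ f 0)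
    (hg : AnalyticAt ℂ g 0) (h0 : f 0 = g 0) (hne : g 0 ≠ 0)
    (h : ∀ᶠ z in 𝓝 (0 : ℂ), f z ^ β = g z ^ β) : f =ᶠ[𝓝 0] g := by
  have hc : ContinuousAt (fun z => ∑ i ∈ Finset.range β, f z ^ i * g z ^ (β - 1 - i)) 0 := by
    have := hf.continuousAt
    have := hg.continuousAt
    fun_prop
  have hs : ∑ i ∈ Finset.range β, f 0 ^ i * g 0 ^ (β - 1 - i) ≠ 0 := by
    rw [h0, Finset.sum_congr rfl (g := fun _ => g 0 ^ (β - 1)) fun i hi => by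
      rw [← pow_add]; congr 1; have := Finset.mem_range.1 hi; omega]
    simp [hβ, hne]
  filter_upwards [h, hc.eventually_ne hs] with z hz hz'
  have := geom_sum₂_mul (f z) (g z) β
  rw [hz, sub_self] at this
  exact sub_eq_zero.1 ((mul_eq_zero.1 this).resolve_left hz')

/-- The branch of `(1 + x)^(1/β)` equal to `1` at `0`. -/
def rootOneAdd (β : ℕ) (x : ℂ) : ℂ := (1 + x) ^ ((β : ℂ)⁻¹)

lemma rootOneAdd_zero (β : ℕ) : rootOneAdd β 0 = 1 := by simp [rootOneAdd]

lemma rootOneAdd_pow {β : ℕ} (hβ : β ≠ 0) (x : ℂ) : rootOneAdd β x ^ β = 1 + x :=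
  Complex.cpow_nat_inv_pow _ hβ

lemma analyticAt_rootOneAdd (β : ℕ) : AnalyticAt ℂ (rootOneAdd β) 0 :=
  (analyticAt_const.add analyticAt_id).cpow analyticAt_const (by simp)

/-- A germ with nonvanishing derivative has an analytic left inverse. -/
lemma exists_leftInverse {p : ℂ → ℂ} (hp : AnalyticAt ℂ p 0) (h0 : p 0 = 0) (h1 : deriv p 0 ≠ 0) :
    ∃ P : ℂ → ℂ, AnalyticAt ℂ P 0 ∧ ∀ᶠ x in 𝓝 0, P (p x) = x := by
  refine ⟨hp.hasStrictDerivAt.localInverse _ _ _ h1, ?_, ?_⟩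
  · have := hp.analyticAt_localInverse h1
    rwa [h0] at this
  · exact HasStrictDerivAt.eventually_left_inverse ..

namespace Maps

/-- The quotient of the conjugate tangential component on the zero Segre variety by `χ`. -/
def vb (H : Maps Q Q') (χ : ℂ) : ℂ := ds (cf H.Fb 0) χ

lemma cf_Fb_eq_mul_vb (H : Maps Q Q') (χ : ℂ) : cf H.Fb 0 χ = χ * H.vb χ := by
  have := ds_expand (cf H.Fb 0) χ
  rwa [cf_Fb_zero_zero, zero_add] at this

lemma analyticAt_vb (H : Maps Q Q') : AnalyticAt ℂ H.vb 0 := (analyticAt_cf H.analytic_Fb 0).ds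

lemma vb_zero (H : Maps Q Q') : H.vb 0 = cj (H.J 0 0) := by
  rw [← cf_F_zero_eq, ← tc_conj (analyticAt_cf H.analytic_F 0),
    ← tc_congr (cf_conjGerm H.analytic_F 0)]
  rfl

lemma vb_zero_ne (hQ : IsNormalCoord Q) (hQ' : IsNormalCoord Q') (H : Maps Q Q') : H.vb 0 ≠ 0 := by
  rw [vb_zero]
  exact fun h => (hasTriangularJacobians hQ hQ' H).2.1 (cj_eq_zero.1 h)

/-- The functions `S(0, ·)` and `S'(0, ·)` vanish to the same finite positive order. -/
lemma exists_order (hQ : IsNormalCoord Q) (hQ' : IsNormalCoord Q') (nf : NormalForm Q m α R T S)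
    (nf' : NormalForm Q' m α R' T' S') (hα : 1 ≤ α) (H : Maps Q Q')
    (hne : ¬ ∀ᶠ χ in 𝓝 (0 : ℂ), S (0, χ) = 0 ∧ S' (0, χ) = 0) :
    ∃ (β : ℕ) (u u' : ℂ → ℂ), 1 ≤ β ∧ AnalyticAt ℂ u 0 ∧ AnalyticAt ℂ u' 0 ∧ u 0 ≠ 0 ∧ u' 0 ≠ 0 ∧
      (∀ᶠ χ in 𝓝 (0 : ℂ), S (0, χ) = χ ^ β * u χ) ∧
      ∀ᶠ y in 𝓝 (0 : ℂ), S' (0, y) = y ^ β * u' y := by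
  have hT := hasTriangularJacobians hQ hQ'
  have hid := H.base_identity hQ hQ' nf nf' hα
  have hU := (isBaseUnit_unit (Q' := Q') nf).isBase.analyticAt hT H
  have hU0 : unit m α S H 0 ≠ 0 := (isBaseUnit_unit (Q' := Q') nf).ne_zero hT H
  have hv := H.analyticAt_vb
  have hv0 := H.vb_zero_ne hQ hQ'
  have hf := analyticAt_cf H.analytic_Fb 0
  have hq : AnalyticAt ℂ (fun χ => S (0, χ)) 0 :=
    nf.analytic_S.comp_clm (ContinuousLinearMap.inr ℂ ℂ ℂ)
  have hq' : AnalyticAt ℂ (fun χ => S' (0, χ)) 0 :=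
    nf'.analytic_S.comp_clm (ContinuousLinearMap.inr ℂ ℂ ℂ)
  have hne' : ¬ ∀ᶠ χ in 𝓝 (0 : ℂ), S' (0, χ) = 0 := by
    intro h
    apply hne
    filter_upwards [hid, h, hf.eventually_comp (H.cf_Fb_zero_zero) h] with χ h1 h2 h3
    rw [h3, mul_zero] at h1
    exact ⟨(mul_eq_zero.1 h1).resolve_left (hT H).2.2, h2⟩
  obtain ⟨γ, u', hu', hu'0, hS'⟩ := hq'.exists_eventuallyEq_pow_smul_nonzero_iff.2 hne'
  simp only [sub_zero, smul_eq_mul] at hS'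
  have hfu : AnalyticAt ℂ (fun χ => u' (cf H.Fb 0 χ)) 0 := hu'.comp_zero hf H.cf_Fb_zero_zero
  have hid' : ∀ᶠ χ in 𝓝 (0 : ℂ), H.J 1 1 * S (0, χ) =
      χ ^ γ * (unit m α S H χ * (H.vb χ ^ γ * u' (cf H.Fb 0 χ))) := by
    filter_upwards [hid, hf.eventually_comp (H.cf_Fb_zero_zero) hS'] with χ h1 h2
    rw [h1, h2, H.cf_Fb_eq_mul_vb]
    ring
  have hr : AnalyticAt ℂ (fun χ => unit m α S H χ * (H.vb χ ^ γ * u' (cf H.Fb 0 χ))) 0 :=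
    hU.fun_mul ((hv.fun_pow γ).fun_mul hfu)
  have hr0 : unit m α S H 0 * (H.vb 0 ^ γ * u' (cf H.Fb 0 0)) ≠ 0 := by
    rw [H.cf_Fb_zero_zero]
    exact mul_ne_zero hU0 (mul_ne_zero (pow_ne_zero _ hv0) hu'0)
  have hneq : ¬ ∀ᶠ χ in 𝓝 (0 : ℂ), S (0, χ) = 0 := by
    intro h
    refine hr0 (eventuallyEq_of_pow_mul_eq (β := γ) hr analyticAt_const (g := fun _ => 0)
      ?_).self_of_nhds
    filter_upwards [h, hid'] with χ h1 h2
    rw [← h2, h1, mul_zero, mul_zero]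
  obtain ⟨β, u, hu, hu0, hS⟩ := hq.exists_eventuallyEq_pow_smul_nonzero_iff.2 hneq
  simp only [sub_zero, smul_eq_mul] at hS
  have hβγ : β = γ := by
    refine eq_of_pow_mul_eq (analyticAt_const.fun_mul hu) hr
      (mul_ne_zero (hT H).2.2 hu0) hr0 ?_
    filter_upwards [hS, hid'] with χ h1 h2
    rw [← h2, h1]
    ring
  subst hβγ
  refine ⟨β, u, u', Nat.one_le_iff_ne_zero.2 ?_, hu, hu', hu0, hu'0, hS, hS'⟩
  rintro rfl
  have h1 := hS.self_of_nhds
  have h2 : S (0, 0) = 0 := nf.S_zero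
  rw [h2, pow_zero, one_mul] at h1
  exact hu0 h1.symm

end Maps

lemma IsBase.of_isEmpty [IsEmpty (Maps Q Q')] (φ : Maps Q Q' → ℂ → ℂ) : IsBase φ :=
  ⟨fun _ => 0, fun _ _ _ _ => analyticAt_const, fun H => isEmptyElim H⟩

/-- The restriction of the map to the zero Segre variety is determined by its `1`-jet. -/
lemma IsBase.cf_Fb_zero (hQ : IsNormalCoord Q) (hQ' : IsNormalCoord Q')
    (nf : NormalForm Q m α R T S) (nf' : NormalForm Q' m α R' T' S') (hα : 1 ≤ α)
    {β : ℕ} {u u' : ℂ → ℂ} (hβ : 1 ≤ β) (hu : AnalyticAt ℂ u 0) (hu' : AnalyticAt ℂ u' 0)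
    (hu0 : u 0 ≠ 0) (hu'0 : u' 0 ≠ 0) (hS : ∀ᶠ χ in 𝓝 (0 : ℂ), S (0, χ) = χ ^ β * u χ)
    (hS' : ∀ᶠ y in 𝓝 (0 : ℂ), S' (0, y) = y ^ β * u' y) :
    IsBase fun H : Maps Q Q' => cf H.Fb 0 := by
  have hT := Maps.hasTriangularJacobians hQ hQ'
  have hβ0 : β ≠ 0 := Nat.one_le_iff_ne_zero.1 hβ
  set r' : ℂ → ℂ := fun x => rootOneAdd β (u' x / u' 0 - 1) with hr'
  have hr'a : AnalyticAt ℂ r' 0 := by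
    refine (analyticAt_rootOneAdd β).comp_zero ?_ ?_
    · exact (hu'.fun_div analyticAt_const hu'0).fun_sub analyticAt_const
    · simp [hu'0]
  have hr'0 : r' 0 = 1 := by simp [hr', hu'0, rootOneAdd_zero]
  have hp : AnalyticAt ℂ (fun x => x * r' x) 0 := analyticAt_id.fun_mul hr'a
  obtain ⟨P, hP, hPp⟩ := exists_leftInverse hp (by simp) (by
    have := (hasDerivAt_id (0 : ℂ)).mul hr'a.differentiableAt.hasDerivAt
    have h : HasDerivAt (fun x => x * r' x) (1 * r' 0 + 0 * deriv r' 0) 0 := this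
    rw [h.deriv, hr'0]
    simp)
  have hU := Maps.isBaseUnit_unit (Q' := Q') nf
  have hW : IsBaseUnit fun (H : Maps Q Q') χ => u χ * (Maps.unit m α S H χ)⁻¹ :=
    IsBaseUnit.mul (.of_eval (.of_analytic hu) (.const hu0) fun _ => rfl) hU.inv
  have hW0 : IsBaseUnit fun (H : Maps Q Q') (_ : ℂ) => u 0 * (Maps.unit m α S H 0)⁻¹ :=
    .of_eval hW.isBase.eval hW fun _ => rfl
  have hWW : IsBase fun (H : Maps Q Q') χ => u χ * (Maps.unit m α S H χ)⁻¹ *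
      (u 0 * (Maps.unit m α S H 0)⁻¹)⁻¹ + -1 := (hW.mul hW0.inv).isBase.add (.const _)
  have hWW0 : ∀ H : Maps Q Q', u 0 * (Maps.unit m α S H 0)⁻¹ *
      (u 0 * (Maps.unit m α S H 0)⁻¹)⁻¹ + -1 = 0 := fun H => by
    rw [mul_inv_cancel₀ (hW.ne_zero hT H), add_neg_cancel]
  have hs := hWW.comp (analyticAt_rootOneAdd β) hWW0
  set s : Maps Q Q' → ℂ → ℂ := fun H χ => rootOneAdd β (u χ * (Maps.unit m α S H χ)⁻¹ *
      (u 0 * (Maps.unit m α S H 0)⁻¹)⁻¹ + -1) with hsdef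
  have hs0 : ∀ H, s H 0 = 1 := fun H => by
    simp only [hsdef]; rw [hWW0, rootOneAdd_zero]
  have harg : IsBase fun (H : Maps Q Q') χ => χ * (cj (H.J 0 0) * s H χ) :=
    (IsBase.of_analytic analyticAt_id).mul ((IsBase.entry_snd 0 0).mul hs)
  refine (harg.comp hP fun H => by simp).congr fun H => ?_
  have hf := analyticAt_cf H.analytic_Fb 0
  have hid := H.base_identity hQ hQ' nf nf' hα
  have hfr : AnalyticAt ℂ (fun χ => r' (cf H.Fb 0 χ)) 0 := hr'a.comp_zero hf H.cf_Fb_zero_zero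
  have hfu : AnalyticAt ℂ (fun χ => u' (cf H.Fb 0 χ)) 0 := hu'.comp_zero hf H.cf_Fb_zero_zero
  have hUa := hU.isBase.analyticAt hT H
  have hU0 := hU.ne_zero hT H
  have hred : (fun χ => H.J 1 1 * u χ) =ᶠ[𝓝 0]
      fun χ => Maps.unit m α S H χ * (H.vb χ ^ β * u' (cf H.Fb 0 χ)) := by
    refine eventuallyEq_of_pow_mul_eq (β := β) (analyticAt_const.fun_mul hu)
      (hUa.fun_mul ((H.analyticAt_vb.fun_pow β).fun_mul hfu)) ?_
    filter_upwards [hid, hS, hf.eventually_comp (H.cf_Fb_zero_zero) hS'] with χ h1 h2 h3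
    rw [h2, h3, H.cf_Fb_eq_mul_vb] at h1
    rw [H.cf_Fb_eq_mul_vb]
    linear_combination h1
  have hred0 : H.J 1 1 * u 0 = Maps.unit m α S H 0 * (cj (H.J 0 0) ^ β * u' 0) := by
    have := hred.self_of_nhds
    simp only [H.cf_Fb_zero_zero, H.vb_zero] at this
    exact this
  have hvr : (fun χ => H.vb χ * r' (cf H.Fb 0 χ)) =ᶠ[𝓝 0] fun χ => cj (H.J 0 0) * s H χ := by
    refine eventuallyEq_of_pow_eq hβ0 (H.analyticAt_vb.fun_mul hfr)
      (analyticAt_const.fun_mul (hs.analyticAt hT H)) ?_ ?_ ?_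
    · rw [H.cf_Fb_zero_zero, H.vb_zero, hr'0, hs0]
    · rw [hs0, ← H.vb_zero, mul_one]
      exact H.vb_zero_ne hQ hQ'
    · filter_upwards [hred, hUa.continuousAt.eventually_ne hU0] with χ h1 hUχ
      simp only [hsdef, hr', mul_pow, rootOneAdd_pow hβ0]
      have hU0' : Maps.unit m α S H 0 ≠ 0 := hU0
      have hUχ' : Maps.unit m α S H χ ≠ 0 := hUχ
      have hJ := (hT H).2.2
      have e1 : H.vb χ ^ β * u' (cf H.Fb 0 χ) = H.J 1 1 * u χ / Maps.unit m α S H χ := by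
        rw [eq_div_iff hUχ', h1]; ring
      have e2 : cj (H.J 0 0) ^ β * u' 0 = H.J 1 1 * u 0 / Maps.unit m α S H 0 := by
        rw [eq_div_iff hU0', hred0]; ring
      have e3 : cj (H.J 0 0) ^ β = H.J 1 1 * u 0 / Maps.unit m α S H 0 / u' 0 := by
        rw [← e2, mul_div_cancel_right₀ _ hu'0]
      have e4 : H.vb χ ^ β * (1 + (u' (cf H.Fb 0 χ) / u' 0 - 1)) =
          (H.vb χ ^ β * u' (cf H.Fb 0 χ)) / u' 0 := by ring
      rw [e3, e4, e1]
      field_simp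
      ring
  filter_upwards [hvr, hf.eventually_comp (H.cf_Fb_zero_zero) hPp] with χ h1 h2
  rw [← h1]
  rw [← mul_assoc, ← H.cf_Fb_eq_mul_vb]
  exact h2

end

section

variable {m α : ℕ} {R T R' T' : ℂ × ℂ × ℂ → ℂ} {S S' : ℂ × ℂ → ℂ}

lemma iterate_ds_pow_mul {g : ℂ → ℂ} (hg : AnalyticAt ℂ g 0) (n : ℕ) :
    ds^[n] (fun z => z ^ n * g z) =ᶠ[𝓝 0] g := by
  induction n with
  | zero => exact Eventually.of_forall fun z => by simp
  | succ n ih =>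
    rw [Function.iterate_succ_apply]
    refine (iterate_ds_congr ?_ n).trans ih
    have hc := hg.continuousAt
    refine dslope_eq_of_expand (h := fun z => z ^ (n + 1) * g z) (a := 0)
      (g := fun z => z ^ n * g z) (by fun_prop) (Eventually.of_forall fun z => ?_)
    rw [smul_eq_mul]
    ring

lemma Maps.bar_cf_Fb (H : Maps Q Q') (j : ℕ) :
    (fun z => cj (cf H.Fb j (cj z))) =ᶠ[𝓝 0] cf H.F j := by
  filter_upwards [tendsto_cj.eventually (cf_conjGerm H.analytic_F j)] with z hz
  change cj (cf (conjGerm H.F) j (cj z)) = _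
  rw [hz, cj_cj, cj_cj]

/-- The derivative of a germ vanishing to order `β` vanishes to order `β - 1`. -/
lemma exists_deriv_order {β : ℕ} (hβ : 1 ≤ β) {q u : ℂ → ℂ} (hu : AnalyticAt ℂ u 0)
    (hu0 : u 0 ≠ 0) (hq : ∀ᶠ y in 𝓝 (0 : ℂ), q y = y ^ β * u y) {Ψ : ℂ × ℂ → ℂ}
    (hΨ : AnalyticAt ℂ Ψ 0)
    (hd : ∀ᶠ p : ℂ × ℂ in 𝓝 0, q (p.2 + p.1) = q p.2 + p.1 * Ψ p) :
    ∃ u₁ : ℂ → ℂ, AnalyticAt ℂ u₁ 0 ∧ u₁ 0 ≠ 0 ∧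
      ∀ᶠ y in 𝓝 (0 : ℂ), Ψ (0, y) = y ^ (β - 1) * u₁ y := by
  obtain ⟨D, hD, hDu⟩ := exists_diff_fst (E := ℂ)
    (hu.comp_clm (ContinuousLinearMap.fst ℂ ℂ ℂ))
  let L : ℂ × ℂ →L[ℂ] ℂ × ℂ × ℂ := (ContinuousLinearMap.fst ℂ ℂ ℂ).prod
    ((ContinuousLinearMap.snd ℂ ℂ ℂ).prod 0)
  have hDL := hD.comp_clm L
  have h1 := eventually_comp_clm L hDu
  change ∀ᶠ p : ℂ × ℂ in 𝓝 0, u (p.2 + p.1) = u p.2 + p.1 * D (L p) at h1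
  have h2 := eventually_comp_clm (ContinuousLinearMap.snd ℂ ℂ ℂ) hq
  have h3 := eventually_comp_clm
    (ContinuousLinearMap.snd ℂ ℂ ℂ + ContinuousLinearMap.fst ℂ ℂ ℂ) hq
  change ∀ᶠ p : ℂ × ℂ in 𝓝 0, q (p.2 + p.1) = (p.2 + p.1) ^ β * u (p.2 + p.1) at h3
  have huL := hu.comp_clm (ContinuousLinearMap.snd ℂ ℂ ℂ + ContinuousLinearMap.fst ℂ ℂ ℂ)
  let s : ℂ × ℂ → ℂ := fun p => ∑ i ∈ Finset.range β, (p.2 + p.1) ^ i * p.2 ^ (β - 1 - i)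
  have hs : AnalyticAt ℂ s 0 := Finset.analyticAt_fun_sum _ fun i _ =>
    ((analyticAt_snd.fun_add analyticAt_fst).fun_pow i).fun_mul (analyticAt_snd.fun_pow _)
  have key := eventually_eq_zero_of_pow_smul (m := 1)
    (f := fun p => Ψ p - (s p * u (p.2 + p.1) + p.2 ^ β * D (L p)))
    (hΨ.fun_sub ((hs.fun_mul huL).fun_add ((analyticAt_snd.fun_pow β).fun_mul hDL)))
    (ContinuousLinearMap.fst ℂ ℂ ℂ) (1, 0) rfl (by
      filter_upwards [hd, h1, h2, h3] with p hd h1 h2 h3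
      change q p.2 = p.2 ^ β * u p.2 at h2
      have hg : s p * ((p.2 + p.1) - p.2) = _ := geom_sum₂_mul (p.2 + p.1) p.2 β
      rw [h3, h2] at hd
      change p.1 ^ 1 * (Ψ p - (s p * u (p.2 + p.1) + p.2 ^ β * D (L p))) = 0
      linear_combination -hd - u (p.2 + p.1) * hg + p.2 ^ β * h1)
  refine ⟨fun y => β * u y + y * D (L (0, y)), ?_, ?_, ?_⟩
  · exact (analyticAt_const.fun_mul hu).fun_add (analyticAt_id.fun_mul
      (hDL.comp_clm (ContinuousLinearMap.inr ℂ ℂ ℂ)))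
  · simpa [hu0] using Nat.one_le_iff_ne_zero.1 hβ
  · filter_upwards [eventually_comp_clm (ContinuousLinearMap.inr ℂ ℂ ℂ) key] with y hy
    change Ψ (0, y) - (s (0, y) * u (y + 0) + y ^ β * D (L (0, y))) = 0 at hy
    have hs0 : s (0, y) = β * y ^ (β - 1) := by
      simp only [s, add_zero]
      rw [Finset.sum_congr rfl (g := fun _ => y ^ (β - 1)) fun i hi => by
        rw [← pow_add]; congr 1; have := Finset.mem_range.1 hi; omega]
      simp
    rw [hs0, add_zero] at hy
    obtain ⟨n, rfl⟩ : ∃ n, β = n + 1 := ⟨β - 1, by omega⟩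
    rw [Nat.add_sub_cancel] at hy ⊢
    linear_combination hy

lemma JetPoly.cf_Fb_top (hQ : IsNormalCoord Q) (hQ' : IsNormalCoord Q')
    (nf : NormalForm Q m α R T S) (nf' : NormalForm Q' m α R' T' S') (hα : 1 ≤ α)
    {β : ℕ} {u' : ℂ → ℂ} (hβ : 1 ≤ β) (hu' : AnalyticAt ℂ u' 0) (hu'0 : u' 0 ≠ 0)
    (hS' : ∀ᶠ y in 𝓝 (0 : ℂ), S' (0, y) = y ^ β * u' y)
    (hb : IsBase fun H : Maps Q Q' => cf H.F 0) {k : ℕ} (hk : 1 ≤ k)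
    (hf : ∀ j < k, JetPoly (k + 1) fun H : Maps Q Q' => cf H.F j) :
    JetPoly (k + 1) fun H : Maps Q Q' => cf H.Fb k := by
  have hT := Maps.hasTriangularJacobians hQ hQ'
  obtain ⟨Ψ, hΨ, hd⟩ := exists_diff_fst (E := ℂ)
    (nf'.analytic_S.comp_clm ((ContinuousLinearMap.snd ℂ ℂ ℂ).prod (ContinuousLinearMap.fst ℂ ℂ ℂ)))
  let L : ℂ × ℂ →L[ℂ] ℂ × ℂ × ℂ := (ContinuousLinearMap.fst ℂ ℂ ℂ).prod
    ((ContinuousLinearMap.snd ℂ ℂ ℂ).prod 0)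
  obtain ⟨u₁, hu₁, hu₁0, hΨu⟩ := exists_deriv_order hβ hu' hu'0 hS' (hΨ.comp_clm L)
    (eventually_comp_clm L hd)
  change ∀ᶠ y in 𝓝 (0 : ℂ), Ψ (0, y, 0) = y ^ (β - 1) * u₁ y at hΨu
  let V : Maps Q Q' → ℂ → ℂ := fun H χ =>
    Maps.unit m α S H χ * (Ψ (0, cf H.Fb 0 χ, 0) * cf H.Fb k χ)
  have htop : JetPoly (k + 1) fun H χ => V H χ - V H 0 :=
    JetPoly.top hQ hQ' nf nf' hα hk hb hf hΨ hd fun _ _ => rfl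
  have hU := Maps.isBaseUnit_unit (Q' := Q') nf
  have hΨ0 : AnalyticAt ℂ (fun y : ℂ => Ψ (0, y, 0)) 0 :=
    (hΨ.comp_clm L).comp_clm (ContinuousLinearMap.inr ℂ ℂ ℂ)
  have hΨb := hb.cf_Fb.comp hΨ0 fun H => H.cf_Fb_zero_zero
  have hV0 : JetPoly (k + 1) fun H (_ : ℂ) => V H 0 :=
    (((JetPoly.cf_Fb_zero (Nat.le_succ k)).base_mul hΨb.eval).base_mul hU.isBase.eval)
  have hV : JetPoly (k + 1) V := (htop.add hV0).congr fun H =>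
    Eventually.of_forall fun z => sub_add_cancel _ _
  have hvb : IsBaseUnit fun H : Maps Q Q' => H.vb :=
    .of_eval hb.cf_Fb.ds .entry00_conj fun H => H.vb_zero
  have hA : IsBaseUnit fun (H : Maps Q Q') χ =>
      Maps.unit m α S H χ * (H.vb χ ^ (β - 1) * u₁ (cf H.Fb 0 χ)) :=
    hU.mul ((hvb.pow _).mul (.of_eval (hb.cf_Fb.comp hu₁ fun H => H.cf_Fb_zero_zero)
      (.const hu₁0) fun H => by rw [H.cf_Fb_zero_zero]))
  refine ((hV.iterate_ds hT (β - 1)).base_mul hA.inv.isBase).congr fun H => ?_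
  have hAa := hA.isBase.analyticAt hT H
  have hfa := analyticAt_cf H.analytic_Fb 0
  have hVe : V H =ᶠ[𝓝 0] fun χ => χ ^ (β - 1) *
      (Maps.unit m α S H χ * (H.vb χ ^ (β - 1) * u₁ (cf H.Fb 0 χ)) * cf H.Fb k χ) := by
    filter_upwards [hfa.eventually_comp H.cf_Fb_zero_zero hΨu] with χ h
    simp only [V, h]
    nth_rw 1 [H.cf_Fb_eq_mul_vb]
    ring
  have hVd := (iterate_ds_congr hVe (β - 1)).trans
    (iterate_ds_pow_mul (hAa.fun_mul (analyticAt_cf H.analytic_Fb k)) (β - 1))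
  filter_upwards [hVd, hAa.continuousAt.eventually_ne (hA.ne_zero hT H)] with χ h1 h2
  rw [h1, inv_mul_cancel_left₀ h2]

/-- The `w`-jets of the map along the zero Segre variety are jet-polynomial. -/
lemma JetPoly.cf_F_and_cf_G (hQ : IsNormalCoord Q) (hQ' : IsNormalCoord Q')
    (hLF : NotLeviFlat Q) (k : ℕ) :
    (JetPoly (k + 1) fun H : Maps Q Q' => cf H.F k) ∧
      JetPoly (k + 1) fun H : Maps Q Q' => cf H.G k := by
  rcases isEmpty_or_nonempty (Maps Q Q') with he | ⟨⟨H₀⟩⟩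
  · exact ⟨.base (.of_isEmpty _), .base (.of_isEmpty _)⟩
  obtain ⟨m, α, R, T, R', T', S, S', nf, nf', hne⟩ := exists_normalForms hQ hQ' hLF
  have hα : 1 ≤ α + 1 := Nat.le_add_left 1 α
  obtain ⟨β, u, u', hβ, hu, hu', hu0, hu'0, hS, hS'⟩ := H₀.exists_order hQ hQ' nf nf' hα hne
  have hb : IsBase fun H : Maps Q Q' => cf H.F 0 :=
    (IsBase.cf_Fb_zero hQ hQ' nf nf' hα hβ hu hu' hu0 hu'0 hS hS').bar.congr
      fun H => H.bar_cf_Fb 0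
  have hF : ∀ k, JetPoly (k + 1) fun H : Maps Q Q' => cf H.F k := fun k => by
    induction k using Nat.strong_induction_on with
    | _ k ih =>
      rcases k.eq_zero_or_pos with rfl | hk
      · exact .base hb
      · exact (JetPoly.cf_Fb_top hQ hQ' nf nf' hα hβ hu' hu'0 hS' hb hk fun j hj =>
          (ih j hj).mono (by omega)).bar.congr fun H => H.bar_cf_Fb k
  refine ⟨hF k, ?_⟩
  rcases k with - | l
  · exact (JetPoly.const 0).congr fun H => by
      filter_upwards [H.G_z_zero hQ hQ'] with z hz
      exact hz.symm
  · exact JetPoly.cf_G hQ hQ' nf' (l := l) (by omega) (by omega) hb fun j hj =>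
      (hF j).mono (by omega)

end

end Parametrization

/-- Theorem 3.1: parametrization of jets along the zero Segre variety.
For `M, M'` not Levi-flat (in normal coordinates `Q, Q'`) and every `k ≥ 0` there is a
`ℂ²`-valued map `Φᵏ`, polynomial in the jet variables `(Λ₂, Λ̃₂) ∈ ℂ^{N_{k+1}} × ℂ^{N_{k+1}}`
(encoded by a finite set `S` of multi-indices and coefficient functions `c`), whose
coefficients are holomorphic in `(z, Λ₁, Λ̃₁)` on a neighborhood `V` of
`{0} × T(ℂ²) × conj(T(ℂ²))`, such that every local biholomorphism `H = (F, G)` sending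
`M` into `M'` satisfies `∂_w^k H(z, 0) = Φᵏ(z, H'(0), conj H'(0), j₀^{k+1}H, conj j₀^{k+1}H)`
for `z` near `0`. -/
theorem jet_parametrization_along_segre
    (Q Q' : ℂ → ℂ → ℂ → ℂ) (hQ : IsNormalCoord Q) (hQ' : IsNormalCoord Q')
    (hLF : NotLeviFlat Q) (hLF' : NotLeviFlat Q') (k : ℕ) :
    ∃ (V : Set (ℂ × Matrix (Fin 2) (Fin 2) ℂ × Matrix (Fin 2) (Fin 2) ℂ))
      (S : Finset ((JetIdx (k + 1) → ℕ) × (JetIdx (k + 1) → ℕ)))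
      (c : ((JetIdx (k + 1) → ℕ) × (JetIdx (k + 1) → ℕ)) →
        ℂ × Matrix (Fin 2) (Fin 2) ℂ × Matrix (Fin 2) (Fin 2) ℂ → ℂ × ℂ),
      IsOpen V ∧
      (∀ A B : Matrix (Fin 2) (Fin 2) ℂ, A ∈ Tmat → B ∈ TmatConj → ((0 : ℂ), A, B) ∈ V) ∧
      (∀ ab ∈ S, AnalyticOnNhd ℂ (c ab) V) ∧
      ∀ F G : ℂ → ℂ → ℂ, SendsInto Q Q' F G → JacDet F G ≠ 0 →
        ∀ᶠ z : ℂ in 𝓝 0,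
          (z, Jmat F G, (Jmat F G).map cj) ∈ V ∧
          (deriv^[k] (F z) 0, deriv^[k] (G z) 0) =
            ∑ ab ∈ S,
              ((∏ i, jetMap (k + 1) F G i ^ ab.1 i) *
                (∏ i, cj (jetMap (k + 1) F G i) ^ ab.2 i)) •
                c ab (z, Jmat F G, (Jmat F G).map cj) := by
  have hT : HasTriangularJacobians Q Q' := Maps.hasTriangularJacobians hQ hQ'
  obtain ⟨hF, hG⟩ := JetPoly.cf_F_and_cf_G hQ hQ' hLF k
  obtain ⟨V, S, c, hV, hmem, hc, h⟩ := ((JetPoly.const (k.factorial : ℂ)).mul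
    hF).exists_parametrization hT ((JetPoly.const (k.factorial : ℂ)).mul hG)
  refine ⟨V, S, c, hV, hmem, hc, fun F G hH hJ => ?_⟩
  filter_upwards [h ⟨(F, G), hH, hJ⟩, deriv_iterate_eq_cf hH.1 k, deriv_iterate_eq_cf hH.2.1 k]
    with z hz hzF hzG
  refine ⟨hz.1, ?_⟩
  rw [hzF, hzG]
  exact hz.2
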